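/- Feigenbaum's parameter scaling law for the period-doubling cascade of the quadratic family: let c_F = sup{c ∈ ℝ : P_c has a real periodic point whose least period is not a power of 2} (the Feigenbaum parameter value), and for each integer n ≥ 0 let c_n = sup{c ∈ ℝ : 0 is a periodic point of P_c of least period exactly 2ⁿ} (the superattracting parameter of period 2ⁿ in the doubling cascade). Then c_n > c_F for all n, and there exist real constants λ > 1 and b > 0 such that λⁿ·(c_n − c_F) → b as n → ∞; in particular c_n − c_F ∼ b·λ^{−n}. -/

import Mathlib

open Filter

/-- The Feigenbaum parameter value: the supremum of the set of real parameters `c` for which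
`P_c : x ↦ x² + c` has a real periodic point whose least period is not a power of `2`. -/
noncomputable def feigenbaumValue : ℝ :=
  sSup {c : ℝ | ∃ x : ℝ, 0 < Function.minimalPeriod (fun y : ℝ => y ^ 2 + c) x ∧
    ¬∃ m : ℕ, Function.minimalPeriod (fun y : ℝ => y ^ 2 + c) x = 2 ^ m}

/-- The superattracting parameter of period `2ⁿ` in the period-doubling cascade:
the supremum of the set of real `c` for which `0` is a periodic point of `P_c` of least
period exactly `2ⁿ`. -/
noncomputable def doublingSuperattracting (n : ℕ) : ℝ :=
  sSup {c : ℝ | Function.minimalPeriod (fun y : ℝ => y ^ 2 + c) 0 = 2 ^ n}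

section
open Filter Topology

namespace FB

noncomputable def Rn (f : ℝ → ℝ) : ℝ → ℝ := fun x => f (f (f 1 * x)) / f 1

structure Good (L : ℝ) (f : ℝ → ℝ) : Prop where
  even : ∀ x, f (-x) = f x
  zero : f 0 = 1
  anti : StrictAntiOn f (Set.Icc 0 1)
  lip : ∀ x y, |x| ≤ 1 → |y| ≤ 1 → |f x - f y| ≤ L * |x ^ 2 - y ^ 2|

def Lev : ℕ → (ℝ → ℝ) → Prop
  | 0, f => 0 < f 1
  | n + 1, f => -1 < f 1 ∧ f 1 < 0 ∧ 0 < f (f 1) ∧ Lev n (Rn f)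

def Zer : ℕ → (ℝ → ℝ) → Prop
  | 0, f => f 1 = 0
  | n + 1, f => -1 < f 1 ∧ f 1 < 0 ∧ 0 < f (f 1) ∧ Zer n (Rn f)

def LZ (n : ℕ) (f : ℝ → ℝ) : Prop := Lev n f ∨ Zer n f

theorem LZ_zero {f : ℝ → ℝ} : LZ 0 f ↔ 0 ≤ f 1 := by
  simp only [LZ, Lev, Zer]
  rw [le_iff_lt_or_eq]; tauto

theorem LZ_succ {n : ℕ} {f : ℝ → ℝ} :
    LZ (n + 1) f ↔ -1 < f 1 ∧ f 1 < 0 ∧ 0 < f (f 1) ∧ LZ n (Rn f) := by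
  simp only [LZ, Lev, Zer]; tauto

theorem LZ.gt {n : ℕ} {f : ℝ → ℝ} (h : LZ n f) : -1 < f 1 := by
  cases n with
  | zero => rw [LZ_zero] at h; linarith
  | succ n => rw [LZ_succ] at h; exact h.1

theorem Good.abs {L : ℝ} {f : ℝ → ℝ} (g : Good L f) (x : ℝ) : f |x| = f x := by
  rcases abs_choice x with h | h <;> rw [h]
  exact g.even x

theorem Good.bd {L : ℝ} {f : ℝ → ℝ} (g : Good L f) {x y : ℝ} (h : |x| ≤ |y|) (hy : |y| ≤ 1) :
    f y ≤ f x := by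
  rw [← g.abs x, ← g.abs y]
  exact g.anti.antitoneOn ⟨abs_nonneg x, h.trans hy⟩ ⟨abs_nonneg y, hy⟩ h

theorem Good.inv {L : ℝ} {f : ℝ → ℝ} (g : Good L f) (h1 : -1 ≤ f 1) {x : ℝ} (hx : |x| ≤ 1) :
    f 1 ≤ f x ∧ f x ≤ 1 ∧ |f x| ≤ 1 := by
  have h2 : f 1 ≤ f x := g.bd (by simpa using hx) (by simp)
  have h3 : f x ≤ 1 := by
    have := g.bd (x := 0) (y := x) (by simp) hx
    rwa [g.zero] at this
  exact ⟨h2, h3, abs_le.2 ⟨by linarith, h3⟩⟩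

theorem Good.iter {L : ℝ} {f : ℝ → ℝ} (g : Good L f) (h1 : -1 ≤ f 1) {x : ℝ} (hx : |x| ≤ 1)
    (n : ℕ) : |f^[n] x| ≤ 1 := by
  induction n with
  | zero => simpa
  | succ n ih => rw [Function.iterate_succ_apply']; exact (g.inv h1 ih).2.2

theorem Rn_iter {f : ℝ → ℝ} (h : f 1 ≠ 0) (m : ℕ) (x : ℝ) :
    f 1 * (Rn f)^[m] x = f^[2 * m] (f 1 * x) := by
  induction m with
  | zero => simp
  | succ m ih =>
    rw [Function.iterate_succ_apply', Nat.mul_succ, Function.iterate_succ_apply',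
      Function.iterate_succ_apply', ← ih]
    simp only [Rn]
    field_simp

theorem Good.Rn {L : ℝ} {f : ℝ → ℝ} (g : Good L f) (h1 : -1 < f 1) (h2 : f 1 < 0)
    (h3 : 0 < f (f 1)) : Good (2 * L ^ 2) (Rn f) := by
  have hs : |f 1| ≤ 1 := abs_le.2 ⟨h1.le, by linarith⟩
  have hL : 0 ≤ L := by
    have := g.lip 1 0 (by simp) (by simp)
    norm_num at this
    exact (abs_nonneg _).trans this
  have hm : ∀ x : ℝ, |x| ≤ 1 → |f 1 * x| ≤ 1 := fun x hx => by
    rw [abs_mul]; exact mul_le_one₀ hs (abs_nonneg _) hx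
  refine ⟨fun x => ?_, ?_, ?_, ?_⟩
  · simp only [FB.Rn]; rw [mul_neg, g.even]
  · simp only [FB.Rn]; rw [mul_zero, g.zero, div_self h2.ne]
  · intro x hx y hy hxy
    simp only [FB.Rn]
    have e : ∀ z : ℝ, f (f 1 * z) = f (-f 1 * z) := fun z => by
      rw [neg_mul, g.even]
    have i1 : ∀ z ∈ Set.Icc (0:ℝ) 1, -f 1 * z ∈ Set.Icc (0:ℝ) 1 := fun z hz =>
      ⟨by nlinarith [hz.1], by nlinarith [hz.1, hz.2]⟩
    have i2 : ∀ z ∈ Set.Icc (0:ℝ) 1, f (f 1 * z) ∈ Set.Icc (0:ℝ) 1 := fun z hz => by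
      have a1 : |z| ≤ 1 := abs_le.2 ⟨by linarith [hz.1], hz.2⟩
      refine ⟨?_, (g.inv h1.le (hm z a1)).2.1⟩
      refine h3.le.trans (g.bd ?_ hs)
      rw [abs_mul]; exact mul_le_of_le_one_right (abs_nonneg _) a1
    have k1 : f (f 1 * y) < f (f 1 * x) := by
      rw [e, e]; exact g.anti (i1 x hx) (i1 y hy) (by nlinarith)
    have k2 := g.anti (i2 y hy) (i2 x hx) k1
    exact div_lt_div_of_neg_of_lt h2 k2
  · intro x y hx hy
    simp only [FB.Rn]
    rw [← sub_div, abs_div, div_le_iff₀ (abs_pos.2 h2.ne)]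
    have q1 := g.inv h1.le (hm x hx)
    have q2 := g.inv h1.le (hm y hy)
    have l1 := g.lip _ _ q1.2.2 q2.2.2
    have l2 := g.lip _ _ (hm x hx) (hm y hy)
    have l3 : |f (f 1 * x) ^ 2 - f (f 1 * y) ^ 2| ≤ 2 * |f (f 1 * x) - f (f 1 * y)| := by
      rw [sq_sub_sq, abs_mul]
      refine mul_le_mul_of_nonneg_right ?_ (abs_nonneg _)
      refine (abs_add_le _ _).trans ?_
      linarith [q1.2.2, q2.2.2]
    have l4 : |(f 1 * x) ^ 2 - (f 1 * y) ^ 2| = |f 1| * |f 1| * |x ^ 2 - y ^ 2| := by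
      rw [← abs_mul, ← abs_mul]; congr 1; ring
    have l5 : |f 1| * |f 1| * |x ^ 2 - y ^ 2| ≤ |x ^ 2 - y ^ 2| * |f 1| := by
      nlinarith [mul_nonneg (mul_nonneg (abs_nonneg (f 1)) (abs_nonneg (x ^ 2 - y ^ 2)))
        (sub_nonneg.2 hs)]
    calc _ ≤ L * (2 * (L * (|x ^ 2 - y ^ 2| * |f 1|))) := by
          refine l1.trans (mul_le_mul_of_nonneg_left (l3.trans ?_) hL)
          refine mul_le_mul_of_nonneg_left (l2.trans ?_) (by norm_num)
          rw [l4]; exact mul_le_mul_of_nonneg_left l5 hL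
      _ = _ := by ring

theorem Good.near {L : ℝ} {f : ℝ → ℝ} (g : Good L f) (h1 : -1 < f 1) (h2 : f 1 < 0) :
    |FB.Rn f 1 - 1| ≤ 2 * L ^ 2 * |f 1| := by
  have hs : |f 1| ≤ 1 := abs_le.2 ⟨h1.le, by linarith⟩
  have hL : 0 ≤ L := by
    have := g.lip 1 0 (by simp) (by simp)
    norm_num at this
    exact (abs_nonneg _).trans this
  have e : FB.Rn f 1 - 1 = (f (f (f 1)) - f 1) / f 1 := by
    simp only [FB.Rn]; rw [mul_one, sub_div, div_self h2.ne]
  rw [e, abs_div, div_le_iff₀ (abs_pos.2 h2.ne)]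
  have q := g.inv h1.le hs
  have l1 := g.lip (f (f 1)) 1 q.2.2 (by simp)
  have l2 := g.lip (f 1) 0 hs (by simp)
  rw [g.zero] at l2
  have l3 : |f (f 1) ^ 2 - 1 ^ 2| ≤ 2 * |f (f 1) - 1| := by
    rw [sq_sub_sq, abs_mul]
    refine mul_le_mul_of_nonneg_right ?_ (abs_nonneg _)
    refine (abs_add_le _ _).trans ?_
    have := q.2.2
    norm_num; linarith
  have l4 : |f 1 ^ 2 - 0 ^ 2| = |f 1| * |f 1| := by rw [← abs_mul]; congr 1; ring
  rw [l4] at l2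
  calc _ ≤ L * (2 * (L * (|f 1| * |f 1|))) :=
        l1.trans (mul_le_mul_of_nonneg_left (l3.trans (by linarith)) hL)
    _ = _ := by ring

theorem mono_per {g : ℝ → ℝ} {S : Set ℝ} (hg : StrictMonoOn g S) {x : ℝ} {q : ℕ} (hq : 0 < q)
    (hS : ∀ n, g^[n] x ∈ S) (hx : g^[q] x = x) : g x = x := by
  obtain ⟨q, rfl⟩ : ∃ p, q = p + 1 := ⟨q - 1, by omega⟩
  rcases lt_trichotomy (g x) x with h | h | h
  · exfalso
    have : ∀ n, g^[n + 1] x < x := by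
      intro n
      induction n with
      | zero => simpa
      | succ n ih =>
        rw [Function.iterate_succ_apply']
        exact (hg (hS _) (hS 0) ih).trans h
    exact (this q).ne hx
  · exact h
  · exfalso
    have : ∀ n, x < g^[n + 1] x := by
      intro n
      induction n with
      | zero => simpa
      | succ n ih =>
        rw [Function.iterate_succ_apply']
        exact h.trans (hg (hS 0) (hS _) ih)
    exact (this q).ne' hx

theorem anti_per {f : ℝ → ℝ} {S : Set ℝ} (hf : StrictAntiOn f S) {x : ℝ} {q : ℕ} (hq : 0 < q)
    (hS : ∀ n, f^[n] x ∈ S) (hx : f^[q] x = x) : f^[2 ^ 1] x = x := by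
  have key : ∀ n y, (f ∘ f)^[n] y = f^[2 * n] y := by
    intro n y
    rw [Function.iterate_mul]; rfl
  have e : f^[2 ^ 1] x = (f ∘ f) x := rfl
  rw [e]
  refine mono_per (S := {y | y ∈ S ∧ f y ∈ S}) (q := q) ?_ hq ?_ ?_
  · intro a ha b hb hab
    exact hf hb.2 ha.2 (hf ha.1 hb.1 hab)
  · intro n
    rw [key]
    refine ⟨hS _, ?_⟩
    rw [← Function.iterate_succ_apply' f]; exact hS _
  · rw [key, mul_comm, Function.iterate_mul]
    simp [hx]

theorem Good.per {L : ℝ} {f : ℝ → ℝ} (n : ℕ) (g : Good L f) (h : LZ n f) {x : ℝ}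
    (hx : |x| ≤ 1) {q : ℕ} (hq : 0 < q) (hp : f^[q] x = x) : ∃ m, f^[2 ^ m] x = x := by
  induction n generalizing L f x q with
  | zero =>
    rw [LZ_zero] at h
    refine ⟨1, anti_per g.anti hq (fun n => ?_) hp⟩
    have : f^[n] x = f^[n + q] x := by rw [Function.iterate_add_apply, hp]
    rw [this]
    obtain ⟨q, rfl⟩ : ∃ p, q = p + 1 := ⟨q - 1, by omega⟩
    rw [← add_assoc, Function.iterate_succ_apply']
    have := g.inv (by linarith) (g.iter (by linarith) hx (n + q))
    exact ⟨h.trans this.1, this.2.1⟩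
  | succ n ih =>
    rw [LZ_succ] at h
    obtain ⟨h1, h2, h3, h4⟩ := h
    have hs : |f 1| ≤ 1 := abs_le.2 ⟨h1.le, by linarith⟩
    by_cases hJ : ∃ i, |f^[i] x| ≤ |f 1|
    · obtain ⟨i, hi⟩ := hJ
      set z := f^[i] x / f 1 with hz
      have hz1 : f 1 * z = f^[i] x := by rw [hz]; exact mul_div_cancel₀ _ h2.ne
      have hz2 : |z| ≤ 1 := by
        rw [hz, abs_div]; exact div_le_one_of_le₀ hi (abs_nonneg _)
      have hzq : (FB.Rn f)^[q] z = z := by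
        apply mul_left_cancel₀ h2.ne
        rw [Rn_iter h2.ne, hz1, ← Function.iterate_add_apply, add_comm,
          Function.iterate_add_apply, mul_comm 2 q, Function.iterate_mul]
        simp [hp]
      obtain ⟨m, hm⟩ := ih (g.Rn h1 h2 h3) h4 hz2 hq hzq
      refine ⟨m + 1, ?_⟩
      have k := Rn_iter h2.ne (2 ^ m) z
      rw [hm, hz1] at k
      rw [pow_succ, mul_comm]
      obtain ⟨j, hj⟩ : ∃ j, j + i = q * (i + 1) := ⟨q * (i + 1) - i, by
        have : i + 1 ≤ q * (i + 1) := Nat.le_mul_of_pos_left _ hq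
        omega⟩
      have e : f^[j] (f^[i] x) = x := by
        rw [← Function.iterate_add_apply, hj, Function.iterate_mul]
        exact Function.iterate_fixed hp _
      rw [← Function.iterate_add_apply] at k
      have k2 := congrArg (f^[j]) k
      rw [e, ← Function.iterate_add_apply] at k2
      have : j + (2 * 2 ^ m + i) = 2 * 2 ^ m + (j + i) := by ring
      rw [this, Function.iterate_add_apply, Function.iterate_add_apply, e] at k2
      exact k2.symm
    · push Not at hJ
      refine ⟨1, anti_per g.anti hq (fun n => ?_) hp⟩
      have hlt := hJ n
      have : f^[n] x = f^[n + q] x := by rw [Function.iterate_add_apply, hp]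
      rw [this] at hlt ⊢
      obtain ⟨q, rfl⟩ : ∃ p, q = p + 1 := ⟨q - 1, by omega⟩
      rw [← add_assoc, Function.iterate_succ_apply'] at hlt ⊢
      have := g.inv h1.le (g.iter h1.le hx (n + q))
      refine ⟨?_, this.2.1⟩
      by_contra hneg
      push Not at hneg
      rw [abs_of_neg hneg, abs_of_neg h2] at hlt
      linarith [this.1]

theorem Lev.notper {L : ℝ} {f : ℝ → ℝ} {n : ℕ} (g : Good L f) (h : Lev n f) {q : ℕ}
    (hq : 0 < q) : f^[q] 0 ≠ 0 := by
  induction n generalizing L f q with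
  | zero =>
    obtain ⟨q, rfl⟩ : ∃ p, q = p + 1 := ⟨q - 1, by omega⟩
    have h' : 0 < f 1 := h
    rw [Function.iterate_succ_apply']
    exact (h'.trans_le (g.inv (by linarith) (g.iter (by linarith) (by simp) q)).1).ne'
  | succ n ih =>
    have hh : LZ (n + 1) f := Or.inl h
    obtain ⟨h1, h2, h3, h4⟩ := h
    have g' := g.Rn h1 h2 h3
    have hs : |f 1| ≤ 1 := abs_le.2 ⟨h1.le, by linarith⟩
    rcases Nat.even_or_odd' q with ⟨m, rfl | rfl⟩
    · have := Rn_iter h2.ne m 0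
      rw [mul_zero] at this
      rw [← this]
      exact mul_ne_zero h2.ne (ih g' h4 (by omega))
    · have := Rn_iter h2.ne m 0
      rw [mul_zero] at this
      rw [Function.iterate_succ_apply', ← this]
      have k : |(FB.Rn f)^[m] 0| ≤ 1 := g'.iter (LZ.gt (Or.inl h4)).le (by simp) m
      refine (h3.trans_le (g.bd ?_ hs)).ne'
      rw [abs_mul]; exact mul_le_of_le_one_right (abs_nonneg _) k

theorem Zer.zero {f : ℝ → ℝ} {n : ℕ} {L : ℝ} (g : Good L f) (h : Zer n f) :
    f^[2 ^ (n + 1)] 0 = 0 ∧ 0 < (-1) ^ n * f^[2 ^ n] 0 := by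
  induction n generalizing L f with
  | zero =>
    have h' : f 1 = 0 := h
    simp [g.zero, h']
  | succ n ih =>
    obtain ⟨h1, h2, h3, h4⟩ := h
    have k := ih (g.Rn h1 h2 h3) h4
    constructor
    · have := Rn_iter h2.ne (2 ^ (n + 1)) 0
      rw [mul_zero, k.1, mul_zero] at this
      rw [pow_succ, mul_comm, ← this]
    · have := Rn_iter h2.ne (2 ^ n) 0
      rw [mul_zero] at this
      rw [pow_succ 2 n, mul_comm (2 ^ n), ← this, pow_succ]
      have := mul_pos k.2 (neg_pos.2 h2)
      linarith

theorem prod_split (g : ℕ → ℝ) (n : ℕ) : ∏ i ∈ Finset.range (2 * n + 1), g (i + 1) =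
    (∏ m ∈ Finset.range (n + 1), g (2 * m + 1)) * ∏ m ∈ Finset.range n, g (2 * (m + 1)) := by
  induction n with
  | zero => simp
  | succ n ih =>
    rw [show 2 * (n + 1) + 1 = 2 * n + 1 + 1 + 1 by ring, Finset.prod_range_succ,
      Finset.prod_range_succ, ih, Finset.prod_range_succ _ (n + 1),
      Finset.prod_range_succ (fun m => g (2 * (m + 1))) n]
    rw [show 2 * n + 1 + 1 = 2 * (n + 1) by ring]
    ring

theorem Zer.prod {f : ℝ → ℝ} {n : ℕ} {L : ℝ} (g : Good L f) (h : Zer n f) :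
    0 < (-1) ^ n * ∏ i ∈ Finset.range (2 ^ (n + 1) - 1), f^[i + 1] 0 := by
  induction n generalizing L f with
  | zero => simp [g.zero]
  | succ n ih =>
    obtain ⟨h1, h2, h3, h4⟩ := h
    have g' := g.Rn h1 h2 h3
    have k := ih g' h4
    have hs : |f 1| ≤ 1 := abs_le.2 ⟨h1.le, by linarith⟩
    obtain ⟨M, hM⟩ : ∃ M, 2 ^ (n + 1) = M + 1 := ⟨2 ^ (n + 1) - 1, by
      have : 0 < 2 ^ (n + 1) := by positivity
      omega⟩
    have hodd : Odd M := by
      have : Even (M + 1) := by rw [← hM]; exact ⟨2 ^ n, by ring⟩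
      exact Nat.not_even_iff_odd.1 fun hM => by
        rw [Nat.even_add_one] at this; exact this hM
    rw [hM, Nat.add_sub_cancel] at k
    rw [show 2 ^ (n + 1 + 1) - 1 = 2 * M + 1 by rw [pow_succ, hM]; omega,
      prod_split (fun i => f^[i] 0)]
    have p1 : 0 < ∏ m ∈ Finset.range (M + 1), f^[2 * m + 1] 0 := by
      refine Finset.prod_pos fun m _ => ?_
      have := Rn_iter h2.ne m 0
      rw [mul_zero] at this
      rw [Function.iterate_succ_apply', ← this]
      have k : |(FB.Rn f)^[m] 0| ≤ 1 := g'.iter (LZ.gt (Or.inr h4)).le (by simp) m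
      refine (h3.trans_le (g.bd ?_ hs))
      rw [abs_mul]; exact mul_le_of_le_one_right (abs_nonneg _) k
    have p2 : ∏ m ∈ Finset.range M, f^[2 * (m + 1)] 0 =
        f 1 ^ M * ∏ m ∈ Finset.range M, (FB.Rn f)^[m + 1] 0 := by
      rw [← Finset.card_range M, ← Finset.prod_const, Finset.card_range,
        ← Finset.prod_mul_distrib]
      refine Finset.prod_congr rfl fun m _ => ?_
      rw [Rn_iter h2.ne, mul_zero]
    rw [p2]
    have p3 : f 1 ^ M < 0 := hodd.pow_neg h2
    rw [pow_succ]
    nlinarith [mul_pos p1 (mul_pos k (neg_pos.2 p3))]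

theorem Rn_pow {f : ℝ → ℝ} (h0 : f 0 = 1) {n : ℕ} (h : ∀ k < n, f^[2 ^ (k + 1)] 0 ≠ 0) (x : ℝ) :
    Rn^[n] f x = f^[2 ^ n] (f^[2 ^ n] 0 * x) / f^[2 ^ n] 0 := by
  induction n generalizing x with
  | zero => simp [h0]
  | succ n ih =>
    have ih := ih (fun k hk => h k (by omega))
    have hS : f^[2 ^ n] 0 ≠ 0 := by
      cases n with
      | zero => simp [h0]
      | succ n => exact h n (by omega)
    rw [Function.iterate_succ_apply']
    have e1 : Rn^[n] f 1 = f^[2 ^ (n + 1)] 0 / f^[2 ^ n] 0 := by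
      rw [ih, mul_one, ← Function.iterate_add_apply]; congr 2; ring
    rw [show Rn (Rn^[n] f) x = Rn^[n] f (Rn^[n] f (Rn^[n] f 1 * x)) / Rn^[n] f 1 from rfl, e1, ih,
      ih, mul_div_cancel₀ _ hS, div_div, mul_div_cancel₀ _ hS]
    rw [← Function.iterate_add_apply, show 2 ^ n + 2 ^ n = 2 ^ (n + 1) by ring]
    congr 2
    rw [← mul_assoc, mul_div_cancel₀ _ hS]

end FB

namespace FB

def JC (f : ℝ → ℝ → ℝ) (c : ℝ) : Prop := ∀ x, ContinuousAt (fun p : ℝ × ℝ => f p.1 p.2) (c, x)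

theorem JC.at {f : ℝ → ℝ → ℝ} {c : ℝ} (h : JC f c) {u : ℝ → ℝ} (hu : ContinuousAt u c) :
    ContinuousAt (fun c' => f c' (u c')) c :=
  ContinuousAt.comp (f := fun c' => (c', u c')) (g := fun p : ℝ × ℝ => f p.1 p.2) (h (u c))
    (continuousAt_id.prodMk hu)

theorem JC.one {f : ℝ → ℝ → ℝ} {c : ℝ} (h : JC f c) : ContinuousAt (fun c' => f c' 1) c :=
  h.at continuousAt_const

theorem JC.two {f : ℝ → ℝ → ℝ} {c : ℝ} (h : JC f c) : ContinuousAt (fun c' => f c' (f c' 1)) c :=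
  h.at h.one

theorem JC.Rn {f : ℝ → ℝ → ℝ} {c : ℝ} (h : JC f c) (h1 : f c 1 ≠ 0) :
    JC (fun c' => Rn (f c')) c := by
  intro x
  have k1 : ContinuousAt (fun p : ℝ × ℝ => f p.1 1) (c, x) :=
    ContinuousAt.comp (f := fun p : ℝ × ℝ => (p.1, (1:ℝ))) (g := fun p : ℝ × ℝ => f p.1 p.2) (h 1)
      (by fun_prop)
  have k2 : ContinuousAt (fun p : ℝ × ℝ => f p.1 (f p.1 1 * p.2)) (c, x) :=
    ContinuousAt.comp (f := fun p : ℝ × ℝ => (p.1, f p.1 1 * p.2))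
      (g := fun p : ℝ × ℝ => f p.1 p.2) (h _) (by
        exact continuousAt_fst.prodMk (k1.mul continuousAt_snd))
  have k3 : ContinuousAt (fun p : ℝ × ℝ => f p.1 (f p.1 (f p.1 1 * p.2))) (c, x) :=
    ContinuousAt.comp (f := fun p : ℝ × ℝ => (p.1, f p.1 (f p.1 1 * p.2)))
      (g := fun p : ℝ × ℝ => f p.1 p.2) (h _) (by
        exact continuousAt_fst.prodMk k2)
  exact k3.div k1 h1

theorem Lev_open {f : ℝ → ℝ → ℝ} {c : ℝ} {n : ℕ} (h : JC f c) (hl : Lev n (f c)) :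
    ∀ᶠ c' in 𝓝 c, Lev n (f c') := by
  induction n generalizing f with
  | zero => exact h.one.eventually (lt_mem_nhds hl)
  | succ n ih =>
    obtain ⟨h1, h2, h3, h4⟩ := hl
    filter_upwards [h.one.eventually (lt_mem_nhds h1), h.one.eventually (gt_mem_nhds h2),
      h.two.eventually (lt_mem_nhds h3), ih (h.Rn h2.ne) h4] with c' a b c d
    exact ⟨a, b, c, d⟩

theorem LZ_close {f : ℝ → ℝ → ℝ} {c L : ℝ} {n : ℕ} {l : Filter ℝ} [l.NeBot] (hl : l ≤ 𝓝 c)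
    (h : JC f c) (hg : ∀ᶠ c' in l, Good L (f c')) (hc : Good L (f c))
    (hn : ∀ᶠ c' in l, LZ n (f c')) : LZ n (f c) ∨ ∃ j, j + 1 = n ∧ Zer j (f c) := by
  induction n generalizing f L with
  | zero =>
    left
    rw [LZ_zero]
    refine ge_of_tendsto (h.one.tendsto.mono_left hl) ?_
    filter_upwards [hn] with c' h'
    rwa [LZ_zero] at h'
  | succ n ih =>
    simp only [LZ_succ] at hn
    have t1 := h.one.tendsto.mono_left hl
    have a1 : -1 ≤ f c 1 := ge_of_tendsto t1 (hn.mono fun c' h => h.1.le)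
    have a2 : f c 1 ≤ 0 := le_of_tendsto t1 (hn.mono fun c' h => h.2.1.le)
    have a3 : 0 ≤ f c (f c 1) :=
      ge_of_tendsto (h.two.tendsto.mono_left hl) (hn.mono fun c' h => h.2.2.1.le)
    have b1 : -1 < f c 1 := by
      refine lt_of_le_of_ne a1 fun e => ?_
      rw [← e, hc.even, ← e] at a3
      linarith
    rcases a2.lt_or_eq with b2 | b2
    · have hR := h.Rn b2.ne
      have b3 : 0 < f c (f c 1) := by
        refine lt_of_le_of_ne a3 fun e => ?_
        have t : -1 ≤ Rn (f c) 1 :=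
          ge_of_tendsto (hR.one.tendsto.mono_left hl) (hn.mono fun c' h => (LZ.gt h.2.2.2).le)
        simp only [Rn] at t
        rw [mul_one, ← e, hc.zero, le_div_iff_of_neg b2] at t
        linarith
      have key := ih hR (by
        filter_upwards [hg, hn] with c' g h'
        exact g.Rn h'.1 h'.2.1 h'.2.2.1) (hc.Rn b1 b2 b3) (hn.mono fun c' h => h.2.2.2)
      rcases key with k | ⟨j, rfl, k⟩
      · left; rw [LZ_succ]; exact ⟨b1, b2, b3, k⟩
      · exact Or.inr ⟨j + 1, rfl, b1, b2, b3, k⟩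
    · right
      refine ⟨n, rfl, ?_⟩
      cases n with
      | zero => exact b2
      | succ n =>
        exfalso
        have t2 : Tendsto (fun c' => 2 * L ^ 2 * |f c' 1|) l (𝓝 (2 * L ^ 2 * |f c 1|)) :=
          (t1.abs).const_mul _
        rw [b2, abs_zero, mul_zero] at t2
        have t3 := t2.eventually (gt_mem_nhds (show (0:ℝ) < 1 by norm_num))
        obtain ⟨c', g, h', q⟩ := (hg.and (hn.and t3)).exists
        have := abs_le.1 (g.near h'.1 h'.2.1)
        have k := h'.2.2.2
        rw [LZ_succ] at k
        linarith [k.2.1, this.1]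

theorem Zer_near {f : ℝ → ℝ → ℝ} {c L : ℝ} {n : ℕ} (h : JC f c)
    (hg : ∀ᶠ c' in 𝓝 c, Good L (f c')) (hz : Zer n (f c)) :
    ∀ᶠ c' in 𝓝 c, (0 < Rn^[n] (f c') 1 → Lev n (f c')) ∧
      (Rn^[n] (f c') 1 < 0 → Lev (n + 1) (f c')) ∧ (∀ k < n, Rn^[k] (f c') 1 ≠ 0) := by
  induction n generalizing f L with
  | zero =>
    have hz' : f c 1 = 0 := hz
    have t1 : Tendsto (fun c' => 2 * L ^ 2 * |f c' 1|) (𝓝 c) (𝓝 (2 * L ^ 2 * |f c 1|)) :=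
      (h.one.tendsto.abs).const_mul _
    rw [hz', abs_zero, mul_zero] at t1
    have t2 := h.two.tendsto
    rw [hz', hg.self_of_nhds.zero] at t2
    have t3 := h.one.tendsto
    rw [hz'] at t3
    filter_upwards [t1.eventually (gt_mem_nhds (show (0:ℝ) < 1 by norm_num)),
      t2.eventually (lt_mem_nhds (show (0:ℝ) < 1 by norm_num)),
      t3.eventually (lt_mem_nhds (show (-1:ℝ) < 0 by norm_num)), hg] with c' a1 a2 a3 g
    refine ⟨id, fun hn => ⟨a3, hn, a2, ?_⟩, by simp⟩
    have := abs_le.1 (g.near a3 hn)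
    show 0 < Rn (f c') 1
    linarith [this.1]
  | succ n ih =>
    obtain ⟨h1, h2, h3, h4⟩ := hz
    have e1 := h.one.eventually (lt_mem_nhds h1)
    have e2 := h.one.eventually (gt_mem_nhds h2)
    have e3 := h.two.eventually (lt_mem_nhds h3)
    filter_upwards [e1, e2, e3, ih (f := fun c' => Rn (f c')) (L := 2 * L ^ 2) (h.Rn h2.ne) (by
      filter_upwards [e1, e2, e3, hg] with c' a b c g using g.Rn a b c) h4] with c' a b c d
    simp only [← Function.iterate_succ_apply] at d
    refine ⟨fun q => ⟨a, b, c, d.1 q⟩, fun q => ⟨a, b, c, d.2.1 q⟩, fun k hk => ?_⟩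
    cases k with
    | zero => exact b.ne
    | succ k => exact d.2.2 k (by omega)

def Hor : ℕ → (ℝ → ℝ) → Prop
  | 0, f => f 1 ≤ -1
  | n + 1, f => -1 < f 1 ∧ f 1 < 0 ∧ 0 < f (f 1) ∧ Hor n (Rn f)

theorem Good.contOn {L : ℝ} {f : ℝ → ℝ} (g : Good L f) : ContinuousOn f (Set.Icc 0 1) := by
  have : LipschitzOnWith (Real.toNNReal (2 * L)) f (Set.Icc 0 1) := by
    refine LipschitzOnWith.of_dist_le' fun x hx y hy => ?_
    have ax : |x| ≤ 1 := abs_le.2 ⟨by linarith [hx.1], hx.2⟩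
    have ay : |y| ≤ 1 := abs_le.2 ⟨by linarith [hy.1], hy.2⟩
    have hL : 0 ≤ L := by
      have := g.lip 1 0 (by simp) (by simp)
      norm_num at this
      exact (abs_nonneg _).trans this
    rw [Real.dist_eq, Real.dist_eq]
    refine (g.lip x y ax ay).trans ?_
    rw [sq_sub_sq, abs_mul, mul_comm 2 L, mul_assoc]
    refine mul_le_mul_of_nonneg_left (mul_le_mul_of_nonneg_right ?_ (abs_nonneg _)) hL
    refine (abs_add_le _ _).trans (by linarith)
  exact this.continuousOn

theorem Hor.three {L : ℝ} {f : ℝ → ℝ} (g : Good L f) (h : f 1 ≤ -1) :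
    ∃ x, |x| ≤ 1 ∧ f^[3] x = x ∧ f x ≠ x := by
  have hc := g.contOn
  obtain ⟨p, hp, hpf⟩ : ∃ p ∈ Set.Icc (0:ℝ) 1, f p - p = 0 := by
    have := intermediate_value_Icc' (f := fun x => f x - x) (show (0:ℝ) ≤ 1 by norm_num)
      (hc.sub continuousOn_id)
    exact this ⟨show f 1 - 1 ≤ 0 by linarith, show 0 ≤ f 0 - 0 by rw [g.zero]; norm_num⟩
  have hpf : f p = p := by linarith
  have hp0 : 0 < p := by
    rcases hp.1.lt_or_eq with q | q
    · exact q
    · rw [← q, g.zero] at hpf; norm_num at hpf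
  have hp1 : p < 1 := by
    rcases hp.2.lt_or_eq with q | q
    · exact q
    · rw [q] at hpf; linarith
  have ivt : ∀ v ∈ Set.Icc (-1:ℝ) 1, ∃ r ∈ Set.Icc (0:ℝ) 1, f r = v := fun v hv =>
    intermediate_value_Icc' (show (0:ℝ) ≤ 1 by norm_num) hc ⟨h.trans hv.1, by rw [g.zero]; exact hv.2⟩
  have lt_of : ∀ x ∈ Set.Icc (0:ℝ) 1, ∀ y ∈ Set.Icc (0:ℝ) 1, f y < f x → x < y := fun x hx y hy q =>
    (g.anti.lt_iff_gt hy hx).1 q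
  obtain ⟨r, hr, hr0⟩ := ivt 0 (by norm_num)
  have pr : p < r := lt_of p hp r hr (by rw [hr0, hpf]; exact hp0)
  obtain ⟨r1, hr1, hr1f⟩ := ivt (-p) ⟨by linarith, by linarith⟩
  obtain ⟨r2, hr2, hr2f⟩ := ivt (-r) ⟨by linarith [hr.2], by linarith [hr.1]⟩
  have h12 : r1 < r2 := lt_of r1 hr1 r2 hr2 (by rw [hr1f, hr2f]; linarith)
  have hpr1 : p < r1 := lt_of p hp r1 hr1 (by rw [hr1f, hpf]; linarith)
  have hsub : Set.Icc r1 r2 ⊆ Set.Icc 0 1 := Set.Icc_subset_Icc hr1.1 hr2.2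
  have m1 : ∀ x ∈ Set.Icc r1 r2, f x ∈ Set.Icc (-r) (-p) := fun x hx => by
    rw [← hr1f, ← hr2f]
    exact ⟨g.anti.antitoneOn (hsub hx) hr2 hx.2, g.anti.antitoneOn hr1 (hsub hx) hx.1⟩
  have m2 : ∀ x ∈ Set.Icc r1 r2, f (f x) ∈ Set.Icc 0 1 := fun x hx => by
    have := m1 x hx
    rw [← g.even (f x)]
    have hh : -f x ∈ Set.Icc (0:ℝ) 1 := ⟨by linarith [this.2], by linarith [this.1, hr.2]⟩
    refine ⟨?_, ?_⟩
    · rw [← hr0]; exact g.anti.antitoneOn hh hr (by linarith [this.1])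
    · rw [← g.zero]; exact g.anti.antitoneOn (by norm_num) hh hh.1
  have c1 : ContinuousOn f (Set.Icc r1 r2) := hc.mono hsub
  have c2 : ContinuousOn (fun x => f (f x)) (Set.Icc r1 r2) := by
    have : ContinuousOn (fun x => f (-f x)) (Set.Icc r1 r2) := hc.comp c1.neg fun x hx => by
      have := m1 x hx
      exact ⟨by linarith [this.2], by linarith [this.1, hr.2]⟩
    simpa only [g.even] using this
  have c3 : ContinuousOn (fun x => f (f (f x)) - x) (Set.Icc r1 r2) :=
    (hc.comp c2 m2).sub continuousOn_id
  obtain ⟨x, hx, hx3⟩ := intermediate_value_Icc h12.le c3 (show (0:ℝ) ∈ Set.Icc _ _ from by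
    simp only [hr1f, hr2f, g.even, hpf, hr0, g.zero]
    exact ⟨by linarith, by linarith [hr2.2]⟩)
  have := hsub hx
  refine ⟨x, abs_le.2 ⟨by linarith [this.1], this.2⟩, ?_, ?_⟩
  · show f (f (f x)) = x
    simp only at hx3; linarith
  · have := (m1 x hx).2
    have := (hsub hx).1
    intro h; linarith

theorem Hor.pt {L : ℝ} {f : ℝ → ℝ} {n : ℕ} (g : Good L f) (h : Hor n f) :
    ∃ x, f^[3 * 2 ^ n] x = x ∧ f^[2 ^ n] x ≠ x := by
  induction n generalizing L f with
  | zero =>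
    obtain ⟨x, -, h1, h2⟩ := Hor.three g h
    exact ⟨x, h1, h2⟩
  | succ n ih =>
    obtain ⟨h1, h2, h3, h4⟩ := h
    obtain ⟨z, k1, k2⟩ := ih (g.Rn h1 h2 h3) h4
    refine ⟨f 1 * z, ?_, fun e => k2 ?_⟩
    · rw [pow_succ, ← mul_assoc, mul_comm _ 2, ← Rn_iter h2.ne, k1]
    · rw [pow_succ, mul_comm _ 2, ← Rn_iter h2.ne] at e
      exact mul_left_cancel₀ h2.ne e

def f0 (c : ℝ) : ℝ → ℝ := fun x => 1 + c * x ^ 2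

theorem f0_JC (c : ℝ) : JC f0 c := fun x => by
  simp only [f0]; fun_prop

theorem f0_good {c : ℝ} (h1 : -2 ≤ c) (h2 : c < 0) : Good 2 (f0 c) := by
  refine ⟨fun x => by simp [f0], by simp [f0], fun x hx y hy hxy => ?_, fun x y _ _ => ?_⟩
  · simp only [f0]
    have : x ^ 2 < y ^ 2 := by nlinarith [hx.1]
    nlinarith [mul_lt_mul_of_neg_left this h2]
  · simp only [f0]
    rw [show 1 + c * x ^ 2 - (1 + c * y ^ 2) = c * (x ^ 2 - y ^ 2) by ring, abs_mul]
    exact mul_le_mul_of_nonneg_right (abs_le.2 ⟨by linarith, by linarith⟩) (abs_nonneg _)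

theorem f0_conj (c : ℝ) (n : ℕ) (x : ℝ) :
    (fun y : ℝ => y ^ 2 + c)^[n] (c * x) = c * (f0 c)^[n] x := by
  induction n with
  | zero => simp
  | succ n ih =>
    rw [Function.iterate_succ_apply', Function.iterate_succ_apply', ih]
    simp only [f0]; ring

theorem per_bd {c : ℝ} (hc : c < 0) {x : ℝ} {q : ℕ} (hq : 0 < q)
    (hx : (fun y : ℝ => y ^ 2 + c)^[q] x = x) : x ^ 2 + c = x ∨ |x| ≤ -c := by
  by_contra hcon
  push Not at hcon
  obtain ⟨h1, h2⟩ := hcon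
  set P := (fun y : ℝ => y ^ 2 + c) with hP
  have hge : ∀ n, c ≤ P^[n] x := fun n => by
    have : P^[n] x = P^[n + q] x := by rw [Function.iterate_add_apply, hx]
    rw [this]
    obtain ⟨q, rfl⟩ : ∃ p, q = p + 1 := ⟨q - 1, by omega⟩
    rw [← add_assoc, Function.iterate_succ_apply', hP]
    simp only; nlinarith [sq_nonneg ((fun y : ℝ => y ^ 2 + c)^[n + q] x)]
  have h0 := hge 0
  simp only [Function.iterate_zero, id] at h0
  have hxc : -c < x := by
    rcases lt_abs.1 h2 with h | h
    · exact h
    · linarith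
  obtain ⟨q, rfl⟩ : ∃ p, q = p + 1 := ⟨q - 1, by omega⟩
  rcases lt_or_gt_of_ne h1 with h | h
  ·
    have : ∀ n, P^[n + 1] x < x := by
      intro n
      induction n with
      | zero => simpa [hP] using h
      | succ n ih =>
        rw [Function.iterate_succ_apply', hP]
        have a := hge (n + 1)
        rw [hP] at a ih
        simp only
        nlinarith
    exact (this q).ne hx
  · have : ∀ n, x < P^[n + 1] x := by
      intro n
      induction n with
      | zero => simpa [hP] using h
      | succ n ih =>
        rw [Function.iterate_succ_apply', hP]
        rw [hP] at ih
        simp only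
        nlinarith
    exact (this q).ne' hx

theorem P_per {c : ℝ} {n : ℕ} (h1 : -2 ≤ c) (h2 : c < 0) (h : LZ n (f0 c)) {x : ℝ} {q : ℕ}
    (hq : 0 < q) (hx : (fun y : ℝ => y ^ 2 + c)^[q] x = x) :
    ∃ m, (fun y : ℝ => y ^ 2 + c)^[2 ^ m] x = x := by
  rcases per_bd h2 hq hx with k | k
  · exact ⟨0, by simpa using k⟩
  · have e : x = c * (x / c) := (mul_div_cancel₀ _ h2.ne).symm
    rw [e, f0_conj] at hx
    obtain ⟨m, hm⟩ := (f0_good h1 h2).per n h (x := x / c)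
      (by rw [abs_div, abs_of_neg h2]; exact div_le_one_of_le₀ k (by linarith)) hq
      (mul_left_cancel₀ h2.ne hx)
    exact ⟨m, by rw [e, f0_conj, hm]⟩

theorem P_per_pos {c : ℝ} (h : 0 ≤ c) {x : ℝ} {q : ℕ} (hq : 0 < q)
    (hx : (fun y : ℝ => y ^ 2 + c)^[q] x = x) : x ^ 2 + c = x := by
  have hm : StrictMonoOn (fun y : ℝ => y ^ 2 + c) (Set.Ici 0) := fun a ha b hb hab => by
    simp only [Set.mem_Ici] at ha hb; simp only; nlinarith
  refine mono_per hm hq (fun n => ?_) hx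
  have : (fun y : ℝ => y ^ 2 + c)^[n] x = (fun y : ℝ => y ^ 2 + c)^[n + q] x := by
    rw [Function.iterate_add_apply, hx]
  rw [this]
  obtain ⟨q, rfl⟩ : ∃ p, q = p + 1 := ⟨q - 1, by omega⟩
  rw [← add_assoc, Function.iterate_succ_apply', Set.mem_Ici]
  positivity

theorem Hor_mem {c : ℝ} {n : ℕ} (h1 : -2 ≤ c) (h2 : c < 0) (h : Hor n (f0 c)) :
    ∃ x : ℝ, 0 < Function.minimalPeriod (fun y : ℝ => y ^ 2 + c) x ∧
      ¬∃ m : ℕ, Function.minimalPeriod (fun y : ℝ => y ^ 2 + c) x = 2 ^ m := by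
  obtain ⟨x, k1, k2⟩ := Hor.pt (f0_good h1 h2) h
  have p1 : Function.IsPeriodicPt (fun y : ℝ => y ^ 2 + c) (3 * 2 ^ n) (c * x) := by
    show _ = _; rw [f0_conj, k1]
  have d1 := p1.minimalPeriod_dvd
  refine ⟨c * x, p1.minimalPeriod_pos (by positivity), ?_⟩
  rintro ⟨m, hm⟩
  rw [hm] at d1
  have d2 : 2 ^ m ∣ 2 ^ n := Nat.Coprime.dvd_of_dvd_mul_left
    (Nat.Coprime.pow_left m (by norm_num)) d1
  rw [← hm] at d2
  have p2 := Function.isPeriodicPt_iff_minimalPeriod_dvd.2 d2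
  apply k2
  have : (fun y : ℝ => y ^ 2 + c)^[2 ^ n] (c * x) = c * x := p2
  rw [f0_conj] at this
  exact mul_left_cancel₀ h2.ne this

end FB

namespace FB

theorem hsqrt {ε : ℝ} (hε : 0 < ε) {g : ℂ → ℂ} (hg : DifferentiableOn ℂ g (Metric.ball 0 ε))
    (h0 : ∀ z ∈ Metric.ball (0:ℂ) ε, g z ≠ 0) {a : ℂ} (ha : a ^ 2 = g 0) :
    ∃ s : ℂ → ℂ, DifferentiableOn ℂ s (Metric.ball 0 ε) ∧ s 0 = a ∧
      ∀ z ∈ Metric.ball (0:ℂ) ε, s z ^ 2 = g z := by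
  have m0 : (0:ℂ) ∈ Metric.ball (0:ℂ) ε := Metric.mem_ball_self hε
  have d1 : DifferentiableOn ℂ (fun z => deriv g z / g z) (Metric.ball 0 ε) :=
    (hg.deriv Metric.isOpen_ball).div hg h0
  obtain ⟨F, F0, hF⟩ := d1.isExactOn_ball.with_val_at 0 0
  have hga : ∀ z ∈ Metric.ball (0:ℂ) ε, HasDerivAt g (deriv g z) z := fun z hz =>
    (hg.differentiableAt (Metric.isOpen_ball.mem_nhds hz)).hasDerivAt
  refine ⟨fun z => a * Complex.exp (F z / 2), fun z hz => ?_, by simp [F0], fun z hz => ?_⟩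
  · exact ((((hF z hz).div_const 2).cexp.const_mul a).differentiableAt).differentiableWithinAt
  · have key : ∀ z ∈ Metric.ball (0:ℂ) ε, HasDerivAt (fun z => g z * Complex.exp (-F z)) 0 z := by
      intro z hz
      have := (hga z hz).mul (hF z hz).neg.cexp
      convert! this using 1
      field_simp [h0 z hz]
      ring
    have e : g z * Complex.exp (-F z) = g 0 * Complex.exp (-F 0) := by
      refine (convex_ball (0:ℂ) ε).is_const_of_fderivWithin_eq_zero (𝕜 := ℂ)
        (f := fun z => g z * Complex.exp (-F z))
        (fun w hw => (key w hw).differentiableAt.differentiableWithinAt) (fun w hw => ?_) hz m0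
      rw [fderivWithin_of_isOpen Metric.isOpen_ball hw]
      ext
      simp [(key w hw).deriv]
    rw [F0, neg_zero, Complex.exp_zero, mul_one, ← ha] at e
    have e2 : Complex.exp (F z / 2) ^ 2 = Complex.exp (F z) := by
      rw [← Complex.exp_nat_mul]; congr 1; push_cast; ring
    rw [mul_pow, e2, ← e, mul_assoc, ← Complex.exp_add]
    simp

structure Mot (x : ℕ → ℂ) (q : ℕ) (ε R : ℝ) (v : ℕ → ℂ) (h : ℕ → ℂ → ℂ) : Prop where
  d : ∀ i, 1 ≤ i → i ≤ q → DifferentiableOn ℂ (h i) (Metric.ball 0 ε)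
  z : ∀ i, 1 ≤ i → i ≤ q → h i 0 = x i
  e : ∀ z ∈ Metric.ball (0:ℂ) ε, h q z = 0
  n : ∀ i j, 1 ≤ i → i ≤ q → 1 ≤ j → j ≤ q → i ≠ j → ∀ z ∈ Metric.ball (0:ℂ) ε, h i z ≠ h j z
  b : ∀ i, 1 ≤ i → i ≤ q → ∀ z ∈ Metric.ball (0:ℂ) ε, ‖h i z‖ ≤ R
  v : ∀ i, 1 ≤ i → i ≤ q → deriv (h i) 0 = v i

theorem Mot.lift {x v : ℕ → ℂ} {c μ s : ℂ} {q : ℕ} {ε R : ℝ} {h : ℕ → ℂ → ℂ} (hε : 0 < ε)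
    (hR : 2 ≤ R) (hq : 1 ≤ q) (hx1 : x 1 = c) (hxs : ∀ i, x (i + 1) = x i ^ 2 + c)
    (hx0 : ∀ i, 0 < i → i < q → x i ≠ 0) (hv1 : v 1 = 1)
    (hvs : ∀ i, v (i + 1) = 1 + 2 * μ * x i * v i) (hxq : x q = 0) (hvq : v q = 0)
    (m : Mot x q ε R (fun i => s * v i) h) :
    ∃ h', Mot x q ε R (fun i => (s * μ) * v i) h' := by
  have m0 : (0:ℂ) ∈ Metric.ball (0:ℂ) ε := Metric.mem_ball_self hε
  have ex : ∀ i, ∃ k : ℂ → ℂ, 1 ≤ i → i < q → DifferentiableOn ℂ k (Metric.ball 0 ε) ∧ k 0 = x i ∧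
      ∀ z ∈ Metric.ball (0:ℂ) ε, k z ^ 2 = h (i + 1) z - h 1 z := by
    intro i
    by_cases hi : 1 ≤ i ∧ i < q
    · obtain ⟨k, hk⟩ := hsqrt hε (g := fun z => h (i + 1) z - h 1 z) (a := x i)
        ((m.d (i+1) (by omega) (by omega)).sub (m.d 1 le_rfl hq))
        (fun z hz => sub_ne_zero.2 (m.n (i+1) 1 (by omega) (by omega) le_rfl hq (by omega) z hz))
        (by simp only [m.z (i+1) (by omega) (by omega), m.z 1 le_rfl hq, hxs i, hx1]; ring)
      exact ⟨k, fun _ _ => hk⟩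
    · exact ⟨0, fun a b => absurd ⟨a, b⟩ hi⟩
  choose k hk using ex
  have sq : ∀ i, 1 ≤ i → i ≤ q → ∀ z ∈ Metric.ball (0:ℂ) ε,
      i < q → (if i = q then (0 : ℂ → ℂ) else k i) z ^ 2 = h (i + 1) z - h 1 z := by
    intro i h1 h2 z hz h3
    rw [if_neg h3.ne]
    exact (hk i h1 h3).2.2 z hz
  have nz : ∀ i, 1 ≤ i → i < q → ∀ z ∈ Metric.ball (0:ℂ) ε, k i z ≠ 0 := by
    intro i h1 h2 z hz h3
    have := (hk i h1 h2).2.2 z hz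
    rw [h3] at this
    exact m.n (i+1) 1 (by omega) (by omega) le_rfl hq (by omega) z hz
      (sub_eq_zero.1 (by rw [← this]; simp))
  refine ⟨fun i => if i = q then 0 else k i, ⟨?_, ?_, ?_, ?_, ?_, ?_⟩⟩
  · intro i h1 h2
    by_cases h3 : i = q
    · simp only [h3, if_true]; exact differentiableOn_const 0
    · simp only [h3, if_false]; exact (hk i h1 (by omega)).1
  · intro i h1 h2
    by_cases h3 : i = q
    · simp [h3, hxq]
    · simp only [h3, if_false]; exact (hk i h1 (by omega)).2.1
  · intro z hz; simp
  · intro i j h1 h2 h3 h4 h5 z hz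
    by_cases h6 : i = q
    · have : j ≠ q := by omega
      simp only [h6, this, if_true, if_false]
      exact (nz j h3 (by omega) z hz).symm
    · by_cases h7 : j = q
      · simp only [h6, h7, if_true, if_false]
        exact nz i h1 (by omega) z hz
      · simp only [h6, h7, if_false]
        intro h8
        have a := (hk i h1 (by omega)).2.2 z hz
        have b := (hk j h3 (by omega)).2.2 z hz
        rw [h8, b] at a
        exact m.n (i+1) (j+1) (by omega) (by omega) (by omega) (by omega) (by omega) z hz
          (sub_left_injective a).symm
  · intro i h1 h2 z hz
    by_cases h3 : i = q
    · simp only [h3, if_true, Pi.zero_apply, norm_zero]; linarith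
    · simp only [h3, if_false]
      have a := (hk i h1 (by omega)).2.2 z hz
      have b := norm_sub_le (h (i+1) z) (h 1 z)
      rw [← a, norm_pow] at b
      have c1 := m.b (i+1) (by omega) (by omega) z hz
      have c2 := m.b 1 le_rfl hq z hz
      refine abs_le_of_sq_le_sq' (b := R) ?_ (by linarith) |>.2
      nlinarith
  · intro i h1 h2
    by_cases h3 : i = q
    · simp [h3, hvq]
    · simp only [h3, if_false]
      obtain ⟨a1, a2, a3⟩ := hk i h1 (by omega)
      have nb := Metric.isOpen_ball.mem_nhds m0
      have b1 := ((a1.differentiableAt nb).hasDerivAt.pow 2)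
      have b2 := ((m.d (i+1) (by omega) (by omega)).differentiableAt nb).hasDerivAt.sub
        ((m.d 1 le_rfl hq).differentiableAt nb).hasDerivAt
      have b3 := b2.congr_of_eventuallyEq (f₁ := k i ^ 2) (by
        filter_upwards [nb] with z hz; exact a3 z hz)
      have b4 := b1.unique b3
      rw [a2, m.v _ (by omega) (by omega), m.v 1 le_rfl hq, hvs i, hv1] at b4
      have x0 := hx0 i (by omega) (by omega)
      apply mul_left_cancel₀ (mul_ne_zero two_ne_zero x0)
      simp only [Nat.cast_ofNat, Nat.add_one_sub_one, pow_one] at b4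
      linear_combination b4

theorem tsujii {x v : ℕ → ℂ} {c μ : ℂ} {q : ℕ} (hμ : 1 < ‖μ‖)
    (hq : 1 ≤ q) (hxz : x 0 = 0) (hxs : ∀ i, x (i + 1) = x i ^ 2 + c)
    (hx0 : ∀ i, 0 < i → i < q → x i ≠ 0) (hv0 : v 0 = 0)
    (hvs : ∀ i, v (i + 1) = 1 + 2 * μ * x i * v i) (hxq : x q = 0) : v q ≠ 0 := by
  intro hvq
  have hx1 : x 1 = c := by rw [hxs 0, hxz]; ring
  have hv1 : v 1 = 1 := by rw [hvs 0, hv0]; ring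
  have shift : ∀ i j, x i = x j → ∀ k, x (i + k) = x (j + k) := fun i j h k => by
    induction k with
    | zero => simpa using h
    | succ k ih => rw [← add_assoc, ← add_assoc, hxs, hxs, ih]
  have inj' : ∀ i j, 1 ≤ i → i < j → j ≤ q → x i ≠ x j := by
    intro i j h1 h2 h3 h4
    have := shift i j h4 (q - j)
    rw [show j + (q - j) = q by omega, hxq] at this
    exact hx0 _ (by omega) (by omega) this
  have inj : ∀ i j, 1 ≤ i → i ≤ q → 1 ≤ j → j ≤ q → i ≠ j → x i ≠ x j := by
    intro i j h1 h2 h3 h4 h5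
    rcases lt_or_gt_of_ne h5 with h | h
    · exact inj' i j h1 h h4
    · exact (inj' j i h3 h h2).symm
  have ev : ∀ᶠ ε : ℝ in 𝓝[>] 0, ∀ i ∈ Finset.range (q+1), ∀ j ∈ Finset.range (q+1), x i ≠ x j →
      ε * (‖v i‖ + ‖v j‖) < ‖x i - x j‖ := by
    refine (Filter.eventually_all_finset _).2 fun i _ => (Filter.eventually_all_finset _).2
      fun j _ => ?_
    by_cases h : x i = x j
    · exact Eventually.of_forall fun ε k => absurd h k
    · have : Tendsto (fun ε : ℝ => ε * (‖v i‖ + ‖v j‖)) (𝓝[>] 0) (𝓝 0) := by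
        have : Continuous (fun ε : ℝ => ε * (‖v i‖ + ‖v j‖)) := by fun_prop
        have := this.tendsto 0
        rw [zero_mul] at this
        exact this.mono_left nhdsWithin_le_nhds
      filter_upwards [this.eventually (gt_mem_nhds (norm_pos_iff.2 (sub_ne_zero.2 h)))] with ε a _
      exact a
  obtain ⟨ε, hε1, hε⟩ := (ev.and self_mem_nhdsWithin).exists
  have hε : 0 < ε := hε
  set R : ℝ := 2 + ∑ i ∈ Finset.range (q+1), (‖x i‖ + ε * ‖v i‖) with hR
  have term : ∀ i ≤ q, ‖x i‖ + ε * ‖v i‖ ≤ R - 2 := by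
    intro i hi
    rw [hR]
    have := Finset.single_le_sum (f := fun i => ‖x i‖ + ε * ‖v i‖) (s := Finset.range (q+1))
      (fun i _ => by positivity) (Finset.mem_range.2 (Nat.lt_succ_of_le hi))
    linarith
  have hR2 : 2 ≤ R := by
    have := term 0 (by omega)
    have : 0 ≤ ‖x 0‖ + ε * ‖v 0‖ := by positivity
    linarith
  have start : Mot x q ε R (fun i => (1:ℂ) * v i) (fun i z => x i + z * v i) := by
    refine ⟨?_, ?_, ?_, ?_, ?_, ?_⟩
    · intro i _ _; fun_prop
    · intro i _ _; simp
    · intro z _; simp [hxq, hvq]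
    · intro i j h1 h2 h3 h4 h5 z hz h6
      have a := hε1 i (by simp; omega) j (by simp; omega) (inj i j h1 h2 h3 h4 h5)
      have hz' : ‖z‖ < ε := by simpa using hz
      have b : x i - x j = z * (v j - v i) := by linear_combination h6
      rw [b, norm_mul] at a
      have c1 := norm_sub_le (v j) (v i)
      have c2 : ‖z‖ * ‖v j - v i‖ ≤ ε * (‖v i‖ + ‖v j‖) := by
        refine mul_le_mul hz'.le (by linarith) (norm_nonneg _) hε.le
      linarith
    · intro i h1 h2 z hz
      have hz' : ‖z‖ < ε := by simpa using hz
      refine (norm_add_le _ _).trans ?_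
      rw [norm_mul]
      have := term i h2
      have : ‖z‖ * ‖v i‖ ≤ ε * ‖v i‖ := mul_le_mul_of_nonneg_right hz'.le (norm_nonneg _)
      linarith
    · intro i h1 h2
      simp
  have all : ∀ k : ℕ, ∃ h, Mot x q ε R (fun i => (μ ^ k) * v i) h := by
    intro k
    induction k with
    | zero => exact ⟨_, by simpa using start⟩
    | succ k ih =>
      obtain ⟨h, m⟩ := ih
      obtain ⟨h', m'⟩ := m.lift hε hR2 hq hx1 hxs hx0 hv1 hvs hxq hvq
      exact ⟨h', by simpa only [pow_succ] using m'⟩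
  have bd : ∀ k : ℕ, ‖μ‖ ^ k ≤ R / (ε / 2) := by
    intro k
    obtain ⟨h, m⟩ := all k
    have sub : Metric.closedBall (0:ℂ) (ε/2) ⊆ Metric.ball 0 ε :=
      Metric.closedBall_subset_ball (by linarith)
    have dd := (m.d 1 le_rfl hq).mono sub
    have := Complex.norm_deriv_le_of_forall_mem_sphere_norm_le (f := h 1) (c := 0) (R := ε/2)
      (C := R) (by linarith) (by
        refine DifferentiableOn.diffContOnCl ?_
        rw [closure_ball _ (by linarith)]
        exact dd) (fun z hz => m.b 1 le_rfl hq z (sub (Metric.sphere_subset_closedBall hz)))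
    rwa [m.v 1 le_rfl hq, hv1, mul_one, norm_pow] at this
  obtain ⟨k, hk⟩ := pow_unbounded_of_one_lt (R / (ε / 2)) hμ
  linarith [bd k]

def X (c : ℝ) : ℕ → ℝ
  | 0 => 0
  | n + 1 => X c n ^ 2 + c

def V (c : ℝ) : ℕ → ℝ
  | 0 => 0
  | n + 1 => 1 + 2 * X c n * V c n

theorem X_deriv (c : ℝ) (n : ℕ) : HasDerivAt (fun c => X c n) (V c n) c := by
  induction n with
  | zero => simpa [X, V] using hasDerivAt_const c (0:ℝ)
  | succ n ih =>
    have := (ih.pow 2).add (hasDerivAt_id c)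
    convert! this using 1
    simp [V]; ring

theorem X_iter (c : ℝ) (n : ℕ) : X c n = (fun y : ℝ => y ^ 2 + c)^[n] 0 := by
  induction n with
  | zero => rfl
  | succ n ih => rw [Function.iterate_succ_apply', ← ih]; rfl

theorem X_f0 (c : ℝ) (n : ℕ) : X c n = c * (f0 c)^[n] 0 := by
  rw [X_iter, ← f0_conj, mul_zero]

noncomputable def QP : ℕ → Polynomial ℤ
  | 0 => 0
  | n + 1 => QP n ^ 2 + Polynomial.X

theorem QP_monic (n : ℕ) : (QP (n + 1)).Monic ∧ 1 ≤ (QP (n+1)).natDegree := by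
  induction n with
  | zero => simp [QP, Polynomial.monic_X]
  | succ n ih =>
    obtain ⟨m, d⟩ := ih
    have m2 := m.pow 2
    have dd : (QP (n+1) ^ 2).natDegree = 2 * (QP (n+1)).natDegree := m.natDegree_pow 2
    have lt : (Polynomial.X : Polynomial ℤ).degree < (QP (n+1) ^ 2).degree := by
      apply Polynomial.degree_lt_degree
      rw [dd, Polynomial.natDegree_X]; omega
    refine ⟨m2.add_of_left lt, ?_⟩
    show 1 ≤ (QP (n+1) ^ 2 + Polynomial.X).natDegree
    rw [Polynomial.natDegree_add_eq_left_of_degree_lt lt, dd]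
    omega

theorem QP_eval (c : ℝ) (n : ℕ) : Polynomial.aeval c (QP n) = X c n := by
  induction n with
  | zero => simp [QP, X]
  | succ n ih => simp [QP, X, ih]

theorem gleason {c : ℝ} {q : ℕ} (hq : 0 < q) (h : X c q = 0) : V c q ≠ 0 := by
  obtain ⟨q, rfl⟩ : ∃ p, q = p + 1 := ⟨q - 1, by omega⟩
  have ci : IsIntegral ℤ c := ⟨QP (q+1), (QP_monic q).1, by
    have := QP_eval c (q+1)
    rw [h] at this
    exact this⟩
  have xi : ∀ n, IsIntegral ℤ (X c n) := fun n => by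
    induction n with
    | zero => exact isIntegral_zero
    | succ n ih => exact (ih.pow 2).add ci
  have i2 : IsIntegral ℤ (2:ℝ) := by simpa using isIntegral_algebraMap (R := ℤ) (A := ℝ) (x := 2)
  have vi : ∀ n, IsIntegral ℤ (V c n) := fun n => by
    induction n with
    | zero => exact isIntegral_zero
    | succ n ih => exact isIntegral_one.add ((i2.mul (xi n)).mul ih)
  intro hV
  have hh : IsIntegral ℤ (-(X c q * V c q)) := ((xi q).mul (vi q)).neg
  have e : -(X c q * V c q) = algebraMap ℚ ℝ (1/2) := by
    have : 1 + 2 * X c q * V c q = 0 := hV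
    simp only [eq_ratCast]
    push_cast
    linarith
  rw [e, isIntegral_algebraMap_iff (algebraMap ℚ ℝ).injective] at hh
  obtain ⟨m, hm⟩ := IsIntegrallyClosed.isIntegral_iff.1 hh
  simp only [eq_intCast] at hm
  have : (2 * m : ℚ) = 1 := by rw [hm]; norm_num
  have : (2 * m : ℤ) = 1 := by exact_mod_cast this
  omega

def U (c e : ℝ) : ℕ → ℝ
  | 0 => 0
  | n + 1 => e ^ n + X c n * U c e n

theorem U_cont (c : ℝ) (n : ℕ) : Continuous (fun e => U c e n) := by
  induction n with
  | zero => exact continuous_const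
  | succ n ih => simp only [U]; fun_prop

theorem U_zero (c : ℝ) (n : ℕ) : U c 0 (n + 1) = ∏ i ∈ Finset.range n, X c (i + 1) := by
  induction n with
  | zero => simp [U]
  | succ n ih =>
    rw [Finset.prod_range_succ, ← ih, U]; simp; ring

theorem U_half (c : ℝ) (n : ℕ) : V c (n + 1) = 2 ^ n * U c (1/2) (n + 1) := by
  induction n with
  | zero => simp [U, V]
  | succ n ih =>
    rw [V, ih, show U c (1/2) (n+1+1) = (1/2) ^ (n+1) + X c (n+1) * U c (1/2) (n+1) from rfl]
    have : (2:ℝ) ^ (n+1) * (1/2) ^ (n+1) = 1 := by rw [← mul_pow]; norm_num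
    rw [mul_add, this]; ring

theorem transv {c : ℝ} {q : ℕ} (h : X c (q + 1) = 0) (h' : ∀ i, 0 < i → i < q + 1 → X c i ≠ 0) :
    0 < V c (q + 1) * ∏ i ∈ Finset.range q, X c (i + 1) := by
  have nz : ∀ e ∈ Set.Icc (0:ℝ) (1/2), U c e (q+1) ≠ 0 := by
    intro e he
    rcases he.1.eq_or_lt with e0 | e0
    · rw [← e0, U_zero]
      exact Finset.prod_ne_zero_iff.2 fun i hi => h' _ (by omega) (by simp at hi; omega)
    rcases he.2.eq_or_lt with e1 | e1
    · intro h0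
      apply gleason (Nat.succ_pos q) h
      rw [U_half, ← e1, h0, mul_zero]
    · intro h0
      set w : ℕ → ℂ := fun n => if n = 0 then 0 else ((U c e n : ℝ) : ℂ) / (e:ℂ) ^ (n - 1) with hw
      have ec : (e:ℂ) ≠ 0 := by exact_mod_cast e0.ne'
      refine tsujii (x := fun n => ((X c n : ℝ) : ℂ)) (v := w) (c := (c : ℂ)) (q := q+1)
        (μ := ((1 / (2 * e) : ℝ) : ℂ)) ?_ (by omega) (by simp [X]) (fun i => by simp [X])
        (fun i h1 h2 => by exact_mod_cast h' i h1 h2) (by simp [hw]) (fun i => ?_)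
        (by exact_mod_cast h) ?_
      · rw [Complex.norm_real, Real.norm_of_nonneg (by positivity)]
        rw [lt_div_iff₀ (by positivity)]; linarith
      · cases i with
        | zero => simp [hw, U, X]
        | succ i =>
          have e2 : U c e (i+1+1) = e ^ (i+1) + X c (i+1) * U c e (i+1) := rfl
          simp only [hw, if_neg (Nat.succ_ne_zero _), e2, Nat.add_sub_cancel]
          push_cast
          field_simp
          ring
      · simp [hw, h0]
  have same : 0 < U c (1/2) (q+1) * U c 0 (q+1) := by
    by_contra hcon
    push Not at hcon
    have ct := (U_cont c (q+1)).continuousOn (s := Set.uIcc (0:ℝ) (1/2))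
    have : (0:ℝ) ∈ Set.uIcc (U c 0 (q+1)) (U c (1/2) (q+1)) := by
      rw [Set.mem_uIcc]
      rcases mul_nonpos_iff.1 hcon with a | a
      · left; exact ⟨a.2, a.1⟩
      · right; exact ⟨a.1, a.2⟩
    obtain ⟨e, he, h0⟩ := intermediate_value_uIcc ct this
    rw [Set.uIcc_of_le (by norm_num)] at he
    exact nz e he h0
  rw [U_half, ← U_zero, mul_assoc]
  positivity

end FB

namespace FB

theorem LZ.uniq {f : ℝ → ℝ} {i j : ℕ} (h : LZ i f) (h' : LZ j f) : i = j := by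
  induction i generalizing f j with
  | zero =>
    cases j with
    | zero => rfl
    | succ j => rw [LZ_zero] at h; rw [LZ_succ] at h'; linarith [h'.2.1]
  | succ i ih =>
    cases j with
    | zero => rw [LZ_zero] at h'; rw [LZ_succ] at h; linarith [h.2.1]
    | succ j => rw [LZ_succ] at h h'; rw [ih h.2.2.2 h'.2.2.2]

theorem Lev.not_Zer {f : ℝ → ℝ} {i : ℕ} (h : Lev i f) (h' : Zer i f) : False := by
  induction i generalizing f with
  | zero => exact h.ne' h'
  | succ i ih => exact ih h.2.2.2 h'.2.2.2

theorem deriv_sign {f : ℝ → ℝ} {f' c : ℝ} (h : HasDerivAt f f' c) (h0 : f c = 0) (hp : 0 < f') :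
    (∀ᶠ x in 𝓝[>] c, 0 < f x) ∧ (∀ᶠ x in 𝓝[<] c, f x < 0) := by
  have ev := (hasDerivAt_iff_tendsto_slope.1 h).eventually (lt_mem_nhds hp)
  constructor
  · have := ev.filter_mono (nhdsWithin_mono c (fun x (hx : c < x) => hx.ne'))
    filter_upwards [this, self_mem_nhdsWithin] with x hx hc
    rw [slope_def_field, h0, sub_zero] at hx
    have hc : 0 < x - c := sub_pos.2 hc
    exact (div_pos_iff_of_pos_right hc).1 hx
  · have := ev.filter_mono (nhdsWithin_mono c (fun x (hx : x < c) => hx.ne))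
    filter_upwards [this, self_mem_nhdsWithin] with x hx hc
    rw [slope_def_field, h0, sub_zero] at hx
    have hc : x - c < 0 := sub_neg.2 hc
    exact (div_pos_iff.1 hx).elim (fun h => absurd h.2 (by linarith)) (fun h => h.1)

theorem Zer_lr {c : ℝ} {N : ℕ} (h1 : -2 < c) (h2 : c < 0) (hz : Zer N (f0 c)) :
    (∀ᶠ x in 𝓝[>] c, Lev N (f0 x)) ∧ (∀ᶠ x in 𝓝[<] c, Lev (N + 1) (f0 x)) := by
  have g := f0_good h1.le h2
  have hg : ∀ᶠ x in 𝓝 c, Good 2 (f0 x) := by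
    filter_upwards [lt_mem_nhds h1, gt_mem_nhds h2] with x a b using f0_good a.le b
  obtain ⟨k1, k2⟩ := hz.zero g
  have k3 := hz.prod g
  obtain ⟨q, hq⟩ : ∃ q, 2 ^ (N + 1) = q + 1 := ⟨2 ^ (N+1) - 1, by have := Nat.one_le_two_pow (n := N+1); omega⟩
  have hodd : Odd q := by
    rw [← Nat.not_even_iff_odd]; intro he
    have : Even (2 ^ (N+1)) := ⟨2 ^ N, by ring⟩
    rw [hq] at this
    exact (Nat.not_even_iff_odd.2 he.add_one) this
  rw [hq, Nat.add_sub_cancel] at k3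
  have nz : ∀ i, 0 < i → i < q + 1 → X c i ≠ 0 := by
    intro i hi hi2 h0
    rw [X_f0] at h0
    have h0 := (mul_eq_zero.1 h0).resolve_left h2.ne
    have : ∏ i ∈ Finset.range q, (f0 c)^[i + 1] 0 = 0 :=
      Finset.prod_eq_zero (i := i - 1) (by simp; omega) (by rwa [Nat.sub_add_cancel hi])
    rw [this] at k3; simp at k3
  have Xq : X c (q + 1) = 0 := by rw [← hq, X_f0, k1, mul_zero]
  have tr := transv Xq nz
  have pe : ∏ i ∈ Finset.range q, X c (i + 1) = c ^ q * ∏ i ∈ Finset.range q, (f0 c)^[i + 1] 0 := by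
    simp only [X_f0, Finset.prod_mul_distrib, Finset.prod_const, Finset.card_range]
  rw [pe] at tr
  have cq : c ^ q < 0 := hodd.pow_neg h2
  set Pr := ∏ i ∈ Finset.range q, (f0 c)^[i + 1] 0
  have sq1 : ((-1:ℝ) ^ N) * (-1) ^ N = 1 := by rw [← mul_pow]; norm_num
  have vs : 0 < -(-1) ^ N * V c (q + 1) := by
    have a : 0 < (V c (q+1) * (-1) ^ N) * (c ^ q * ((-1) ^ N * Pr)) := by
      have : V c (q+1) * (-1) ^ N * (c ^ q * ((-1) ^ N * Pr)) =
        V c (q+1) * (c ^ q * Pr) * ((-1) ^ N * (-1) ^ N) := by ring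
      rw [this, sq1, mul_one]; exact tr
    have b : c ^ q * ((-1) ^ N * Pr) < 0 := mul_neg_of_neg_of_pos cq k3
    have := neg_of_mul_pos_left a b.le
    linarith
  have xs : 0 < -(-1) ^ N * X c (2 ^ N) := by
    rw [X_f0]
    nlinarith [mul_neg_of_neg_of_pos h2 k2]
  have d := ((X_deriv c (q+1)).const_mul (-(-1) ^ N))
  have ds := deriv_sign d (by rw [Xq, mul_zero]) vs
  have cx : ∀ n, ContinuousAt (fun c => X c n) c := fun n => (X_deriv c n).continuousAt
  have e1 : ∀ᶠ x in 𝓝 c, 0 < -(-1) ^ N * X x (2 ^ N) :=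
    ((cx (2 ^ N)).const_mul (-(-1) ^ N)).eventually (lt_mem_nhds xs)
  have e2 : ∀ᶠ x in 𝓝 c, ∀ k ∈ Finset.range N, X x (2 ^ (k + 1)) ≠ 0 := by
    refine (eventually_all_finset _).2 fun k hk => ?_
    have hk := Finset.mem_range.1 hk
    refine (cx _).eventually_ne (nz _ (by positivity) ?_)
    rw [← hq]; exact Nat.pow_lt_pow_right (by norm_num) (by omega)
  have key : ∀ᶠ x in 𝓝 c, (0 < -(-1) ^ N * X x (q + 1) → Lev N (f0 x)) ∧
      (-(-1) ^ N * X x (q + 1) < 0 → Lev (N + 1) (f0 x)) := by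
    filter_upwards [Zer_near (f0_JC c) hg hz, e1, e2, hg, gt_mem_nhds h2] with x a1 a2 a3 a4 a5
    have form : Rn^[N] (f0 x) 1 = (-(-1) ^ N * X x (q + 1)) / (-(-1) ^ N * X x (2 ^ N)) := by
      rw [Rn_pow a4.zero (fun k hk h => a3 k (Finset.mem_range.2 hk) (by rw [X_f0, h, mul_zero])),
        mul_one, ← Function.iterate_add_apply, ← two_mul, mul_comm, ← pow_succ, hq, X_f0, X_f0]
      rw [X_f0] at a2
      have b1 : (f0 x)^[2 ^ N] 0 ≠ 0 := by rintro h; rw [h] at a2; simp at a2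
      have b2 : (-1:ℝ) ^ N ≠ 0 := by simp
      have b3 := a5.ne
      field_simp
    exact ⟨fun h => a1.1 (by rw [form]; exact div_pos h a2),
      fun h => a1.2.1 (by rw [form]; exact div_neg_of_neg_of_pos h a2)⟩
  constructor
  · filter_upwards [ds.1, key.filter_mono nhdsWithin_le_nhds] with x a b using b.1 a
  · filter_upwards [ds.2, key.filter_mono nhdsWithin_le_nhds] with x a b using b.2 a

def S (N : ℕ) : Set ℝ :=
  {c | -2 < c ∧ c < 0 ∧ ∃ i ≤ N, LZ i (f0 c) ∧ (Zer i (f0 c) → i < N)}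

theorem S_open (N : ℕ) : IsOpen (S N) := by
  rw [isOpen_iff_mem_nhds]
  rintro c ⟨h1, h2, i, hi, h3, h4⟩
  rcases h3 with h | h
  · filter_upwards [lt_mem_nhds h1, gt_mem_nhds h2, Lev_open (f0_JC c) h] with x a b l
    exact ⟨a, b, i, hi, Or.inl l, fun z => (l.not_Zer z).elim⟩
  · obtain ⟨l, r⟩ := Zer_lr h1 h2 h
    have l := eventually_nhdsWithin_iff.1 l
    have r := eventually_nhdsWithin_iff.1 r
    filter_upwards [lt_mem_nhds h1, gt_mem_nhds h2, l, r] with x a b l r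
    rcases lt_trichotomy x c with k | k | k
    · exact ⟨a, b, i + 1, h4 h, Or.inl (r k), fun z => ((r k).not_Zer z).elim⟩
    · rw [k]; exact ⟨h1, h2, i, hi, Or.inr h, h4⟩
    · exact ⟨a, b, i, hi, Or.inl (l k), fun z => ((l k).not_Zer z).elim⟩

theorem S_close {N : ℕ} {d : ℝ} {l : Filter ℝ} [l.NeBot] (hl : l ≤ 𝓝 d) (h1 : -2 < d) (h2 : d < 0)
    (h : ∀ᶠ x in l, x ∈ S N) : d ∈ S N ∨ Zer N (f0 d) := by
  have hg : ∀ᶠ x in 𝓝 d, Good 2 (f0 x) := by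
    filter_upwards [lt_mem_nhds h1, gt_mem_nhds h2] with x a b using f0_good a.le b
  obtain ⟨i, hi, hf⟩ : ∃ i ∈ Finset.range (N+1), ∃ᶠ x in l, LZ i (f0 x) := by
    by_contra hcon
    push Not at hcon
    have : ∀ᶠ x in l, ∀ i ∈ Finset.range (N+1), ¬ LZ i (f0 x) :=
      (eventually_all_finset _).2 fun i hi => by simpa using hcon i hi
    obtain ⟨x, ⟨_, _, i, hi, hz, _⟩, hn⟩ := (h.and this).exists
    exact hn i (by simp; omega) hz
  have hi : i ≤ N := by simp at hi; omega
  set l' := l ⊓ 𝓟 {x | LZ i (f0 x)}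
  have : l'.NeBot := frequently_mem_iff_neBot.1 hf
  have hl' : l' ≤ 𝓝 d := inf_le_left.trans hl
  have c1 := LZ_close (f := f0) (c := d) (L := 2) (n := i) hl' (f0_JC d) (hg.filter_mono hl')
    (f0_good h1.le h2) (mem_inf_of_right (mem_principal_self _))
  by_cases hz : Zer N (f0 d)
  · exact Or.inr hz
  · left
    rcases c1 with c1 | ⟨j, hj, c1⟩
    · refine ⟨h1, h2, i, hi, c1, fun z => lt_of_le_of_ne hi ?_⟩
      rintro rfl; exact hz z
    · exact ⟨h1, h2, j, by omega, Or.inr c1, fun _ => by omega⟩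

theorem S_not_Zer {N : ℕ} {c : ℝ} (h : c ∈ S N) : ¬ Zer N (f0 c) := by
  rintro hz
  obtain ⟨_, _, i, hi, a, b⟩ := h
  have := LZ.uniq a (Or.inr hz)
  subst this
  exact lt_irrefl _ (b hz)

theorem S_not_Lev {N M : ℕ} (hM : N < M) {c : ℝ} (h : c ∈ S N) : ¬ LZ M (f0 c) := by
  rintro hz
  obtain ⟨_, _, i, hi, a, b⟩ := h
  have := LZ.uniq a hz
  omega

theorem S_up {N : ℕ} {c e : ℝ} (h : c ∈ S N) (hce : c ≤ e) (he : e < 0) : e ∈ S N := by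
  by_contra hcon
  have hcomp : IsCompact (Set.Icc c e ∩ (S N)ᶜ) :=
    isCompact_Icc.inter_right (S_open N).isClosed_compl
  obtain ⟨d, ⟨⟨d1, d2⟩, d3⟩, d4⟩ := hcomp.exists_isLeast ⟨e, ⟨hce, le_rfl⟩, hcon⟩
  have hcd : c < d := lt_of_le_of_ne d1 (by rintro rfl; exact d3 h)
  have ev : ∀ᶠ x in 𝓝[<] d, x ∈ S N := by
    filter_upwards [Ioo_mem_nhdsLT hcd] with x hx
    by_contra hx2
    exact absurd (d4 ⟨⟨hx.1.le, hx.2.le.trans d2⟩, hx2⟩) (not_le.2 hx.2)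
  have hd1 : -2 < d := h.1.trans hcd
  have hd2 : d < 0 := d2.trans_lt he
  rcases S_close nhdsWithin_le_nhds hd1 hd2 ev with k | k
  · exact d3 k
  · obtain ⟨x, a, b⟩ := (ev.and (Zer_lr hd1 hd2 k).2).exists
    exact S_not_Lev (Nat.lt_succ_self N) a (Or.inl b)

theorem S_mem (N : ℕ) : (-1/2 : ℝ) ∈ S N := by
  refine ⟨by norm_num, by norm_num, 0, Nat.zero_le _, Or.inl (by simp [Lev, f0]; norm_num), ?_⟩
  intro h; simp [Zer, f0] at h; norm_num at h

theorem S_low {N : ℕ} {c : ℝ} (h : c ∈ S N) : -19/10 < c := by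
  obtain ⟨h1, h2, i, hi, a, b⟩ := h
  cases i with
  | zero => rw [LZ_zero] at a; simp only [f0] at a; linarith
  | succ i =>
    rw [LZ_succ] at a
    have := a.2.2.1
    simp only [f0] at this
    by_contra hc
    push Not at hc
    nlinarith [sq_nonneg (c+2), sq_nonneg (c+19/10)]

noncomputable def z (N : ℕ) : ℝ := sInf (S N)

theorem z_bdd (N : ℕ) : BddBelow (S N) := ⟨-19/10, fun _ h => (S_low h).le⟩

theorem z_le {N : ℕ} {c : ℝ} (h : c ∈ S N) : z N < c := by
  refine lt_of_le_of_ne (csInf_le (z_bdd N) h) ?_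
  rintro rfl
  obtain ⟨x, hx, hx2⟩ : ∃ x < z N, x ∈ S N := by
    obtain ⟨ε, h1, h2⟩ := Metric.isOpen_iff.1 (S_open N) _ h
    exact ⟨z N - ε/2, by linarith, h2 (by simp [abs_of_pos h1]; linarith)⟩
  linarith [csInf_le (z_bdd N) hx2, show z N = sInf (S N) from rfl]

theorem z_gt (N : ℕ) : -2 < z N := by
  have : -19/10 ≤ z N := le_csInf ⟨_, S_mem N⟩ fun _ h => (S_low h).le
  linarith

theorem z_neg (N : ℕ) : z N < 0 := by
  have := z_le (S_mem N); linarith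

theorem S_iff {N : ℕ} {c : ℝ} : c ∈ S N ↔ z N < c ∧ c < 0 := by
  refine ⟨fun h => ⟨z_le h, h.2.1⟩, fun ⟨h1, h2⟩ => ?_⟩
  obtain ⟨x, hx, hxc⟩ := (csInf_lt_iff (z_bdd N) ⟨_, S_mem N⟩).1 h1
  exact S_up hx hxc.le h2

theorem z_Zer (N : ℕ) : Zer N (f0 (z N)) := by
  have ev : ∀ᶠ x in 𝓝[>] (z N), x ∈ S N := by
    filter_upwards [Ioo_mem_nhdsGT (z_neg N)] with x hx using S_iff.2 hx
  rcases S_close nhdsWithin_le_nhds (z_gt N) (z_neg N) ev with h | h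
  · exact absurd (z_le h) (lt_irrefl _)
  · exact h

theorem z_lt (N : ℕ) : z (N + 1) < z N := by
  obtain ⟨x, a, b, c⟩ := ((Zer_lr (z_gt N) (z_neg N) (z_Zer N)).2.and
    ((Ioo_mem_nhdsLT (z_gt N)) |> fun h => (show ∀ᶠ x in 𝓝[<] z N, x ∈ Set.Ioo (-2) (z N) from h))).exists
  have : x ∈ S (N+1) := ⟨b, c.trans (z_neg N), N+1, le_rfl, Or.inl a, fun k => (a.not_Zer k).elim⟩
  exact (z_le this).trans c

theorem z_anti : StrictAnti z := strictAnti_nat_of_succ_lt z_lt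

theorem z_le_of_Lev {c : ℝ} {N : ℕ} (h1 : -2 < c) (h2 : c < 0) (h : LZ N (f0 c)) : z N ≤ c := by
  rcases h with h | h
  · exact (z_le ⟨h1, h2, N, le_rfl, Or.inl h, fun k => (h.not_Zer k).elim⟩).le
  · by_contra hc
    push Not at hc
    obtain ⟨x, a, b, c'⟩ := ((Zer_lr h1 h2 h).1.and
      (show ∀ᶠ x in 𝓝[>] c, x ∈ Set.Ioo c (z N) from Ioo_mem_nhdsGT hc)).exists
    have : x ∈ S N := ⟨h1.trans b, c'.trans (z_neg N), N, le_rfl, Or.inl a, fun k => (a.not_Zer k).elim⟩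
    linarith [z_le this]

theorem LZ_of_z {c : ℝ} {N : ℕ} (h2 : c < 0) (h : z N ≤ c) : ∃ i ≤ N, LZ i (f0 c) := by
  rcases h.eq_or_lt with h | h
  · exact ⟨N, le_rfl, Or.inr (h ▸ z_Zer N)⟩
  · obtain ⟨_, _, i, hi, k, _⟩ := S_iff.2 ⟨h, h2⟩
    exact ⟨i, hi, k⟩

theorem cF_le (N : ℕ) : feigenbaumValue ≤ z N := by
  have hh : Hor 0 (f0 (-2)) := by simp [Hor, f0]; norm_num
  refine csSup_le ⟨-2, Hor_mem (by norm_num) (by norm_num) hh⟩ ?_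
  rintro c ⟨x, hx1, hx2⟩
  by_contra hc
  push Not at hc
  have hper : (fun y : ℝ => y ^ 2 + c)^[Function.minimalPeriod (fun y : ℝ => y ^ 2 + c) x] x = x :=
    Function.isPeriodicPt_minimalPeriod _ x
  apply hx2
  have hm : ∃ m, (fun y : ℝ => y ^ 2 + c)^[2 ^ m] x = x := by
    rcases lt_or_ge c 0 with h | h
    · obtain ⟨i, _, hi⟩ := LZ_of_z h hc.le
      exact P_per ((z_gt N).trans hc).le h hi hx1 hper
    · exact ⟨0, by simpa using P_per_pos h hx1 hper⟩
  obtain ⟨m, hm⟩ := hm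
  obtain ⟨k, _, hk⟩ := (Nat.dvd_prime_pow Nat.prime_two).1 (Function.IsPeriodicPt.minimalPeriod_dvd (n := 2 ^ m) hm)
  exact ⟨k, hk⟩

theorem Hor_le {c : ℝ} {n : ℕ} (h1 : -2 ≤ c) (h2 : c < 0) (h : Hor n (f0 c)) :
    c ≤ feigenbaumValue := by
  refine le_csSup ⟨0, ?_⟩ (Hor_mem h1 h2 h)
  rintro c ⟨x, hx1, hx2⟩
  by_contra hc
  push Not at hc
  have hper : (fun y : ℝ => y ^ 2 + c)^[Function.minimalPeriod (fun y : ℝ => y ^ 2 + c) x] x = x :=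
    Function.isPeriodicPt_minimalPeriod _ x
  have := P_per_pos hc.le hx1 hper
  exact hx2 ⟨0, by
    have h : Function.IsFixedPt (fun y : ℝ => y ^ 2 + c) x := this
    rw [Function.minimalPeriod_eq_one_iff_isFixedPt.2 h]; simp⟩

theorem dbl_zero : doublingSuperattracting 0 = 0 := by
  have : {c : ℝ | Function.minimalPeriod (fun y : ℝ => y ^ 2 + c) 0 = 2 ^ 0} = {0} := by
    ext c
    simp [Function.minimalPeriod_eq_one_iff_isFixedPt, Function.IsFixedPt]
  rw [doublingSuperattracting, this, csSup_singleton]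

theorem z_minPer (n : ℕ) :
    Function.minimalPeriod (fun y : ℝ => y ^ 2 + z n) 0 = 2 ^ (n + 1) := by
  obtain ⟨a, b⟩ := (z_Zer n).zero (f0_good (z_gt n).le (z_neg n))
  have : Fact (Nat.Prime 2) := ⟨Nat.prime_two⟩
  refine Function.minimalPeriod_eq_prime_pow (p := 2) (k := n) ?_ ?_
  · intro h
    have : (fun y : ℝ => y ^ 2 + z n)^[2 ^ n] 0 = 0 := h
    rw [← X_iter, X_f0] at this
    rw [(mul_eq_zero.1 this).resolve_left (z_neg n).ne] at b
    simp at b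
  · show (fun y : ℝ => y ^ 2 + z n)^[2 ^ (n+1)] 0 = 0
    rw [← X_iter, X_f0, a, mul_zero]

theorem dbl_succ (n : ℕ) : doublingSuperattracting (n + 1) = z n := by
  refine IsGreatest.csSup_eq ⟨z_minPer n, ?_⟩
  intro c hc
  have hc : Function.minimalPeriod (fun y : ℝ => y ^ 2 + c) 0 = 2 ^ (n + 1) := hc
  by_contra hlt
  push Not at hlt
  have hper : (fun y : ℝ => y ^ 2 + c)^[2 ^ (n+1)] 0 = 0 := by
    rw [← hc]; exact Function.isPeriodicPt_minimalPeriod _ _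
  rcases lt_or_ge c 0 with h | h
  · obtain ⟨h1, _, i, hi, k1, k2⟩ := S_iff.2 ⟨hlt, h⟩
    have g := f0_good h1.le h
    rcases k1 with k | k
    · rw [← X_iter, X_f0] at hper
      exact k.notper g (by positivity) ((mul_eq_zero.1 hper).resolve_left h.ne)
    · have a := (k.zero g).1
      have p : Function.IsPeriodicPt (fun y : ℝ => y ^ 2 + c) (2 ^ (i+1)) 0 := by
        show (fun y : ℝ => y ^ 2 + c)^[2 ^ (i+1)] 0 = 0
        rw [← X_iter, X_f0, a, mul_zero]
      have := Nat.le_of_dvd (by positivity) p.minimalPeriod_dvd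
      rw [hc] at this
      have := (Nat.pow_le_pow_iff_right (by norm_num)).1 this
      have := k2 k
      omega
  · have := P_per_pos h (by positivity) hper
    have hf : Function.IsFixedPt (fun y : ℝ => y ^ 2 + c) 0 := this
    rw [Function.minimalPeriod_eq_one_iff_isFixedPt.2 hf] at hc
    have := Nat.one_lt_two_pow (n := n + 1) (by omega)
    omega

theorem reduction {lam b : ℝ} (h1 : 1 < lam) (hb : 0 < b)
    (h : Tendsto (fun n : ℕ => lam ^ n * (z n - feigenbaumValue)) atTop (nhds b)) :
    (∀ n : ℕ, feigenbaumValue < doublingSuperattracting n) ∧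
    ∃ lam b : ℝ, 1 < lam ∧ 0 < b ∧
      Tendsto (fun n : ℕ => lam ^ n * (doublingSuperattracting n - feigenbaumValue))
        atTop (nhds b) := by
  refine ⟨fun n => ?_, lam, lam * b, h1, by positivity, ?_⟩
  · cases n with
    | zero => rw [dbl_zero]; exact (cF_le 0).trans_lt (z_neg 0)
    | succ n => rw [dbl_succ]; exact (cF_le (n+1)).trans_lt (z_lt n)
  · rw [← tendsto_add_atTop_iff_nat 1]
    refine (h.const_mul lam).congr fun n => ?_
    rw [dbl_succ, pow_succ]; ring

end FB

namespace FC
open Polynomial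

noncomputable def Ww (w : ℕ → ℝ) (p : ℝ[X]) : ℝ := ∑ i ∈ p.support, |p.coeff i| * w i

theorem Ww_eq (w : ℕ → ℝ) (p : ℝ[X]) {s : Finset ℕ} (h : p.support ⊆ s) :
    Ww w p = ∑ i ∈ s, |p.coeff i| * w i := by
  unfold Ww
  refine Finset.sum_subset h fun i _ hi => ?_
  rw [notMem_support_iff.1 hi]; simp

theorem Ww_nonneg {w : ℕ → ℝ} (hw : ∀ i, 0 ≤ w i) (p : ℝ[X]) : 0 ≤ Ww w p :=
  Finset.sum_nonneg fun i _ => mul_nonneg (abs_nonneg _) (hw i)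

theorem Ww_add_le {w : ℕ → ℝ} (hw : ∀ i, 0 ≤ w i) (p q : ℝ[X]) :
    Ww w (p + q) ≤ Ww w p + Ww w q := by
  rw [Ww_eq w (p+q) (s := p.support ∪ q.support) support_add,
    Ww_eq w p Finset.subset_union_left, Ww_eq w q Finset.subset_union_right,
    ← Finset.sum_add_distrib]
  refine Finset.sum_le_sum fun i _ => ?_
  rw [coeff_add, ← add_mul]
  exact mul_le_mul_of_nonneg_right (abs_add_le _ _) (hw i)

theorem Ww_C_mul (w : ℕ → ℝ) (a : ℝ) (p : ℝ[X]) : Ww w (C a * p) = |a| * Ww w p := by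
  have : (C a * p).support ⊆ p.support := by
    intro i; simp only [mem_support_iff, coeff_C_mul]; exact right_ne_zero_of_mul
  rw [Ww_eq w _ this, Ww, Finset.mul_sum]
  exact Finset.sum_congr rfl fun i _ => by rw [coeff_C_mul, abs_mul]; ring

theorem Ww_neg (w : ℕ → ℝ) (p : ℝ[X]) : Ww w (-p) = Ww w p := by
  unfold Ww; simp

theorem Ww_sub_le {w : ℕ → ℝ} (hw : ∀ i, 0 ≤ w i) (p q : ℝ[X]) :
    Ww w (p - q) ≤ Ww w p + Ww w q := by
  rw [sub_eq_add_neg, ← Ww_neg w q]; exact Ww_add_le hw _ _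

theorem Ww_zero (w : ℕ → ℝ) : Ww w 0 = 0 := by simp [Ww]

theorem Ww_monomial (w : ℕ → ℝ) (n : ℕ) (a : ℝ) : Ww w (monomial n a) = |a| * w n := by
  rw [Ww_eq w _ (s := {n}) (support_monomial_subset _ _)]; simp

theorem Ww_sum_le {w : ℕ → ℝ} (hw : ∀ i, 0 ≤ w i) {ι : Type*} (s : Finset ι) (f : ι → ℝ[X]) :
    Ww w (∑ i ∈ s, f i) ≤ ∑ i ∈ s, Ww w (f i) := by
  classical
  induction s using Finset.induction_on with
  | empty => simp [Ww_zero]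
  | insert a s ha ih =>
    rw [Finset.sum_insert ha, Finset.sum_insert ha]
    exact (Ww_add_le hw _ _).trans (by linarith)

theorem Ww_mono {w w' : ℕ → ℝ} (h : ∀ i, w i ≤ w' i) (p : ℝ[X]) : Ww w p ≤ Ww w' p :=
  Finset.sum_le_sum fun i _ => mul_le_mul_of_nonneg_left (h i) (abs_nonneg _)

theorem Ww_smul_w (a : ℝ) (w : ℕ → ℝ) (p : ℝ[X]) : Ww (fun i => a * w i) p = a * Ww w p := by
  unfold Ww; rw [Finset.mul_sum]; exact Finset.sum_congr rfl fun i _ => by ring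

noncomputable def W (σ : ℝ) (p : ℝ[X]) : ℝ := Ww (fun i => σ ^ i) p
noncomputable def W1 (σ : ℝ) (p : ℝ[X]) : ℝ := Ww (fun i => i * σ ^ (i-1)) p
noncomputable def W2 (σ : ℝ) (p : ℝ[X]) : ℝ := Ww (fun i => i * (i - 1 : ℕ) * σ ^ (i-2)) p
noncomputable def N (p : ℝ[X]) : ℝ := W 2 p

theorem pw {σ : ℝ} (h : 0 ≤ σ) : ∀ i : ℕ, 0 ≤ σ ^ i := fun i => pow_nonneg h i
theorem two_nonneg' : (0:ℝ) ≤ 2 := by norm_num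
theorem pw2 : ∀ i : ℕ, (0:ℝ) ≤ 2 ^ i := pw two_nonneg'
theorem pw1 {σ : ℝ} (h : 0 ≤ σ) : ∀ i : ℕ, (0:ℝ) ≤ i * σ ^ (i-1) := fun i => by positivity
theorem pw22 {σ : ℝ} (h : 0 ≤ σ) : ∀ i : ℕ, (0:ℝ) ≤ i * (i - 1 : ℕ) * σ ^ (i-2) :=
  fun i => by positivity

theorem N_nonneg (p : ℝ[X]) : 0 ≤ N p := Ww_nonneg pw2 p
theorem N_add (p q : ℝ[X]) : N (p + q) ≤ N p + N q := Ww_add_le pw2 p q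
theorem N_sub (p q : ℝ[X]) : N (p - q) ≤ N p + N q := Ww_sub_le pw2 p q
theorem N_neg (p : ℝ[X]) : N (-p) = N p := Ww_neg _ p
theorem N_subc (p q : ℝ[X]) : N (p - q) = N (q - p) := by rw [← N_neg, neg_sub]
theorem N_C_mul (a : ℝ) (p : ℝ[X]) : N (C a * p) = |a| * N p := Ww_C_mul _ a p
theorem N_zero : N 0 = 0 := Ww_zero (fun i => 2^i)
theorem N_tri (p q r : ℝ[X]) : N (p - r) ≤ N (p - q) + N (q - r) := by
  have := N_add (p - q) (q - r); rwa [sub_add_sub_cancel] at this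

theorem W_mul {σ : ℝ} (h : 0 ≤ σ) (p q : ℝ[X]) : W σ (p * q) ≤ W σ p * W σ q := by
  rw [mul_eq_sum_sum]
  refine (Ww_sum_le (pw h) _ _).trans ?_
  unfold W Ww
  rw [Finset.sum_mul]
  refine Finset.sum_le_sum fun i _ => ?_
  rw [sum_def]
  refine (Ww_sum_le (pw h) _ _).trans ?_
  rw [Finset.mul_sum]
  refine Finset.sum_le_sum fun j _ => ?_
  rw [Ww_monomial, abs_mul, pow_add]
  exact le_of_eq (by ring)

theorem N_mul (p q : ℝ[X]) : N (p * q) ≤ N p * N q := W_mul two_nonneg' p q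

theorem W_C (σ a : ℝ) : W σ (C a) = |a| := by
  rw [← monomial_zero_left, W, Ww_monomial]; simp
theorem N_C (a : ℝ) : N (C a) = |a| := W_C 2 a
theorem N_one : N 1 = 1 := by rw [← C_1, N_C, abs_one]

theorem N_pow (p : ℝ[X]) (n : ℕ) : N (p ^ n) ≤ N p ^ n := by
  induction n with
  | zero => simp [N_one]
  | succ n ih =>
    rw [pow_succ, pow_succ]
    exact (N_mul _ _).trans (mul_le_mul_of_nonneg_right ih (N_nonneg _))

theorem comp_sum (p q : ℝ[X]) : p.comp q = ∑ i ∈ p.support, C (p.coeff i) * q ^ i := by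
  rw [comp, eval₂_eq_sum, sum_def]

theorem N_comp (p q : ℝ[X]) {σ : ℝ} (h : N q ≤ σ) : N (p.comp q) ≤ W σ p := by
  rw [comp_sum]
  refine (Ww_sum_le pw2 _ _).trans (Finset.sum_le_sum fun i _ => ?_)
  rw [Ww_C_mul]
  exact mul_le_mul_of_nonneg_left ((N_pow q i).trans (pow_le_pow_left₀ (N_nonneg _) h i))
    (abs_nonneg _)

theorem W_le_N {σ : ℝ} (h : 0 ≤ σ) (h2 : σ ≤ 2) (p : ℝ[X]) : W σ p ≤ N p :=
  Ww_mono (fun i => pow_le_pow_left₀ h h2 i) p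

theorem abs_eval_le {x σ : ℝ} (h : |x| ≤ σ) (p : ℝ[X]) : |p.eval x| ≤ W σ p := by
  rw [eval_eq_sum, sum_def]
  refine (Finset.abs_sum_le_sum_abs _ _).trans (Finset.sum_le_sum fun i _ => ?_)
  rw [abs_mul, abs_pow]
  exact mul_le_mul_of_nonneg_left (pow_le_pow_left₀ (abs_nonneg _) h i) (abs_nonneg _)

theorem abs_eval_N {x : ℝ} (h : |x| ≤ 2) (p : ℝ[X]) : |p.eval x| ≤ N p := abs_eval_le h p

theorem mono1 {σ : ℝ} (h : 0 ≤ σ) (h2 : σ < 2) (i : ℕ) : i * σ ^ (i-1) ≤ (1/(2-σ)) * 2 ^ i := by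
  rw [one_div_mul_eq_div, le_div_iff₀ (by linarith)]
  have key : ∀ i : ℕ, ((i+1:ℕ):ℝ) * σ ^ i * (2 - σ) ≤ 2 ^ (i+1) - σ ^ (i+1) := by
    intro i
    induction i with
    | zero => simp
    | succ i ih =>
      have a : σ ^ (i+1) ≤ 2 ^ (i+1) := pow_le_pow_left₀ h h2.le _
      have b := mul_le_mul_of_nonneg_right ih h
      rw [pow_succ (2:ℝ) (i+1), pow_succ σ (i+1)]
      push_cast at b ⊢
      have c : ((i:ℝ)+1+1) * σ ^ (i+1) * (2-σ) = (i+1) * σ^i*(2-σ)*σ + σ^(i+1)*(2-σ) := by ring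
      rw [c]
      nlinarith
  cases i with
  | zero => simp
  | succ i =>
    have := key i
    rw [Nat.add_sub_cancel]
    linarith [pw h (i+1)]

theorem mono2 {σ : ℝ} (h : 0 ≤ σ) (h2 : σ < 2) (i : ℕ) :
    i * (i-1:ℕ) * σ ^ (i-2) ≤ (2/(2-σ)^2) * 2 ^ i := by
  rw [div_mul_eq_mul_div, le_div_iff₀ (pow_pos (by linarith) 2)]
  have key : ∀ i : ℕ, ((i+2:ℕ):ℝ) * (i+1:ℕ) * σ ^ i * (2 - σ)^2 ≤ 2 * 2 ^ (i+2) -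
      2 * σ^(i+2) - 2 * (i+2:ℕ) * σ ^ (i+1) * (2-σ) := by
    intro i
    induction i with
    | zero => simp; nlinarith
    | succ i ih =>
      have a := mono1 h h2 (i+2)
      rw [one_div_mul_eq_div, le_div_iff₀ (by linarith)] at a
      have b := mul_le_mul_of_nonneg_right ih h
      have e : i + 2 - 1 = i + 1 := by omega
      rw [e] at a
      have a' : (2:ℝ) * 2^(i+2) * σ + (2 - σ) * (2 * 2^(i+2)) = 2 * 2 ^ (i+3) := by ring
      have p1 : 0 ≤ σ ^ i := pw h i
      push_cast at a b ⊢
      have e2 : σ ^ (i+1) = σ^i * σ := pow_succ _ _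
      have e3 : σ ^ (i+2) = σ^i * σ^2 := pow_add _ _ _
      have e4 : σ ^ (i+1+1) = σ^i * σ^2 := by ring
      have e5 : σ ^ (i+1+2) = σ^i * σ^3 := by ring
      rw [e2] at a b
      rw [e3] at b
      rw [e2, e4, e5]
      have key2 : ((i:ℝ)+2) * (σ^i*σ) * (2-σ) + σ^i * σ^2 ≤ 2^(i+2) := by
        have := (show ∀ i : ℕ, ((i+1:ℕ):ℝ) * σ ^ i * (2 - σ) ≤ 2 ^ (i+1) - σ ^ (i+1) from by
          intro i
          induction i with
          | zero => simp
          | succ i ih =>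
            have a : σ ^ (i+1) ≤ 2 ^ (i+1) := pow_le_pow_left₀ h h2.le _
            have b := mul_le_mul_of_nonneg_right ih h
            rw [pow_succ (2:ℝ) (i+1), pow_succ σ (i+1)]
            push_cast at b ⊢
            have c : ((i:ℝ)+1+1) * σ ^ (i+1) * (2-σ) = (i+1) * σ^i*(2-σ)*σ + σ^(i+1)*(2-σ) := by ring
            rw [c]
            nlinarith) (i+1)
        push_cast at this
        rw [e2, e4] at this
        have e6 : (2:ℝ)^(i+1+1) = 2^(i+2) := by ring
        rw [e6] at this
        nlinarith
      have q := mul_le_mul_of_nonneg_left key2 (show (0:ℝ) ≤ 2*(2-σ) by linarith)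
      have e7 : (2:ℝ)^(i+1+2) = 2*2^(i+2) := by ring
      rw [e7]
      nlinarith
  match i with
  | 0 => simp
  | 1 => simp
  | i+2 =>
    have := key i
    have e : i + 2 - 1 = i+1 := by omega
    have e' : i + 2 - 2 = i := by omega
    rw [e, e']
    have p1 := pw h (i+2)
    have p2 : (0:ℝ) ≤ 2 * (i+2:ℕ) * σ ^ (i+1) * (2-σ) :=
      mul_nonneg (mul_nonneg (by positivity) (pw h _)) (by linarith)
    linarith

theorem W1_le {σ : ℝ} (h : 0 ≤ σ) (h2 : σ < 2) (p : ℝ[X]) : W1 σ p ≤ 1/(2-σ) * N p := by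
  unfold N W; rw [← Ww_smul_w]; exact Ww_mono (mono1 h h2) p
theorem W2_le {σ : ℝ} (h : 0 ≤ σ) (h2 : σ < 2) (p : ℝ[X]) : W2 σ p ≤ 2/(2-σ)^2 * N p := by
  unfold N W; rw [← Ww_smul_w]; exact Ww_mono (mono2 h h2) p

theorem der_comp_sum (p a : ℝ[X]) :
    (derivative p).comp a = ∑ i ∈ p.support, C (p.coeff i) * (C (i:ℝ) * a ^ (i-1)) := by
  rw [derivative_apply, sum_def, Polynomial.sum_comp]
  refine Finset.sum_congr rfl fun i _ => ?_
  rw [mul_comp, C_comp, pow_comp, X_comp, C_mul, mul_assoc]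

theorem N_der_comp (p a : ℝ[X]) {σ : ℝ} (h : N a ≤ σ) : N ((derivative p).comp a) ≤ W1 σ p := by
  rw [der_comp_sum]
  refine (Ww_sum_le pw2 _ _).trans (Finset.sum_le_sum fun i _ => ?_)
  rw [Ww_C_mul, Ww_C_mul, Nat.abs_cast]
  exact mul_le_mul_of_nonneg_left (mul_le_mul_of_nonneg_left
    ((N_pow a _).trans (pow_le_pow_left₀ (N_nonneg _) h _)) (by positivity)) (abs_nonneg _)

theorem N_powmul (a b : ℝ[X]) {σ : ℝ} (ha : N a ≤ σ) (hb : N b ≤ σ) (i j : ℕ) :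
    N (a ^ i * b ^ j) ≤ σ ^ (i + j) := by
  have h := (N_nonneg a).trans ha
  rw [pow_add]
  exact (N_mul _ _).trans (mul_le_mul ((N_pow a i).trans (pow_le_pow_left₀ (N_nonneg _) ha i))
    ((N_pow b j).trans (pow_le_pow_left₀ (N_nonneg _) hb j)) (N_nonneg _) (pw h i))

theorem N_pow_sub (a b : ℝ[X]) {σ : ℝ} (ha : N a ≤ σ) (hb : N b ≤ σ) (n : ℕ) :
    N (b ^ n - a ^ n) ≤ n * σ ^ (n-1) * N (b - a) := by
  rw [← (Commute.all b a).geom_sum₂_mul]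
  refine (N_mul _ _).trans (mul_le_mul_of_nonneg_right ?_ (N_nonneg _))
  refine (Ww_sum_le pw2 _ _).trans ?_
  refine (Finset.sum_le_card_nsmul _ _ (σ^(n-1)) fun i hi => ?_).trans ?_
  · have := N_powmul b a hb ha i (n-1-i)
    rw [Finset.mem_range] at hi
    rwa [show i + (n-1-i) = n-1 by omega] at this
  · simp

theorem N_comp_sub (p a b : ℝ[X]) {σ : ℝ} (ha : N a ≤ σ) (hb : N b ≤ σ) :
    N (p.comp b - p.comp a) ≤ W1 σ p * N (b - a) := by
  rw [comp_sum, comp_sum, ← Finset.sum_sub_distrib]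
  refine (Ww_sum_le pw2 _ _).trans ?_
  unfold W1 Ww; rw [Finset.sum_mul]
  refine (Finset.sum_le_sum fun i _ => ?_)
  have := N_pow_sub a b ha hb i
  rw [← mul_sub]
  have e := N_C_mul (p.coeff i) (b^i - a^i)
  refine (le_of_eq e).trans ?_
  rw [mul_assoc]
  exact mul_le_mul_of_nonneg_left this (abs_nonneg _)

theorem N_pow_sub2 (o a b : ℝ[X]) {σ ρ : ℝ} (ho : N o ≤ σ) (ha : N a ≤ σ) (hb : N b ≤ σ)
    (hao : N (a - o) ≤ ρ) (hbo : N (b - o) ≤ ρ) (n : ℕ) :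
    N (b ^ n - a ^ n - C (n:ℝ) * o ^ (n-1) * (b - a)) ≤
      n * (n-1:ℕ) * σ ^ (n-2) * ρ * N (b - a) := by
  have h := (N_nonneg o).trans ho
  have hρ := (N_nonneg _).trans hao
  rw [← (Commute.all b a).geom_sum₂_mul, ← sub_mul]
  refine (N_mul _ _).trans (mul_le_mul_of_nonneg_right ?_ (N_nonneg _))
  have e : C (n:ℝ) * o ^ (n-1) = ∑ i ∈ Finset.range n, o ^ (n-1) := by simp
  rw [e, ← Finset.sum_sub_distrib]
  refine (Ww_sum_le pw2 _ _).trans ?_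
  refine (Finset.sum_le_card_nsmul _ _ ((n-1:ℕ) * σ^(n-2) * ρ) fun i hi => ?_).trans ?_
  · rw [Finset.mem_range] at hi
    have e2 : b ^ i * a ^ (n-1-i) - o ^ (n-1)
        = (b ^ i - o ^ i) * a ^ (n-1-i) + o ^ i * (a ^ (n-1-i) - o^(n-1-i)) := by
      have : o ^ (n-1) = o^i * o^(n-1-i) := by rw [← pow_add]; congr 1; omega
      rw [this]; ring
    rw [e2]
    have p1 : N ((b ^ i - o ^ i) * a ^ (n-1-i)) ≤ i * σ^(n-2) * ρ := by
      refine (N_mul _ _).trans ?_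
      have q1 := N_pow_sub o b ho hb i
      have q2 := (N_pow a (n-1-i)).trans (pow_le_pow_left₀ (N_nonneg _) ha _)
      have q3 : N (b^i - o^i) ≤ i * σ^(i-1) * ρ :=
        q1.trans (mul_le_mul_of_nonneg_left hbo (pw1 h i))
      refine (mul_le_mul q3 q2 (N_nonneg _) (mul_nonneg (pw1 h i) hρ)).trans (le_of_eq ?_)
      rcases Nat.eq_zero_or_pos i with rfl | hp
      · simp
      · have : σ^(n-2) = σ^(i-1) * σ^(n-1-i) := by rw [← pow_add]; congr 1; omega
        rw [this]; ring
    have p2 : N (o ^ i * (a ^ (n-1-i) - o^(n-1-i))) ≤ (n-1-i:ℕ) * σ^(n-2) * ρ := by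
      refine (N_mul _ _).trans ?_
      have q1 := N_pow_sub o a ho ha (n-1-i)
      have q2 := (N_pow o i).trans (pow_le_pow_left₀ (N_nonneg _) ho _)
      have q3 : N (a^(n-1-i) - o^(n-1-i)) ≤ (n-1-i:ℕ) * σ^((n-1-i)-1) * ρ :=
        q1.trans (mul_le_mul_of_nonneg_left hao (pw1 h _))
      refine (mul_le_mul q2 q3 (N_nonneg _) (pw h i)).trans (le_of_eq ?_)
      rcases Nat.eq_zero_or_pos (n-1-i) with h0 | hp
      · rw [h0]; simp
      · have : σ^(n-2) = σ^i * σ^(n-1-i-1) := by rw [← pow_add]; congr 1; omega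
        rw [this]; ring
    refine (N_add _ _).trans ((add_le_add p1 p2).trans (le_of_eq ?_))
    have : ((n-1:ℕ):ℝ) = (i:ℝ) + (n-1-i:ℕ) := by rw [← Nat.cast_add]; congr 1; omega
    rw [this]; ring
  · simp only [Finset.card_range, nsmul_eq_mul]; exact le_of_eq (by ring)

theorem N_comp_sub2 (p o a b : ℝ[X]) {σ ρ : ℝ} (ho : N o ≤ σ) (ha : N a ≤ σ) (hb : N b ≤ σ)
    (hao : N (a - o) ≤ ρ) (hbo : N (b - o) ≤ ρ) :
    N (p.comp b - p.comp a - (derivative p).comp o * (b - a)) ≤ W2 σ p * ρ * N (b - a) := by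
  rw [comp_sum, comp_sum, der_comp_sum, ← Finset.sum_sub_distrib, Finset.sum_mul,
    ← Finset.sum_sub_distrib]
  refine (Ww_sum_le pw2 _ _).trans ?_
  unfold W2 Ww; rw [Finset.sum_mul, Finset.sum_mul]
  refine (Finset.sum_le_sum fun i _ => ?_)
  have := N_pow_sub2 o a b ho ha hb hao hbo i
  have e : C (p.coeff i) * b ^ i - C (p.coeff i) * a ^ i -
      C (p.coeff i) * (C (i:ℝ) * o ^ (i-1)) * (b - a) =
      C (p.coeff i) * (b ^ i - a ^ i - C (i:ℝ) * o ^ (i-1) * (b - a)) := by ring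
  rw [e]
  refine (le_of_eq (N_C_mul _ _)).trans ?_
  calc _ ≤ |p.coeff i| * _ := mul_le_mul_of_nonneg_left this (abs_nonneg _)
    _ = _ := by ring

theorem abs_eval0_le (d : ℝ[X]) (h : d.eval (-1) = 0) : |d.eval 0| ≤ N d / 3 := by
  have e0 : d.eval 0 = d.coeff 0 := (coeff_zero_eq_eval_zero d).symm
  have hs : d.support ⊆ Finset.range (d.natDegree + 1) := supp_subset_range_natDegree_succ
  have hN : N d = ∑ i ∈ Finset.range (d.natDegree + 1), |d.coeff i| * 2 ^ i := Ww_eq _ d hs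
  rw [eval_eq_sum_range, Finset.sum_range_succ'] at h
  rw [Finset.sum_range_succ'] at hN
  simp only [pow_zero, mul_one] at h hN
  have h1 : |d.coeff 0| ≤ ∑ i ∈ Finset.range d.natDegree, |d.coeff (i+1)| := by
    have : d.coeff 0 = -∑ i ∈ Finset.range d.natDegree, d.coeff (i+1) * (-1)^(i+1) := by linarith
    rw [this, abs_neg]
    refine (Finset.abs_sum_le_sum_abs _ _).trans (Finset.sum_le_sum fun i _ => ?_)
    rw [abs_mul, abs_pow, abs_neg, abs_one, one_pow, mul_one]
  have h2 : 2 * ∑ i ∈ Finset.range d.natDegree, |d.coeff (i+1)| ≤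
      ∑ i ∈ Finset.range d.natDegree, |d.coeff (i+1)| * 2^(i+1) := by
    rw [Finset.mul_sum]
    refine Finset.sum_le_sum fun i _ => ?_
    have : (1:ℝ) ≤ 2 ^ i := one_le_pow₀ (by norm_num)
    rw [pow_succ]
    nlinarith [abs_nonneg (d.coeff (i+1))]
  rw [e0]; linarith

end FC

namespace FC
open Polynomial

structure Cst where
  (m M sA nB sG nH c1A c2A c1G c2G : ℝ)

noncomputable def sv (Φ : ℝ[X]) : ℝ := Φ.eval 0
noncomputable def Ap (Φ : ℝ[X]) : ℝ[X] := C (sv Φ) * C (sv Φ) * (1 + X) - 1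
noncomputable def Bp (Φ : ℝ[X]) : ℝ[X] := Φ.comp (Ap Φ)
noncomputable def Gp (Φ : ℝ[X]) : ℝ[X] := Bp Φ * Bp Φ - 1
noncomputable def Hp (Φ : ℝ[X]) : ℝ[X] := Φ.comp (Gp Φ)
noncomputable def Rp (Φ : ℝ[X]) : ℝ[X] := C (1 / sv Φ) * Hp Φ

noncomputable def DA (O d : ℝ[X]) : ℝ[X] := C (2 * sv O * sv d) * (1 + X)
noncomputable def DB (O d : ℝ[X]) : ℝ[X] := d.comp (Ap O) + (derivative O).comp (Ap O) * DA O d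
noncomputable def DG (O d : ℝ[X]) : ℝ[X] := Bp O * DB O d + DB O d * Bp O
noncomputable def DH (O d : ℝ[X]) : ℝ[X] := d.comp (Gp O) + (derivative O).comp (Gp O) * DG O d
noncomputable def DR (O d : ℝ[X]) : ℝ[X] :=
  C (1 / sv O) * DH O d + C (- sv d / (sv O)^2) * Hp O

def Con (Φ : ℝ[X]) : Prop := Φ.eval (-1) = 1
def Tan (d : ℝ[X]) : Prop := d.eval (-1) = 0

theorem Con.sub {Φ Ψ : ℝ[X]} (h : Con Φ) (h' : Con Ψ) : Tan (Φ - Ψ) := by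
  unfold Tan; rw [eval_sub, h, h', sub_self]

theorem Rp_con {Φ : ℝ[X]} (h : Con Φ) (hs : sv Φ ≠ 0) : Con (Rp Φ) := by
  unfold Con Rp Hp Gp Bp Ap
  unfold Con at h
  simp only [eval_mul, eval_comp, eval_sub, eval_add, eval_C, eval_one, eval_X]
  norm_num
  rw [h]
  norm_num
  change (sv Φ)⁻¹ * sv Φ = 1
  exact inv_mul_cancel₀ hs

noncomputable def toF (Φ : ℝ[X]) : ℝ → ℝ := fun x => Φ.eval (x^2 - 1)

theorem toF_one (Φ : ℝ[X]) : toF Φ 1 = sv Φ := by unfold toF sv; norm_num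

theorem toF_Rp (Φ : ℝ[X]) : toF (Rp Φ) = FB.Rn (toF Φ) := by
  funext x
  unfold FB.Rn
  rw [toF_one]
  unfold toF Rp Hp Gp Bp Ap
  simp only [eval_mul, eval_comp, eval_sub, eval_add, eval_C, eval_one, eval_X]
  rw [one_div_mul_eq_div]
  congr 2
  rw [show sv Φ * sv Φ * (1 + (x^2 - 1)) - 1 = (sv Φ * x)^2 - 1 by ring]
  ring

structure Bd (k : Cst) (Φ : ℝ[X]) : Prop where
  con : Con Φ
  m : k.m ≤ |sv Φ|
  M : |sv Φ| ≤ k.M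
  sA : N (Ap Φ) ≤ k.sA
  nB : N (Bp Φ) ≤ k.nB
  sG : N (Gp Φ) ≤ k.sG
  nH : N (Hp Φ) ≤ k.nH
  c1A : W1 k.sA Φ ≤ k.c1A
  c2A : W2 k.sA Φ ≤ k.c2A
  c1G : W1 k.sG Φ ≤ k.c1G
  c2G : W2 k.sG Φ ≤ k.c2G

namespace Cst
variable (k : Cst)
noncomputable def bA : ℝ := 2 * k.M
noncomputable def bB : ℝ := 1 + k.c1A * k.bA
noncomputable def bG : ℝ := 2 * k.nB * k.bB
noncomputable def bH : ℝ := 1 + k.c1G * k.bG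
noncomputable def gA : ℝ := 2 / 3
noncomputable def gB : ℝ := 2 * (1/(2-k.sA)) * k.bA + k.c2A * k.bA^2 + k.c1A * gA
noncomputable def gG : ℝ := 2 * k.nB * k.gB + 2 * k.bB^2
noncomputable def gH : ℝ := 2 * (1/(2-k.sG)) * k.bG + k.c2G * k.bG^2 + k.c1G * k.gG
noncomputable def K : ℝ := k.nH * (2/(9*k.m^3)) + k.gH / k.m + 2 * k.bH / (3 * k.m^2)
structure Ok : Prop where
  m : 0 < k.m
  M : 0 ≤ k.M
  A0 : 0 ≤ k.sA
  A2 : k.sA < 2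
  G0 : 0 ≤ k.sG
  G2 : k.sG < 2
  B : 0 ≤ k.nB
  H : 0 ≤ k.nH
  c1A : 0 ≤ k.c1A
  c2A : 0 ≤ k.c2A
  c1G : 0 ≤ k.c1G
  c2G : 0 ≤ k.c2G
end Cst

theorem N_1X : N (1 + X : ℝ[X]) ≤ 3 := by
  refine (N_add _ _).trans ?_
  rw [N_one]
  have : N (X : ℝ[X]) = 2 := by
    unfold N W; rw [← monomial_one_one_eq_X, Ww_monomial]; norm_num
  rw [this]; norm_num

theorem sv_sub (a b : ℝ[X]) : sv (a - b) = sv a - sv b := eval_sub _ _ _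
theorem sv_le {d : ℝ[X]} (h : Tan d) : |sv d| ≤ N d / 3 := abs_eval0_le d h

section Lip
variable {F Φ : ℝ[X]}

theorem lipA {M : ℝ} (hF : |sv F| ≤ M) (hΦ : |sv Φ| ≤ M) (h : Tan (Φ - F)) :
    N (Ap Φ - Ap F) ≤ 2 * M * N (Φ - F) := by
  have e : Ap Φ - Ap F = C ((sv Φ + sv F) * sv (Φ - F)) * (1 + X) := by
    rw [sv_sub]; unfold Ap; simp only [C_mul, C_add, C_sub]; ring
  rw [e, N_C_mul, abs_mul]
  have h1 := sv_le h
  have h2 : |sv Φ + sv F| ≤ 2 * M := (abs_add_le _ _).trans (by linarith)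
  have h3 := N_1X
  have h0 : 0 ≤ 2 * M := (abs_nonneg _).trans h2
  calc _ ≤ (2 * M * (N (Φ - F) / 3)) * 3 :=
        mul_le_mul (mul_le_mul h2 h1 (abs_nonneg _) h0) h3 (N_nonneg _)
          (mul_nonneg h0 (by linarith [N_nonneg (Φ - F)]))
    _ = _ := by ring

theorem lipC {a b : ℝ[X]} {σ c β : ℝ} (ha : N a ≤ σ) (hb : N b ≤ σ) (h2 : σ ≤ 2)
    (hc : W1 σ F ≤ c) (hab : N (b - a) ≤ β * N (Φ - F)) :
    N (Φ.comp b - F.comp a) ≤ (1 + c * β) * N (Φ - F) := by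
  have h0 := (N_nonneg a).trans ha
  have e : Φ.comp b - F.comp a = (Φ - F).comp b + (F.comp b - F.comp a) := by
    rw [sub_comp]; ring
  rw [e]
  have h1 := (N_comp (Φ - F) b hb).trans (W_le_N h0 h2 _)
  have h3 := N_comp_sub F a b ha hb
  have h4 : W1 σ F * N (b - a) ≤ c * (β * N (Φ - F)) :=
    mul_le_mul hc hab (N_nonneg _) ((Ww_nonneg (pw1 h0) F).trans hc)
  refine (N_add _ _).trans ?_
  linarith

theorem lipG {n β : ℝ} (hF : N (Bp F) ≤ n) (hΦ : N (Bp Φ) ≤ n)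
    (h : N (Bp Φ - Bp F) ≤ β * N (Φ - F)) : N (Gp Φ - Gp F) ≤ 2 * n * β * N (Φ - F) := by
  have e : Gp Φ - Gp F = (Bp Φ + Bp F) * (Bp Φ - Bp F) := by unfold Gp; ring
  rw [e]
  have h2 : N (Bp Φ + Bp F) ≤ 2 * n := (N_add _ _).trans (by linarith)
  calc _ ≤ _ := N_mul _ _
    _ ≤ 2 * n * (β * N (Φ - F)) := mul_le_mul h2 h (N_nonneg _) ((N_nonneg _).trans h2)
    _ = _ := by ring

end Lip

structure Bd0 (k : Cst) (r : ℝ) (F : ℝ[X]) : Prop where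
  con : Con F
  m : k.m + r/3 ≤ |sv F|
  M : |sv F| + r/3 ≤ k.M
  sA : N (Ap F) + k.bA * r ≤ k.sA
  nB : N (Bp F) + k.bB * r ≤ k.nB
  sG : N (Gp F) + k.bG * r ≤ k.sG
  nH : N (Hp F) + k.bH * r ≤ k.nH
  c1A : W1 k.sA F + 1/(2-k.sA) * r ≤ k.c1A
  c2A : W2 k.sA F + 2/(2-k.sA)^2 * r ≤ k.c2A
  c1G : W1 k.sG F + 1/(2-k.sG) * r ≤ k.c1G
  c2G : W2 k.sG F + 2/(2-k.sG)^2 * r ≤ k.c2G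

theorem Ww_near {w : ℕ → ℝ} (hw : ∀ i, 0 ≤ w i) (F Φ : ℝ[X]) :
    Ww w Φ ≤ Ww w F + Ww w (Φ - F) := by
  have := Ww_add_le hw F (Φ - F); rwa [add_sub_cancel] at this
theorem W1_near {σ : ℝ} (h : 0 ≤ σ) (F Φ : ℝ[X]) : W1 σ Φ ≤ W1 σ F + W1 σ (Φ - F) :=
  Ww_near (pw1 h) F Φ
theorem W2_near {σ : ℝ} (h : 0 ≤ σ) (F Φ : ℝ[X]) : W2 σ Φ ≤ W2 σ F + W2 σ (Φ - F) :=
  Ww_near (pw22 h) F Φ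
theorem N_near (F Φ : ℝ[X]) : N Φ ≤ N F + N (Φ - F) := Ww_near pw2 F Φ

section
variable {k : Cst}
theorem Cst.Ok.bA (h : k.Ok) : 0 ≤ k.bA := by unfold Cst.bA; linarith [h.M]
theorem Cst.Ok.bB (h : k.Ok) : 0 ≤ k.bB := by
  unfold Cst.bB; linarith [mul_nonneg h.c1A h.bA]
theorem Cst.Ok.bG (h : k.Ok) : 0 ≤ k.bG := by
  unfold Cst.bG; exact mul_nonneg (by linarith [h.B]) h.bB
theorem Cst.Ok.bH (h : k.Ok) : 0 ≤ k.bH := by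
  unfold Cst.bH; linarith [mul_nonneg h.c1G h.bG]

theorem Bd0.ball (hk : k.Ok) {r : ℝ} {F Φ : ℝ[X]} (h : Bd0 k r F) (hc : Con Φ)
    (hr : N (Φ - F) ≤ r) : Bd k Φ := by
  have ht := hc.sub h.con
  have h0 := N_nonneg (Φ - F)
  have hs := sv_le ht
  rw [sv_sub] at hs
  have hsM : |sv Φ| ≤ k.M := by
    have := abs_sub_abs_le_abs_sub (sv Φ) (sv F); linarith [h.M]
  have hsm : k.m ≤ |sv Φ| := by
    have := abs_sub_abs_le_abs_sub (sv F) (sv Φ)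
    rw [abs_sub_comm] at this; linarith [h.m]
  have hsF : |sv F| ≤ k.M := by linarith [h.M]
  have mulr : ∀ {β : ℝ}, 0 ≤ β → β * N (Φ - F) ≤ β * r := fun hb =>
    mul_le_mul_of_nonneg_left hr hb
  have a1 : N (Ap Φ - Ap F) ≤ k.bA * N (Φ - F) := lipA hsF hsM ht
  have a2 : N (Ap Φ) ≤ k.sA := by
    linarith [N_near (Ap F) (Ap Φ), mulr hk.bA, h.sA]
  have nn : ∀ {β : ℝ}, 0 ≤ β → 0 ≤ β * r := fun hb => mul_nonneg hb (h0.trans hr)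
  have a3 : N (Ap F) ≤ k.sA := by linarith [nn hk.bA, h.sA]
  have A2 := hk.A2
  have G2 := hk.G2
  have d1 : 0 ≤ 1/(2-k.sA) := one_div_nonneg.2 (by linarith)
  have d2 : 0 ≤ 2/(2-k.sA)^2 := by positivity
  have d3 : 0 ≤ 1/(2-k.sG) := one_div_nonneg.2 (by linarith)
  have d4 : 0 ≤ 2/(2-k.sG)^2 := by positivity
  have c1 : W1 k.sA Φ ≤ k.c1A := by
    have := W1_near hk.A0 F Φ
    have t := W1_le hk.A0 hk.A2 (Φ - F)
    linarith [h.c1A, mulr d1]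
  have c2 : W2 k.sA Φ ≤ k.c2A := by
    have := W2_near hk.A0 F Φ
    have t := W2_le hk.A0 hk.A2 (Φ - F)
    linarith [h.c2A, mulr d2]
  have c3 : W1 k.sG Φ ≤ k.c1G := by
    have := W1_near hk.G0 F Φ
    have t := W1_le hk.G0 hk.G2 (Φ - F)
    linarith [h.c1G, mulr d3]
  have c4 : W2 k.sG Φ ≤ k.c2G := by
    have := W2_near hk.G0 F Φ
    have t := W2_le hk.G0 hk.G2 (Φ - F)
    linarith [h.c2G, mulr d4]
  have c1F : W1 k.sA F ≤ k.c1A := by linarith [h.c1A, nn d1]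
  have c1F' : W1 k.sG F ≤ k.c1G := by linarith [h.c1G, nn d3]
  have b1 : N (Bp Φ - Bp F) ≤ k.bB * N (Φ - F) := lipC a3 a2 A2.le c1F a1
  have b2 : N (Bp Φ) ≤ k.nB := by linarith [N_near (Bp F) (Bp Φ), mulr hk.bB, h.nB]
  have b3 : N (Bp F) ≤ k.nB := by linarith [nn hk.bB, h.nB]
  have g1 : N (Gp Φ - Gp F) ≤ k.bG * N (Φ - F) := lipG b3 b2 b1
  have g2 : N (Gp Φ) ≤ k.sG := by linarith [N_near (Gp F) (Gp Φ), mulr hk.bG, h.sG]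
  have g3 : N (Gp F) ≤ k.sG := by linarith [nn hk.bG, h.sG]
  have h1 : N (Hp Φ - Hp F) ≤ k.bH * N (Φ - F) := lipC g3 g2 G2.le c1F' g1
  have h2 : N (Hp Φ) ≤ k.nH := by linarith [N_near (Hp F) (Hp Φ), mulr hk.bH, h.nH]
  exact ⟨hc, hsm, hsM, a2, b2, g2, h2, c1, c2, c3, c4⟩
end

structure Tri (U : Set ℝ[X]) (O : ℝ[X]) (ρ : ℝ) (F DF : ℝ[X] → ℝ[X]) (a β γ : ℝ) : Prop where
  a : ∀ Φ ∈ U, N (F Φ) ≤ a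
  b : ∀ Φ ∈ U, ∀ Ψ ∈ U, N (F Ψ - F Φ) ≤ β * N (Ψ - Φ)
  g : ∀ Φ ∈ U, ∀ Ψ ∈ U, N (F Ψ - F Φ - DF (Ψ - Φ)) ≤ γ * ρ * N (Ψ - Φ)
  d : ∀ d, Tan d → N (DF d) ≤ β * N d

theorem Tri.mul {U : Set ℝ[X]} {O : ℝ[X]} {ρ : ℝ} {F DF G DG' : ℝ[X] → ℝ[X]}
    {a1 b1 g1 a2 b2 g2 : ℝ} (hU : ∀ Φ ∈ U, Con Φ) (hO : O ∈ U) (hρ : ∀ Φ ∈ U, N (Φ - O) ≤ ρ)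
    (hb1 : 0 ≤ b1) (hb2 : 0 ≤ b2) (hg1 : 0 ≤ g1) (hg2 : 0 ≤ g2)
    (h1 : Tri U O ρ F DF a1 b1 g1) (h2 : Tri U O ρ G DG' a2 b2 g2) :
    Tri U O ρ (fun Φ => F Φ * G Φ) (fun d => F O * DG' d + DF d * G O) (a1*a2) (a1*b2+b1*a2)
      (a1*g2+a2*g1+2*b1*b2) := by
  have ha1 := (N_nonneg _).trans (h1.a O hO)
  have ha2 := (N_nonneg _).trans (h2.a O hO)
  have hρ0 := (N_nonneg _).trans (hρ O hO)
  have mm : ∀ {p q : ℝ[X]} {x y : ℝ}, N p ≤ x → N q ≤ y → N (p * q) ≤ x * y := fun hp hq =>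
    (N_mul _ _).trans (mul_le_mul hp hq (N_nonneg _) ((N_nonneg _).trans hp))
  refine ⟨fun Φ h => mm (h1.a Φ h) (h2.a Φ h), fun Φ hΦ Ψ hΨ => ?_, fun Φ hΦ Ψ hΨ => ?_,
    fun d hd => ?_⟩
  · have e : F Ψ * G Ψ - F Φ * G Φ = F Ψ * (G Ψ - G Φ) + (F Ψ - F Φ) * G Φ := by ring
    rw [e]
    have := mm (h1.a Ψ hΨ) (h2.b Φ hΦ Ψ hΨ)
    have := mm (h1.b Φ hΦ Ψ hΨ) (h2.a Φ hΦ)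
    refine (N_add _ _).trans ?_
    linarith
  · have e : F Ψ * G Ψ - F Φ * G Φ - (F O * DG' (Ψ - Φ) + DF (Ψ - Φ) * G O) =
      ((F Ψ - F Φ - DF (Ψ - Φ)) * G Ψ + DF (Ψ - Φ) * (G Ψ - G O)) +
      (F Φ * (G Ψ - G Φ - DG' (Ψ - Φ)) + (F Φ - F O) * DG' (Ψ - Φ)) := by ring
    rw [e]
    have ht := (hU Ψ hΨ).sub (hU Φ hΦ)
    have q1 := mm (h1.g Φ hΦ Ψ hΨ) (h2.a Ψ hΨ)
    have q2 := mm (h1.d _ ht) ((h2.b O hO Ψ hΨ).trans (mul_le_mul_of_nonneg_left (hρ Ψ hΨ) hb2))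
    have q3 := mm (h1.a Φ hΦ) (h2.g Φ hΦ Ψ hΨ)
    have q4 := mm ((h1.b O hO Φ hΦ).trans (mul_le_mul_of_nonneg_left (hρ Φ hΦ) hb1)) (h2.d _ ht)
    refine (N_add _ _).trans ((add_le_add (N_add _ _) (N_add _ _)).trans ?_)
    linarith
  · have q1 := mm (h1.a O hO) (h2.d d hd)
    have q2 := mm (h1.d d hd) (h2.a O hO)
    refine (N_add _ _).trans ?_
    linarith

theorem Tri.comp {U : Set ℝ[X]} {O : ℝ[X]} {ρ : ℝ} {A DA' : ℝ[X] → ℝ[X]}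
    {σ β γ c1 c2 a : ℝ} (hU : ∀ Φ ∈ U, Con Φ) (hO : O ∈ U) (hρ : ∀ Φ ∈ U, N (Φ - O) ≤ ρ)
    (hb : 0 ≤ β) (hσ : σ < 2)
    (hA : Tri U O ρ A DA' σ β γ) (ha : ∀ Φ ∈ U, N (Φ.comp (A Φ)) ≤ a)
    (hc1 : ∀ Φ ∈ U, W1 σ Φ ≤ c1) (hc2 : ∀ Φ ∈ U, W2 σ Φ ≤ c2) :
    Tri U O ρ (fun Φ => Φ.comp (A Φ)) (fun d => d.comp (A O) + (derivative O).comp (A O) * DA' d)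
      a (1 + c1 * β) (2 * (1/(2-σ)) * β + c2 * β^2 + c1 * γ) := by
  have hσ0 := (N_nonneg _).trans (hA.a O hO)
  have hρ0 := (N_nonneg _).trans (hρ O hO)
  have mm : ∀ {p q : ℝ[X]} {x y : ℝ}, N p ≤ x → N q ≤ y → N (p * q) ≤ x * y := fun hp hq =>
    (N_mul _ _).trans (mul_le_mul hp hq (N_nonneg _) ((N_nonneg _).trans hp))
  have hd0 : 0 ≤ 1/(2-σ) := one_div_nonneg.2 (by linarith)
  refine ⟨ha, fun Φ hΦ Ψ hΨ => lipC (hA.a Φ hΦ) (hA.a Ψ hΨ) hσ.le (hc1 Φ hΦ) (hA.b Φ hΦ Ψ hΨ),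
    fun Φ hΦ Ψ hΨ => ?_, fun d hd => ?_⟩
  · have e : Ψ.comp (A Ψ) - Φ.comp (A Φ) - ((Ψ - Φ).comp (A O) +
        (derivative O).comp (A O) * DA' (Ψ - Φ)) =
      ((Ψ - Φ).comp (A Ψ) - (Ψ - Φ).comp (A O)) +
      (Φ.comp (A Ψ) - Φ.comp (A Φ) - (derivative Φ).comp (A O) * (A Ψ - A Φ)) +
      ((derivative (Φ - O)).comp (A O) * (A Ψ - A Φ)) +
      ((derivative O).comp (A O) * (A Ψ - A Φ - DA' (Ψ - Φ))) := by
      rw [derivative_sub]; simp only [sub_comp]; ring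
    rw [e]
    set x := N (Ψ - Φ) with hx
    have hx0 : 0 ≤ x := N_nonneg _
    have rr : ∀ Φ ∈ U, N (A Φ - A O) ≤ β * ρ := fun Φ hΦ =>
      (hA.b O hO Φ hΦ).trans (mul_le_mul_of_nonneg_left (hρ Φ hΦ) hb)
    have q1 : N ((Ψ - Φ).comp (A Ψ) - (Ψ - Φ).comp (A O)) ≤ (1/(2-σ) * x) * (β * ρ) :=
      (N_comp_sub (Ψ - Φ) (A O) (A Ψ) (hA.a O hO) (hA.a Ψ hΨ)).trans
        (mul_le_mul (W1_le hσ0 hσ _) (rr Ψ hΨ) (N_nonneg _) (mul_nonneg hd0 hx0))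
    have q2 : N (Φ.comp (A Ψ) - Φ.comp (A Φ) - (derivative Φ).comp (A O) * (A Ψ - A Φ)) ≤
        c2 * (β * ρ) * (β * x) := by
      refine (N_comp_sub2 Φ (A O) (A Φ) (A Ψ) (hA.a O hO) (hA.a Φ hΦ) (hA.a Ψ hΨ)
        (rr Φ hΦ) (rr Ψ hΨ)).trans ?_
      have : 0 ≤ β * ρ := mul_nonneg hb hρ0
      have h2 : 0 ≤ W2 σ Φ := Ww_nonneg (pw22 hσ0) Φ
      exact mul_le_mul (mul_le_mul_of_nonneg_right (hc2 Φ hΦ) this) (hA.b Φ hΦ Ψ hΨ) (N_nonneg _)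
        (mul_nonneg (h2.trans (hc2 Φ hΦ)) this)
    have q3 : N ((derivative (Φ - O)).comp (A O) * (A Ψ - A Φ)) ≤ (1/(2-σ) * ρ) * (β * x) :=
      mm ((N_der_comp _ _ (hA.a O hO)).trans ((W1_le hσ0 hσ _).trans
        (mul_le_mul_of_nonneg_left (hρ Φ hΦ) hd0))) (hA.b Φ hΦ Ψ hΨ)
    have q4 : N ((derivative O).comp (A O) * (A Ψ - A Φ - DA' (Ψ - Φ))) ≤ c1 * (γ * ρ * x) :=
      mm ((N_der_comp _ _ (hA.a O hO)).trans (hc1 O hO)) (hA.g Φ hΦ Ψ hΨ)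
    refine (N_add _ _).trans ((add_le_add_left ((N_add _ _).trans
      (add_le_add_left (N_add _ _) _)) _).trans ?_)
    calc _ ≤ _ := add_le_add (add_le_add (add_le_add q1 q2) q3) q4
      _ = _ := by ring
  · have q1 := (N_comp d (A O) (hA.a O hO)).trans (W_le_N hσ0 hσ.le d)
    have q2 := mm ((N_der_comp O (A O) (hA.a O hO)).trans (hc1 O hO)) (hA.d d hd)
    refine (N_add _ _).trans ?_
    linarith

theorem Tri.weak {U : Set ℝ[X]} {O : ℝ[X]} {ρ : ℝ} {F DF : ℝ[X] → ℝ[X]} {a β γ a' : ℝ}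
    (h : Tri U O ρ F DF a β γ) (ha : ∀ Φ ∈ U, N (F Φ) ≤ a') : Tri U O ρ F DF a' β γ :=
  ⟨ha, h.b, h.g, h.d⟩

theorem triR {k : Cst} (hk : k.Ok) {O : ℝ[X]} {ρ : ℝ} {U : Set ℝ[X]} (hU : ∀ Φ ∈ U, Bd k Φ)
    (hO : O ∈ U) (hρ : ∀ Φ ∈ U, N (Φ - O) ≤ ρ) :
    Tri U O ρ Rp (DR O) (1/k.m * k.nH) (1/k.m * k.bH + (1/(3*k.m^2)) * k.nH) k.K := by
  have hUc : ∀ Φ ∈ U, Con Φ := fun Φ h => (hU Φ h).con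
  have hρ0 := (N_nonneg _).trans (hρ O hO)
  have hm := hk.m
  have s0 : ∀ Φ ∈ U, sv Φ ≠ 0 := fun Φ h => abs_pos.1 (hm.trans_le (hU Φ h).m)
  have tA : Tri U O ρ Ap (DA O) k.sA k.bA Cst.gA := by
    refine ⟨fun Φ h => (hU Φ h).sA, fun Φ hΦ Ψ hΨ => lipA (hU Φ hΦ).M (hU Ψ hΨ).M
      ((hUc Ψ hΨ).sub (hUc Φ hΦ)), fun Φ hΦ Ψ hΨ => ?_, fun d hd => ?_⟩
    · have e : Ap Ψ - Ap Φ - DA O (Ψ - Φ) =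
          C ((sv (Ψ - O) + sv (Φ - O)) * sv (Ψ - Φ)) * (1 + X) := by
        unfold DA Ap; simp only [sv_sub, C_mul, C_add, C_sub]
        rw [show C (2:ℝ) = 2 from rfl]; ring
      rw [e, N_C_mul, abs_mul]
      have h1 := sv_le ((hUc Ψ hΨ).sub (hUc Φ hΦ))
      have h2 := sv_le ((hUc Ψ hΨ).sub (hUc O hO))
      have h3 := sv_le ((hUc Φ hΦ).sub (hUc O hO))
      have h4 : |sv (Ψ - O) + sv (Φ - O)| ≤ 2 * ρ / 3 :=
        (abs_add_le _ _).trans (by linarith [hρ Φ hΦ, hρ Ψ hΨ])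
      have := mul_le_mul (mul_le_mul h4 h1 (abs_nonneg _) (by positivity)) N_1X (N_nonneg _)
        (mul_nonneg (by positivity) (by linarith [N_nonneg (Ψ - Φ)]))
      refine this.trans (le_of_eq ?_); unfold Cst.gA; ring
    · unfold DA
      rw [N_C_mul, abs_mul, abs_mul, abs_two]
      have := mul_le_mul (mul_le_mul (mul_le_mul_of_nonneg_left (hU O hO).M two_nonneg')
        (sv_le hd) (abs_nonneg _) (by linarith [hk.M])) N_1X (N_nonneg _)
        (mul_nonneg (by linarith [hk.M]) (by linarith [N_nonneg d]))
      refine this.trans (le_of_eq ?_); unfold Cst.bA; ring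
  have tB : Tri U O ρ Bp (DB O) k.nB k.bB k.gB :=
    Tri.comp hUc hO hρ hk.bA hk.A2 tA (fun Φ h => (hU Φ h).nB) (fun Φ h => (hU Φ h).c1A)
      (fun Φ h => (hU Φ h).c2A)
  have gA0 : 0 ≤ Cst.gA := by unfold Cst.gA; norm_num
  have gB0 : 0 ≤ k.gB := by
    have : 0 ≤ 1/(2-k.sA) := one_div_nonneg.2 (by linarith [hk.A2])
    have := hk.bA; have := hk.c1A; have := hk.c2A
    unfold Cst.gB; positivity
  have gG0 : 0 ≤ k.gG := by
    have := hk.bB; have := hk.B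
    unfold Cst.gG; positivity
  have gH0 : 0 ≤ k.gH := by
    have : 0 ≤ 1/(2-k.sG) := one_div_nonneg.2 (by linarith [hk.G2])
    have := hk.bG; have := hk.c1G; have := hk.c2G
    unfold Cst.gH; positivity
  have tG : Tri U O ρ Gp (DG O) k.sG k.bG k.gG := by
    have t := Tri.mul hUc hO hρ hk.bB hk.bB gB0 gB0 tB tB
    refine ⟨fun Φ h => (hU Φ h).sG, fun Φ hΦ Ψ hΨ => ?_, fun Φ hΦ Ψ hΨ => ?_, fun d hd => ?_⟩
    · have := t.b Φ hΦ Ψ hΨ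
      have e : Gp Ψ - Gp Φ = Bp Ψ * Bp Ψ - Bp Φ * Bp Φ := by unfold Gp; ring
      rw [e]; refine this.trans (le_of_eq ?_); unfold Cst.bG; ring
    · have := t.g Φ hΦ Ψ hΨ
      have e : Gp Ψ - Gp Φ = Bp Ψ * Bp Ψ - Bp Φ * Bp Φ := by unfold Gp; ring
      rw [e]; refine this.trans (le_of_eq ?_); unfold Cst.gG; ring
    · refine (t.d d hd).trans (le_of_eq ?_); unfold Cst.bG; ring
  have tH : Tri U O ρ Hp (DH O) k.nH k.bH k.gH :=
    Tri.comp hUc hO hρ hk.bG hk.G2 tG (fun Φ h => (hU Φ h).nH) (fun Φ h => (hU Φ h).c1G)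
      (fun Φ h => (hU Φ h).c2G)
  have inv_le : ∀ Φ ∈ U, |1 / sv Φ| ≤ 1 / k.m := fun Φ h => by
    rw [abs_div, abs_one]; exact one_div_le_one_div_of_le hm (hU Φ h).m
  have tI : Tri U O ρ (fun Φ => C (1 / sv Φ)) (fun d => C (- sv d / (sv O)^2)) (1/k.m)
      (1/(3*k.m^2)) (2/(9*k.m^3)) := by
    refine ⟨fun Φ h => by rw [N_C]; exact inv_le Φ h, fun Φ hΦ Ψ hΨ => ?_, fun Φ hΦ Ψ hΨ => ?_,
      fun d hd => ?_⟩
    · rw [← C_sub, N_C]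
      have e : 1 / sv Ψ - 1 / sv Φ = -(sv (Ψ - Φ) * ((1 / sv Φ) * (1 / sv Ψ))) := by
        rw [sv_sub]; have := s0 Φ hΦ; have := s0 Ψ hΨ; field_simp; ring
      rw [e, abs_neg, abs_mul, abs_mul]
      have h1 := sv_le ((hUc Ψ hΨ).sub (hUc Φ hΦ))
      have := mul_le_mul h1 (mul_le_mul (inv_le Φ hΦ) (inv_le Ψ hΨ) (abs_nonneg _)
        (by positivity)) (by positivity) (by linarith [N_nonneg (Ψ - Φ)])
      refine this.trans (le_of_eq ?_); field_simp
    · rw [← C_sub, ← C_sub, N_C]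
      have e : 1 / sv Ψ - 1 / sv Φ - -sv (Ψ - Φ) / sv O ^ 2 =
          sv (Ψ - Φ) * (sv (Ψ - O) * ((1/sv O) * (1/sv O) * (1/sv Ψ)) +
            sv (Φ - O) * ((1/sv O) * (1/sv Φ) * (1/sv Ψ))) := by
        simp only [sv_sub]
        have := s0 Φ hΦ; have := s0 Ψ hΨ; have := s0 O hO; field_simp; ring
      rw [e, abs_mul]
      have h1 := sv_le ((hUc Ψ hΨ).sub (hUc Φ hΦ))
      have h2 := sv_le ((hUc Ψ hΨ).sub (hUc O hO))
      have h3 := sv_le ((hUc Φ hΦ).sub (hUc O hO))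
      have c3 : ∀ {x y w : ℝ}, |x| ≤ 1/k.m → |y| ≤ 1/k.m → |w| ≤ 1/k.m →
          |x * y * w| ≤ 1/k.m*(1/k.m)*(1/k.m) := by
        intro x y w hx hy hw
        rw [abs_mul, abs_mul]
        exact mul_le_mul (mul_le_mul hx hy (abs_nonneg _) (by positivity)) hw (abs_nonneg _)
          (by positivity)
      have h4 : |sv (Ψ - O) * ((1/sv O) * (1/sv O) * (1/sv Ψ)) +
            sv (Φ - O) * ((1/sv O) * (1/sv Φ) * (1/sv Ψ))| ≤
            ρ/3 * (1/k.m*(1/k.m)*(1/k.m)) + ρ/3 * (1/k.m*(1/k.m)*(1/k.m)) := by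
        refine (abs_add_le _ _).trans (add_le_add ?_ ?_)
        · rw [abs_mul]
          exact mul_le_mul (by linarith [hρ Ψ hΨ]) (c3 (inv_le O hO) (inv_le O hO) (inv_le Ψ hΨ))
            (abs_nonneg _) (by positivity)
        · rw [abs_mul]
          exact mul_le_mul (by linarith [hρ Φ hΦ]) (c3 (inv_le O hO) (inv_le Φ hΦ) (inv_le Ψ hΨ))
            (abs_nonneg _) (by positivity)
      refine (mul_le_mul h1 h4 (abs_nonneg _) (by linarith [N_nonneg (Ψ - Φ)])).trans
        (le_of_eq ?_)
      field_simp; ring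
    · rw [N_C]
      have e : -sv d / sv O ^ 2 = -(sv d * ((1/sv O)*(1/sv O))) := by
        have := s0 O hO; field_simp
      rw [e, abs_neg, abs_mul, abs_mul]
      have := mul_le_mul (sv_le hd) (mul_le_mul (inv_le O hO) (inv_le O hO) (abs_nonneg _)
        (by positivity)) (by positivity) (by linarith [N_nonneg d])
      refine this.trans (le_of_eq ?_); field_simp
  have bH := hk.bH
  have t := Tri.mul hUc hO hρ (by positivity) bH (by positivity) gH0 tI tH
  refine ⟨t.a, t.b, fun Φ hΦ Ψ hΨ => (t.g Φ hΦ Ψ hΨ).trans (le_of_eq ?_), t.d⟩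
  unfold Cst.K; field_simp; ring

theorem DR_add (O d e : ℝ[X]) : DR O (d + e) = DR O d + DR O e := by
  have : sv (d + e) = sv d + sv e := eval_add
  unfold DR DH DG DB DA; rw [this]
  simp only [add_comp, mul_add, neg_add, add_div, C_add]; ring

theorem DR_C_mul (O d : ℝ[X]) (a : ℝ) : DR O (C a * d) = C a * DR O d := by
  have : sv (C a * d) = a * sv d := by simp [sv]
  unfold DR DH DG DB DA; rw [this]
  simp only [mul_comp, C_comp]
  have e1 : -(a * sv d) / sv O ^ 2 = a * (-sv d / sv O ^ 2) := by ring
  have e2 : 2 * sv O * (a * sv d) = a * (2 * sv O * sv d) := by ring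
  rw [e1, e2, C_mul (a := a), C_mul (a := a)]; ring

end FC

namespace FC
open Polynomial

def lwI : List ℤ := [0, 1048576, -1066394, 1147692, -1238495, 1326013, -1405822, 1476924, -1539759, 1595281, -1644542, 1688530,
  -1728112, 1764026, -1796889, 1827214, -1855427, 1881876, -1906849, 1930579, -1953260, 1975048, -1996071, 2016432]
noncomputable def lw (i : ℕ) : ℝ := ((lwI.getD i 0 : ℤ) : ℝ) / 2 ^ 20
def nL : ℕ := 24
noncomputable def ell (p : ℝ[X]) : ℝ := ∑ i ∈ Finset.range nL, lw i * p.coeff i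

theorem ell_add (p q : ℝ[X]) : ell (p + q) = ell p + ell q := by
  simp only [ell, coeff_add, mul_add, Finset.sum_add_distrib]
theorem ell_C_mul (a : ℝ) (p : ℝ[X]) : ell (C a * p) = a * ell p := by
  simp only [ell, coeff_C_mul, Finset.mul_sum]; exact Finset.sum_congr rfl fun i _ => by ring
theorem ell_sub (p q : ℝ[X]) : ell (p - q) = ell p - ell q := by
  simp only [ell, coeff_sub, mul_sub, Finset.sum_sub_distrib]
theorem ell_zero : ell 0 = 0 := by simp [ell]
theorem ell_sum {ι : Type*} (s : Finset ι) (f : ι → ℝ[X]) :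
    ell (∑ i ∈ s, f i) = ∑ i ∈ s, ell (f i) := by
  classical
  induction s using Finset.induction_on with
  | empty => simp [ell_zero]
  | insert a s ha ih => rw [Finset.sum_insert ha, Finset.sum_insert ha, ell_add, ih]

theorem lwI_bd : ∀ i < nL, 2 * |lwI.getD i 0| ≤ 2 ^ 20 * 2 ^ i := by decide +kernel
theorem lwI_len : lwI.length ≤ nL := by decide

theorem lw_bd (i : ℕ) : |lw i| ≤ 1/2 * 2 ^ i := by
  unfold lw
  rw [abs_div, abs_of_pos (show (0:ℝ) < 2^20 by positivity), div_le_iff₀ (by positivity)]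
  by_cases h : i < nL
  · have : ((2 * |lwI.getD i 0| : ℤ):ℝ) ≤ ((2^20*2^i : ℤ):ℝ) := by exact_mod_cast lwI_bd i h
    push_cast at this; linarith
  · rw [List.getD_eq_default _ _ (lwI_len.trans (not_lt.1 h))]; simp

theorem lw_zero {i : ℕ} (h : nL ≤ i) : lw i = 0 := by
  unfold lw; rw [List.getD_eq_default _ _ (lwI_len.trans h)]; simp

theorem N_eq_range (p : ℝ[X]) {n : ℕ} (h : p.natDegree < n) :
    N p = ∑ i ∈ Finset.range n, |p.coeff i| * 2 ^ i :=
  Ww_eq _ p (supp_subset_range h)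

theorem ell_eq (p : ℝ[X]) {n : ℕ} (h : p.natDegree < n) :
    ell p = ∑ i ∈ Finset.range n, lw i * p.coeff i := by
  unfold ell
  have h1 : ∀ m, nL ≤ m → ∑ i ∈ Finset.range nL, lw i * p.coeff i =
      ∑ i ∈ Finset.range m, lw i * p.coeff i := fun m hm =>
    Finset.sum_subset (Finset.range_subset_range.2 hm) fun i _ hi => by
      rw [lw_zero (by simpa using hi), zero_mul]
  have h2 : ∑ i ∈ Finset.range n, lw i * p.coeff i =
      ∑ i ∈ Finset.range (max n nL), lw i * p.coeff i :=
    Finset.sum_subset (Finset.range_subset_range.2 (le_max_left _ _)) fun i _ hi => by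
      rw [coeff_eq_zero_of_natDegree_lt (h.trans_le (by simpa using hi)), mul_zero]
  rw [h2]; exact h1 _ (le_max_right _ _)

theorem ell_le (p : ℝ[X]) : |ell p| ≤ 1/2 * N p := by
  rw [ell_eq p (Nat.lt_succ_self _), N_eq_range p (Nat.lt_succ_self _), Finset.mul_sum]
  refine (Finset.abs_sum_le_sum_abs _ _).trans (Finset.sum_le_sum fun i _ => ?_)
  rw [abs_mul]
  calc _ ≤ 1/2 * 2^i * |p.coeff i| := mul_le_mul_of_nonneg_right (lw_bd i) (abs_nonneg _)
    _ = _ := by ring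

noncomputable def wj (j : ℕ) : ℝ[X] := X ^ j - C ((-1)^j)

theorem tan_sum {d : ℝ[X]} (h : Tan d) :
    d = ∑ j ∈ Finset.range (d.natDegree + 1), C (d.coeff j) * wj j := by
  unfold wj
  simp only [mul_sub, Finset.sum_sub_distrib]
  have h1 : ∑ j ∈ Finset.range (d.natDegree + 1), C (d.coeff j) * C ((-1)^j) = 0 := by
    have : ∑ j ∈ Finset.range (d.natDegree + 1), d.coeff j * (-1)^j = 0 := by
      rw [← eval_eq_sum_range]; exact h
    rw [← C_0, ← this, map_sum]; simp
  rw [h1, sub_zero]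
  exact as_sum_range_C_mul_X_pow d

theorem DR_sum (O : ℝ[X]) {ι : Type*} (s : Finset ι) (f : ι → ℝ[X]) :
    DR O (∑ i ∈ s, f i) = ∑ i ∈ s, DR O (f i) := by
  classical
  induction s using Finset.induction_on with
  | empty => simpa using DR_C_mul O 0 0
  | insert a s ha ih => rw [Finset.sum_insert ha, Finset.sum_insert ha, DR_add, ih]

structure Col (F v1 : ℝ[X]) (lam κ leak : ℝ) : Prop where
  l1 : ell v1 = 1
  k0 : 0 ≤ κ
  e0 : 0 ≤ leak
  nn : ∀ j, 1 ≤ j → N (DR F (wj j) - C (lam * lw j) * v1) ≤ κ * 2 ^ j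
  ll : ∀ j, 1 ≤ j → |ell (DR F (wj j)) - lam * lw j| ≤ leak * 2 ^ j

theorem wj_zero : wj 0 = 0 := by unfold wj; simp

theorem lw0 : lw 0 = 0 := by unfold lw lwI; simp

theorem Col.hyp {F v1 : ℝ[X]} {lam κ leak : ℝ} (h : Col F v1 lam κ leak) {d : ℝ[X]} (hd : Tan d) :
    N (DR F d - C (lam * ell d) * v1) ≤ κ * N d ∧ |ell (DR F d) - lam * ell d| ≤ leak * N d := by
  have z0 : DR F (wj 0) = 0 := by rw [wj_zero]; simpa using DR_C_mul F 0 0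
  have hN : ∀ j, N (DR F (wj j) - C (lam * lw j) * v1) ≤ κ * 2 ^ j := fun j => by
    rcases Nat.eq_zero_or_pos j with rfl | hj
    · rw [z0, lw0]; simp [N_zero, h.k0]
    · exact h.nn j hj
  have hL : ∀ j, |ell (DR F (wj j)) - lam * lw j| ≤ leak * 2 ^ j := fun j => by
    rcases Nat.eq_zero_or_pos j with rfl | hj
    · rw [z0, lw0]; simp [ell_zero, h.e0]
    · exact h.ll j hj
  have e1 : DR F d = ∑ j ∈ Finset.range (d.natDegree + 1), C (d.coeff j) * DR F (wj j) := by
    conv_lhs => rw [tan_sum hd, DR_sum]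
    exact Finset.sum_congr rfl fun j _ => DR_C_mul _ _ _
  have e2 := ell_eq d (Nat.lt_succ_self _)
  have e3 := N_eq_range d (Nat.lt_succ_self _)
  constructor
  · have e : DR F d - C (lam * ell d) * v1 = ∑ j ∈ Finset.range (d.natDegree + 1),
        C (d.coeff j) * (DR F (wj j) - C (lam * lw j) * v1) := by
      simp only [mul_sub, Finset.sum_sub_distrib]
      rw [← e1]
      congr 1
      rw [e2, Finset.mul_sum, map_sum, Finset.sum_mul]
      refine Finset.sum_congr rfl fun j _ => ?_
      simp only [C_mul]; ring
    rw [e, e3, Finset.mul_sum]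
    refine (Ww_sum_le pw2 _ _).trans (Finset.sum_le_sum fun j _ => ?_)
    refine (le_of_eq (N_C_mul _ _)).trans ?_
    nlinarith [hN j, abs_nonneg (d.coeff j)]
  · have e : ell (DR F d) - lam * ell d = ∑ j ∈ Finset.range (d.natDegree + 1),
        d.coeff j * (ell (DR F (wj j)) - lam * lw j) := by
      rw [e1, ell_sum, e2, Finset.mul_sum, ← Finset.sum_sub_distrib]
      refine Finset.sum_congr rfl fun j _ => ?_
      rw [ell_C_mul]; ring
    rw [e, e3, Finset.mul_sum]
    refine (Finset.abs_sum_le_sum_abs _ _).trans (Finset.sum_le_sum fun j _ => ?_)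
    rw [abs_mul]
    nlinarith [hL j, abs_nonneg (d.coeff j)]

structure Stg (F v F1 v1 : ℝ[X]) (r lam a b c κ ε : ℝ) : Prop where
  con : Con F
  tv : Tan v
  lv : ell v = 1
  reg : ∀ Φ, Con Φ → N (Φ - F) ≤ r → -1 < sv Φ ∧ sv Φ < 0 ∧ 0 < Φ.eval (sv Φ ^ 2 - 1)
  px : ∀ Φ Ψ, Con Φ → N (Φ - F) ≤ r → Con Ψ → N (Ψ - F) ≤ r →
    |ell (Rp Ψ - Rp Φ) - lam * ell (Ψ - Φ)| ≤ a * |ell (Ψ - Φ)| +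
      b * N (Ψ - Φ - C (ell (Ψ - Φ)) * v)
  py : ∀ Φ Ψ, Con Φ → N (Φ - F) ≤ r → Con Ψ → N (Ψ - F) ≤ r →
    N (Rp Ψ - Rp Φ - C (ell (Rp Ψ - Rp Φ)) * v1) ≤ c * |ell (Ψ - Φ)| +
      κ * N (Ψ - Φ - C (ell (Ψ - Φ)) * v)
  res : N (Rp F - F1) ≤ ε
  sec : ∃ K, 0 ≤ K ∧ ∀ O, Con O → N (O - F) ≤ r → ∀ Φ Ψ, Con Φ → N (Φ - F) ≤ r → Con Ψ →
    N (Ψ - F) ≤ r → ∀ ρ, N (Φ - O) ≤ ρ → N (Ψ - O) ≤ ρ →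
    N (Rp Ψ - Rp Φ - DR O (Ψ - Φ)) ≤ K * ρ * N (Ψ - Φ)

theorem Bp_eval0 (Φ : ℝ[X]) : (Bp Φ).eval 0 = Φ.eval (sv Φ ^ 2 - 1) := by
  unfold Bp Ap; simp only [eval_comp, eval_mul, eval_sub, eval_add, eval_C, eval_one, eval_X]
  congr 1; ring

theorem Stg.mk' {k : Cst} (hk : k.Ok) {F v F1 v1 : ℝ[X]} {r lam κh leak e' Nv Nv1 a b c κ ε Kc : ℝ}
    (hr : 0 ≤ r) (h0 : Bd0 k r F) (hM : k.M < 1) (hs : sv F < 0)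
    (hB : k.bB * r < (Bp F).eval 0) (tv : Tan v) (lv : ell v = 1)
    (hcol : Col F v1 lam κh leak) (hDv : N (DR F v - C lam * v1) ≤ e') (hNv : N v ≤ Nv)
    (hNv1 : N v1 ≤ Nv1) (res : N (Rp F - F1) ≤ ε) (hK : k.K ≤ Kc)
    (ha : 1/2 * (e' + Kc * r * Nv) ≤ a) (hb : leak + 1/2 * (Kc * r) ≤ b)
    (hc : (1 + 1/2 * Nv1) * (e' + Kc * r * Nv) ≤ c)
    (hκ : κh + leak * Nv1 + (1 + 1/2 * Nv1) * (Kc * r) ≤ κ) :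
    Stg F v F1 v1 r lam a b c κ ε := by
  have ball : ∀ Φ, Con Φ → N (Φ - F) ≤ r → Bd k Φ := fun Φ h1 h2 => h0.ball hk h1 h2
  have FF : N (F - F) ≤ r := by rw [sub_self, N_zero]; exact hr
  have tr := triR hk (O := F) (ρ := r) (U := {Φ | Con Φ ∧ N (Φ - F) ≤ r})
    (fun Φ h => ball Φ h.1 h.2) ⟨h0.con, FF⟩ (fun Φ h => h.2)
  have K0 : 0 ≤ k.K := by
    have := hk.m; have := hk.bH; have := hk.H
    have gB0 : 0 ≤ k.gB := by
      have : 0 ≤ 1/(2-k.sA) := one_div_nonneg.2 (by linarith [hk.A2])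
      have := hk.bA; have := hk.c1A; have := hk.c2A
      unfold Cst.gB Cst.gA; positivity
    have gG0 : 0 ≤ k.gG := by
      have := hk.bB; have := hk.B
      unfold Cst.gG; positivity
    have gH0 : 0 ≤ k.gH := by
      have : 0 ≤ 1/(2-k.sG) := one_div_nonneg.2 (by linarith [hk.G2])
      have := hk.bG; have := hk.c1G; have := hk.c2G
      unfold Cst.gH; positivity
    unfold Cst.K; positivity
  have pre : ∀ Φ Ψ, Con Φ → N (Φ - F) ≤ r → Con Ψ → N (Ψ - F) ≤ r →
      ∃ q e : ℝ[X], Rp Ψ - Rp Φ = C (lam * ell (Ψ - Φ)) * v1 +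
        (C (ell (Ψ - Φ)) * (DR F v - C lam * v1)) + q + e ∧
        N e ≤ Kc * r * (|ell (Ψ - Φ)| * Nv + N (Ψ - Φ - C (ell (Ψ - Φ)) * v)) ∧
        N q ≤ κh * N (Ψ - Φ - C (ell (Ψ - Φ)) * v) ∧
        |ell q| ≤ leak * N (Ψ - Φ - C (ell (Ψ - Φ)) * v) := by
    intro Φ Ψ h1 h2 h3 h4
    set d := Ψ - Φ with hd
    set x := ell d with hx
    have td : Tan d := h3.sub h1
    have tq : Tan (d - C x * v) := by
      unfold Tan at *; rw [eval_sub, eval_mul, td, tv]; simp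
    have lq : ell (d - C x * v) = 0 := by rw [ell_sub, ell_C_mul, lv, ← hx]; ring
    refine ⟨DR F (d - C x * v), Rp Ψ - Rp Φ - DR F d, ?_, ?_, ?_, ?_⟩
    · have : DR F d = C x * DR F v + DR F (d - C x * v) := by
        rw [← DR_C_mul, ← DR_add]; congr 1; ring
      rw [this, C_mul]; ring
    · have g := tr.g Φ ⟨h1, h2⟩ Ψ ⟨h3, h4⟩
      have nd : N d ≤ |x| * Nv + N (d - C x * v) := by
        have := N_add (C x * v) (d - C x * v)
        rw [add_sub_cancel, N_C_mul] at this
        have := mul_le_mul_of_nonneg_left hNv (abs_nonneg x)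
        linarith
      refine g.trans ?_
      exact mul_le_mul (mul_le_mul_of_nonneg_right hK hr) nd (N_nonneg _)
        (mul_nonneg (K0.trans hK) hr)
    · have := (hcol.hyp tq).1
      rw [lq] at this; simpa using this
    · have := (hcol.hyp tq).2
      rw [lq] at this; simpa using this
  have hNv0 := (N_nonneg _).trans hNv
  have hNv10 := (N_nonneg _).trans hNv1
  have he0 := (N_nonneg _).trans hDv
  refine ⟨h0.con, tv, lv, fun Φ h1 h2 => ?_, fun Φ Ψ h1 h2 h3 h4 => ?_, fun Φ Ψ h1 h2 h3 h4 => ?_,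
    res, k.K, K0, fun O o1 o2 Φ Ψ h1 h2 h3 h4 ρ h5 h6 => ?_⟩
  · have b := ball Φ h1 h2
    have hsv := sv_le (h1.sub h0.con)
    rw [sv_sub] at hsv
    refine ⟨?_, ?_, ?_⟩
    · linarith [neg_abs_le (sv Φ), b.M]
    · have := abs_le.1 hsv
      have := h0.m; rw [abs_of_neg hs] at this
      have := hk.m
      linarith
    · rw [← Bp_eval0]
      have l := tr
      have bF := ball F h0.con FF
      have a1 : N (Ap Φ - Ap F) ≤ k.bA * N (Φ - F) := lipA bF.M b.M (h1.sub h0.con)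
      have b1 : N (Bp Φ - Bp F) ≤ k.bB * N (Φ - F) := lipC bF.sA b.sA hk.A2.le bF.c1A a1
      have t := abs_eval_N (x := 0) (by norm_num) (Bp Φ - Bp F)
      rw [eval_sub] at t
      have := abs_le.1 t
      have := mul_le_mul_of_nonneg_left h2 hk.bB
      linarith
  · obtain ⟨q, e, h, he, hq, hlq⟩ := pre Φ Ψ h1 h2 h3 h4
    set x := ell (Ψ - Φ)
    set y := N (Ψ - Φ - C x * v) with hy
    have hy0 : 0 ≤ y := N_nonneg _
    rw [h, ell_add, ell_add, ell_add, ell_C_mul, ell_C_mul, hcol.l1]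
    have t1 : |ell (DR F v - C lam * v1)| ≤ 1/2 * e' := (ell_le _).trans (by linarith)
    have t2 : |ell e| ≤ 1/2 * (Kc * r * (|x| * Nv + y)) := (ell_le _).trans (by linarith)
    have e1 : lam * x * 1 + x * ell (DR F v - C lam * v1) + ell q + ell e - lam * x =
      x * ell (DR F v - C lam * v1) + ell q + ell e := by ring
    rw [e1]
    have t3 : |x * ell (DR F v - C lam * v1)| ≤ |x| * (1/2 * e') := by
      rw [abs_mul]; exact mul_le_mul_of_nonneg_left t1 (abs_nonneg _)
    have t4 := (abs_add_le (x * ell (DR F v - C lam * v1) + ell q) (ell e)).trans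
      (add_le_add_left (abs_add_le _ _) _)
    have t5 := mul_le_mul_of_nonneg_right ha (abs_nonneg x)
    have t6 := mul_le_mul_of_nonneg_right hb hy0
    nlinarith
  · obtain ⟨q, e, h, he, hq, hlq⟩ := pre Φ Ψ h1 h2 h3 h4
    set x := ell (Ψ - Φ)
    set y := N (Ψ - Φ - C x * v) with hy
    have hy0 : 0 ≤ y := N_nonneg _
    set p := C x * (DR F v - C lam * v1) with hp
    have proj : ∀ w, N (w - C (ell w) * v1) ≤ (1 + 1/2 * Nv1) * N w := fun w => by
      refine (N_sub _ _).trans ?_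
      rw [N_C_mul]
      have := mul_le_mul (ell_le w) hNv1 (N_nonneg _) (by linarith [N_nonneg w])
      linarith
    have e1 : Rp Ψ - Rp Φ - C (ell (Rp Ψ - Rp Φ)) * v1 = (p - C (ell p) * v1) +
      (q - C (ell q) * v1) + (e - C (ell e) * v1) := by
      have l : ell (Rp Ψ - Rp Φ) = lam * x + ell p + ell q + ell e := by
        rw [h, ell_add, ell_add, ell_add, ell_C_mul, hcol.l1, mul_one]
      rw [l, h, C_add, C_add, C_add]
      ring
    rw [e1]
    have t1 : N (p - C (ell p) * v1) ≤ (1 + 1/2*Nv1) * (|x| * e') := by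
      refine (proj p).trans (mul_le_mul_of_nonneg_left ?_ (by linarith))
      rw [hp, N_C_mul]; exact mul_le_mul_of_nonneg_left hDv (abs_nonneg _)
    have t2 : N (e - C (ell e) * v1) ≤ (1 + 1/2*Nv1) * (Kc * r * (|x| * Nv + y)) :=
      (proj e).trans (mul_le_mul_of_nonneg_left he (by linarith))
    have t3 : N (q - C (ell q) * v1) ≤ κh * y + leak * y * Nv1 := by
      refine (N_sub _ _).trans (add_le_add hq ?_)
      rw [N_C_mul]
      exact mul_le_mul hlq hNv1 (N_nonneg _) ((abs_nonneg _).trans hlq)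
    have t4 := (N_add ((p - C (ell p) * v1) + (q - C (ell q) * v1)) (e - C (ell e) * v1)).trans
      (add_le_add_left (N_add _ _) _)
    have t5 := mul_le_mul_of_nonneg_right hc (abs_nonneg x)
    have t6 := mul_le_mul_of_nonneg_right hκ hy0
    nlinarith
  · have bo : N (O - O) ≤ ρ := by rw [sub_self, N_zero]; exact (N_nonneg _).trans h5
    have t := triR hk (O := O) (ρ := ρ) (U := {Φ | Con Φ ∧ N (Φ - F) ≤ r ∧ N (Φ - O) ≤ ρ})
      (fun Φ h => ball Φ h.1 h.2.1) ⟨o1, o2, bo⟩ (fun Φ h => h.2.2)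
    exact t.g Φ ⟨h1, h2, h5⟩ Ψ ⟨h3, h4, h6⟩

end FC

namespace FC
open Polynomial

noncomputable def xc (W Φ : ℝ[X]) : ℝ := ell (Φ - W)
noncomputable def yc (W v Φ : ℝ[X]) : ℝ := N (Φ - W - C (xc W Φ) * v)

def Reg (Φ : ℝ[X]) : Prop := -1 < sv Φ ∧ sv Φ < 0 ∧ 0 < Φ.eval (sv Φ ^ 2 - 1)

structure EndP (q : ℕ) (W v : ℝ[X]) (X0 X L Y : ℝ) : Prop where
  reg : ∀ Φ, Con Φ → |xc W Φ| ≤ X → yc W v Φ ≤ Y →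
    (∀ j < q, Reg (Rp^[j] Φ)) ∧ -1 < sv (Rp^[q] Φ)
  pos : ∀ Φ, Con Φ → |xc W Φ| ≤ X0 → yc W v Φ ≤ Y → 0 ≤ sv (Rp^[q] Φ)
  neg : ∀ Φ, Con Φ → |xc W Φ| ≤ X → xc W Φ ≤ -L → yc W v Φ ≤ Y → sv (Rp^[q] Φ) < 0
  pair : ∀ Φ Ψ, Con Φ → |xc W Φ| ≤ X → yc W v Φ ≤ Y → Con Ψ → |xc W Ψ| ≤ X → yc W v Ψ ≤ Y →
    ell (Ψ - Φ) ≠ 0 → N (Ψ - Φ - C (ell (Ψ - Φ)) * v) ≤ 1/10 * |ell (Ψ - Φ)| →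
    sv (Rp^[q] Ψ) ≠ sv (Rp^[q] Φ)

structure EndM (q : ℕ) (W v : ℝ[X]) (X Y : ℝ) : Prop where
  reg : ∀ Φ, Con Φ → |xc W Φ| ≤ X → yc W v Φ ≤ Y →
    (∀ j < q, Reg (Rp^[j] Φ)) ∧ FB.Hor 1 (toF (Rp^[q] Φ))

theorem sub_split (W v Φ : ℝ[X]) : Φ - W = C (xc W Φ) * v + (Φ - W - C (xc W Φ) * v) := by ring

theorem N_dev {W v Φ : ℝ[X]} {X Y n : ℝ} (hv : N v ≤ n) (hx : |xc W Φ| ≤ X)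
    (hy : yc W v Φ ≤ Y) : N (Φ - W) ≤ X * n + Y := by
  have h := N_add (C (xc W Φ) * v) (Φ - W - C (xc W Φ) * v)
  rw [← sub_split, N_C_mul] at h
  have := mul_le_mul hx hv (N_nonneg v) ((abs_nonneg _).trans hx)
  unfold yc at hy
  linarith

theorem proj_le {v : ℝ[X]} {n : ℝ} (hv : N v ≤ n) (w : ℝ[X]) :
    N (w - C (ell w) * v) ≤ (1 + 1/2 * n) * N w := by
  refine (N_sub _ _).trans ?_
  rw [N_C_mul]
  have := mul_le_mul (ell_le w) hv (N_nonneg _) (by linarith [N_nonneg w])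
  linarith

theorem Stg.step {F v F1 v1 : ℝ[X]} {r lam a b c κ ε n : ℝ} (h : Stg F v F1 v1 r lam a b c κ ε)
    (hv1 : N v1 ≤ n) (hr : 0 ≤ r) {Φ : ℝ[X]} (hc : Con Φ) (hΦ : N (Φ - F) ≤ r) :
    Con (Rp Φ) ∧ |xc F1 (Rp Φ) - lam * xc F Φ| ≤ a * |xc F Φ| + b * yc F v Φ + 1/2 * ε ∧
    yc F1 v1 (Rp Φ) ≤ c * |xc F Φ| + κ * yc F v Φ + (1 + 1/2 * n) * ε := by
  have hn := (N_nonneg _).trans hv1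
  have FF : N (F - F) ≤ r := by rw [sub_self, N_zero]; exact hr
  refine ⟨Rp_con hc (h.reg Φ hc hΦ).2.1.ne, ?_, ?_⟩
  · have p := h.px F Φ h.con FF hc hΦ
    have e : xc F1 (Rp Φ) = ell (Rp Φ - Rp F) + ell (Rp F - F1) := by
      rw [← ell_add, xc]; congr 1; ring
    have l : |ell (Rp F - F1)| ≤ 1/2 * ε := (ell_le _).trans (by linarith [h.res])
    rw [e]
    rw [show ell (Rp Φ - Rp F) + ell (Rp F - F1) - lam * xc F Φ =
      (ell (Rp Φ - Rp F) - lam * xc F Φ) + ell (Rp F - F1) by ring]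
    refine (abs_add_le _ _).trans ?_
    unfold yc xc at *; linarith
  · have p := h.py F Φ h.con FF hc hΦ
    have e : Rp Φ - F1 - C (xc F1 (Rp Φ)) * v1 =
      (Rp Φ - Rp F - C (ell (Rp Φ - Rp F)) * v1) + ((Rp F - F1) - C (ell (Rp F - F1)) * v1) := by
      have : xc F1 (Rp Φ) = ell (Rp Φ - Rp F) + ell (Rp F - F1) := by
        rw [← ell_add, xc]; congr 1; ring
      rw [this, C_add]; ring
    have l := proj_le hv1 (Rp F - F1)
    have l2 := mul_le_mul_of_nonneg_left h.res (show (0:ℝ) ≤ 1 + 1/2 * n by linarith)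
    have t := N_add (Rp Φ - Rp F - C (ell (Rp Φ - Rp F)) * v1)
      ((Rp F - F1) - C (ell (Rp F - F1)) * v1)
    rw [← e] at t
    unfold yc; unfold xc at *; linarith

theorem EndP.step {F v F1 v1 : ℝ[X]} {r lam a b c κ ε n n1 : ℝ}
    (h : Stg F v F1 v1 r lam a b c κ ε) (hv : N v ≤ n) (hv1 : N v1 ≤ n1) (hr : 0 ≤ r)
    (hε : 0 ≤ ε) (ha : 0 ≤ a) (hb : 0 ≤ b) (hc : 0 ≤ c) (hκ : 0 ≤ κ) (hlam : 0 ≤ lam - a)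
    {q : ℕ} {X0 X L Y X0' X' L' Y' : ℝ} (hX0 : X0 ≤ X) (hL : 0 ≤ L) (hrr : X * n + Y ≤ r)
    (e1 : (lam + a) * X0 + b * Y + 1/2 * ε ≤ X0') (e2 : (lam + a) * X + b * Y + 1/2 * ε ≤ X')
    (e3 : L' ≤ (lam - a) * L - b * Y - 1/2 * ε)
    (e4 : c * X + κ * Y + (1 + 1/2 * n1) * ε ≤ Y')
    (hη : c + 1/10 * κ ≤ 1/10 * (lam - a - 1/10 * b)) (hp : 0 < lam - a - 1/10 * b)
    (hE : EndP q F1 v1 X0' X' L' Y') : EndP (q+1) F v X0 X L Y := by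
  have key : ∀ Φ, Con Φ → |xc F Φ| ≤ X → yc F v Φ ≤ Y → N (Φ - F) ≤ r ∧ Con (Rp Φ) ∧
      |xc F1 (Rp Φ)| ≤ (lam + a) * |xc F Φ| + b * Y + 1/2 * ε ∧ yc F1 v1 (Rp Φ) ≤ Y' ∧
      (xc F Φ ≤ 0 → xc F1 (Rp Φ) ≤ (lam - a) * xc F Φ + b * Y + 1/2*ε) := by
    intro Φ h1 h2 h3
    have hN := (N_dev hv h2 h3).trans hrr
    obtain ⟨s1, s2, s3⟩ := h.step hv1 hr h1 hN
    have q1 := mul_le_mul_of_nonneg_left h2 hc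
    have q2 := mul_le_mul_of_nonneg_left h3 hκ
    have q3 := mul_le_mul_of_nonneg_left h3 hb
    refine ⟨hN, s1, ?_, by linarith, fun hx => ?_⟩
    · have t := abs_add_le (xc F1 (Rp Φ) - lam * xc F Φ) (lam * xc F Φ)
      rw [sub_add_cancel, abs_mul, abs_of_nonneg (show 0 ≤ lam by linarith)] at t
      linarith
    · rw [abs_of_nonpos hx] at s2
      linarith [(abs_le.1 s2).2]
  have mono : ∀ {s t : ℝ}, s ≤ t → (lam + a) * s ≤ (lam + a) * t := fun hh =>
    mul_le_mul_of_nonneg_left hh (by linarith)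
  refine ⟨fun Φ h1 h2 h3 => ?_, fun Φ h1 h2 h3 => ?_, fun Φ h1 h2 h2' h3 => ?_,
    fun Φ Ψ h1 h2 h3 h4 h5 h6 h7 h8 => ?_⟩
  · obtain ⟨k1, k2, k3, k4, k5⟩ := key Φ h1 h2 h3
    have r := hE.reg (Rp Φ) k2 (by linarith [mono h2]) k4
    refine ⟨fun j hj => ?_, r.2⟩
    cases j with
    | zero => exact h.reg Φ h1 k1
    | succ j => exact r.1 j (by omega)
  · obtain ⟨k1, k2, k3, k4, k5⟩ := key Φ h1 (h2.trans hX0) h3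
    exact hE.pos (Rp Φ) k2 (by linarith [mono h2]) k4
  · obtain ⟨k1, k2, k3, k4, k5⟩ := key Φ h1 h2 h3
    refine hE.neg (Rp Φ) k2 (by linarith [mono h2]) ?_ k4
    have := k5 (by linarith)
    have := mul_le_mul_of_nonneg_left h2' hlam
    linarith
  · obtain ⟨k1, k2, k3, k4, k5⟩ := key Φ h1 h2 h3
    obtain ⟨l1, l2, l3, l4, l5⟩ := key Ψ h4 h5 h6
    have p := h.px Φ Ψ h1 k1 h4 l1
    have p' := h.py Φ Ψ h1 k1 h4 l1
    have hx0 := abs_pos.2 h7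
    set x := ell (Ψ - Φ)
    set y := N (Ψ - Φ - C x * v)
    have q1 := mul_le_mul_of_nonneg_left h8 hb
    have q2 := mul_le_mul_of_nonneg_left h8 hκ
    have t : (lam - a - 1/10*b) * |x| ≤ |ell (Rp Ψ - Rp Φ)| := by
      have := abs_sub_abs_le_abs_sub (lam * x) (ell (Rp Ψ - Rp Φ))
      rw [abs_sub_comm, abs_mul, abs_of_nonneg (show 0 ≤ lam by linarith)] at this
      linarith
    refine hE.pair (Rp Φ) (Rp Ψ) k2 (by linarith [mono h2]) k4 l2 (by linarith [mono h5]) l4 ?_ ?_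
    · exact abs_pos.1 ((mul_pos hp hx0).trans_le t)
    · have := mul_le_mul_of_nonneg_right hη hx0.le
      linarith

theorem EndM.step {F v F1 v1 : ℝ[X]} {r lam a b c κ ε n n1 : ℝ}
    (h : Stg F v F1 v1 r lam a b c κ ε) (hv : N v ≤ n) (hv1 : N v1 ≤ n1) (hr : 0 ≤ r)
    (hb : 0 ≤ b) (hc : 0 ≤ c) (hκ : 0 ≤ κ) (hlam : 0 ≤ lam + a) (hl : 0 ≤ lam)
    {q : ℕ} {X Y X' Y' : ℝ} (hrr : X * n + Y ≤ r)
    (e2 : (lam + a) * X + b * Y + 1/2 * ε ≤ X')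
    (e4 : c * X + κ * Y + (1 + 1/2 * n1) * ε ≤ Y')
    (hE : EndM q F1 v1 X' Y') : EndM (q+1) F v X Y := by
  refine ⟨fun Φ h1 h2 h3 => ?_⟩
  have hN := (N_dev hv h2 h3).trans hrr
  obtain ⟨s1, s2, s3⟩ := h.step hv1 hr h1 hN
  have q1 := mul_le_mul_of_nonneg_left h2 hc
  have q2 := mul_le_mul_of_nonneg_left h3 hκ
  have q3 := mul_le_mul_of_nonneg_left h3 hb
  have q4 := mul_le_mul_of_nonneg_left h2 hlam
  have t := abs_add_le (xc F1 (Rp Φ) - lam * xc F Φ) (lam * xc F Φ)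
  rw [sub_add_cancel, abs_mul, abs_of_nonneg hl] at t
  have r := hE.reg (Rp Φ) s1 (by linarith) (by linarith)
  refine ⟨fun j hj => ?_, r.2⟩
  cases j with
  | zero => exact h.reg Φ h1 hN
  | succ j => exact r.1 j (by omega)

theorem sv_dev {W v Φ : ℝ[X]} (hW : Con W) (hΦ : Con Φ) (hv : Tan v) :
    |sv Φ - sv W - xc W Φ * sv v| ≤ yc W v Φ / 3 := by
  have ht : Tan (Φ - W - C (xc W Φ) * v) := by
    have := hΦ.sub hW
    unfold Tan at *; rw [eval_sub, eval_mul, this, hv]; simp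
  have := sv_le ht
  unfold yc
  have e : sv (Φ - W - C (xc W Φ) * v) = sv Φ - sv W - xc W Φ * sv v := by
    simp [sv]
  rwa [e] at this

theorem EndP.base {W v : ℝ[X]} (hW : Con W) (hv : Tan v) (hs : 1/2 ≤ sv v) {X0 X L Y : ℝ}
    (h1 : -1 < sv W - X * sv v - Y/3) (h2 : X0 * sv v + Y/3 ≤ sv W)
    (h3 : sv W + Y/3 < L * sv v) : EndP 0 W v X0 X L Y := by
  refine ⟨fun Φ c1 c2 c3 => ⟨fun j hj => absurd hj (by omega), ?_⟩, fun Φ c1 c2 c3 => ?_,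
    fun Φ c1 c2 c2' c3 => ?_, fun Φ Ψ c1 c2 c3 c4 c5 c6 c7 c8 => ?_⟩
  · have := abs_le.1 (sv_dev hW c1 hv)
    have := mul_le_mul_of_nonneg_right (abs_le.1 c2).1 (show 0 ≤ sv v by linarith)
    show -1 < sv Φ
    linarith
  · have := abs_le.1 (sv_dev hW c1 hv)
    have := mul_le_mul_of_nonneg_right (abs_le.1 c2).1 (show 0 ≤ sv v by linarith)
    show 0 ≤ sv Φ
    linarith
  · have := abs_le.1 (sv_dev hW c1 hv)
    have := mul_le_mul_of_nonneg_right c2' (show 0 ≤ sv v by linarith)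
    show sv Φ < 0
    linarith
  · show sv Ψ ≠ sv Φ
    intro e
    have := sv_dev c1 c4 hv
    unfold xc yc xc at this
    rw [e, sub_self, zero_sub, abs_neg, abs_mul, abs_of_pos (show 0 < sv v by linarith)] at this
    have p := abs_pos.2 c7
    have := mul_le_mul_of_nonneg_left hs p.le
    linarith

theorem sqm {x : ℝ} (h0 : 0 ≤ x) (h1 : x ≤ 1) : |x^2 - 1| ≤ 1 := by
  have := mul_nonneg h0 h0
  have := mul_le_mul h1 h1 h0 zero_le_one
  exact abs_le.2 ⟨by nlinarith, by nlinarith⟩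

theorem lipEval (W : ℝ[X]) {x y : ℝ} (hx : |x| ≤ 1) (hy : |y| ≤ 1) :
    |W.eval x - W.eval y| ≤ W1 1 W * |x - y| := by
  rw [eval_eq_sum, eval_eq_sum, sum_def, sum_def, ← Finset.sum_sub_distrib]
  refine (Finset.abs_sum_le_sum_abs _ _).trans ?_
  unfold W1 Ww; rw [Finset.sum_mul]
  refine Finset.sum_le_sum fun i _ => ?_
  rw [← mul_sub, abs_mul, mul_assoc]
  refine mul_le_mul_of_nonneg_left ?_ (abs_nonneg _)
  show _ ≤ (i:ℝ) * 1^(i-1) * |x - y|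
  rw [one_pow, mul_one, ← (Commute.all x y).geom_sum₂_mul, abs_mul]
  refine mul_le_mul_of_nonneg_right ?_ (abs_nonneg _)
  refine (Finset.abs_sum_le_sum_abs _ _).trans ?_
  refine (Finset.sum_le_card_nsmul _ _ 1 fun j _ => ?_).trans (by simp)
  rw [abs_mul, abs_pow, abs_pow]
  exact mul_le_one₀ (pow_le_one₀ (abs_nonneg _) hx) (by positivity)
    (pow_le_one₀ (abs_nonneg _) hy)

theorem EndM.base {k : Cst} (hk : k.Ok) {W v : ℝ[X]} {r c1 n X Y : ℝ} (hWc : Con W)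
    (hv : N v ≤ n) (hr : 0 ≤ r) (hrr : X * n + Y ≤ r)
    (hM : |sv W| + r/3 ≤ k.M) (hM1 : k.M < 1) (hs : sv W + r/3 < 0)
    (hA : N (Ap W) + k.bA * r ≤ k.sA) (h1 : W1 k.sA W ≤ k.c1A)
    (hB : k.bB * r < (Bp W).eval 0) (hB1 : (Bp W).eval 0 + k.bB * r ≤ 1)
    (hc1 : W1 1 W ≤ c1)
    (hH : r + c1 * (2 * (k.bB * r)) + (r/3 - sv W) ≤ (Hp W).eval 0) :
    EndM 0 W v X Y := by
  refine ⟨fun Φ c h2 h3 => ⟨fun j hj => absurd hj (by omega), ?_⟩⟩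
  have hN := (N_dev hv h2 h3).trans hrr
  have ht := c.sub hWc
  have hsv := sv_le ht
  rw [sv_sub] at hsv
  have hsv' := abs_le.1 hsv
  have hsΦ : |sv Φ| ≤ k.M := by
    have := abs_sub_abs_le_abs_sub (sv Φ) (sv W); linarith
  have hsW : |sv W| ≤ k.M := by linarith
  have a1 : N (Ap Φ - Ap W) ≤ k.bA * N (Φ - W) := lipA hsW hsΦ ht
  have m1 := mul_le_mul_of_nonneg_left hN hk.bA
  have m2 := mul_le_mul_of_nonneg_left hN hk.bB
  have a2 : N (Ap Φ) ≤ k.sA := by linarith [N_near (Ap W) (Ap Φ)]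
  have a3 : N (Ap W) ≤ k.sA := by linarith [mul_nonneg hk.bA hr]
  have b1 : N (Bp Φ - Bp W) ≤ k.bB * N (Φ - W) := lipC a3 a2 hk.A2.le h1 a1
  have t := abs_eval_N (x := 0) (by norm_num) (Bp Φ - Bp W)
  rw [eval_sub] at t
  have t' := abs_le.1 t
  set β := (Bp Φ).eval 0 with hβ
  set βW := (Bp W).eval 0 with hβW
  have bb0 : 0 ≤ k.bB * r := mul_nonneg hk.bB hr
  have β0 : 0 < β := by linarith
  have β1 : β ≤ 1 := by linarith
  have βW1 : βW ≤ 1 := by linarith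
  have βW0 : 0 < βW := by linarith
  have hHW : (Hp W).eval 0 = W.eval (βW^2 - 1) := by
    unfold Hp Gp; simp only [eval_comp, eval_mul, eval_sub, eval_one]; rw [← hβW]; congr 1; ring
  have u1 : |Φ.eval (β^2-1) - W.eval (β^2-1)| ≤ r := by
    rw [← eval_sub]
    refine (abs_eval_N ((sqm β0.le β1).trans (by norm_num)) _).trans hN
  have u2 : |W.eval (β^2-1) - W.eval (βW^2-1)| ≤ c1 * (2 * (k.bB * r)) := by
    have w := lipEval W (sqm β0.le β1) (sqm βW0.le βW1)
    refine w.trans (mul_le_mul hc1 ?_ (abs_nonneg _)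
      ((Ww_nonneg (pw1 zero_le_one) W).trans hc1))
    rw [show β^2 - 1 - (βW^2-1) = (β + βW) * (β - βW) by ring, abs_mul]
    have p1 : |β + βW| ≤ 2 := abs_le.2 ⟨by linarith, by linarith⟩
    have p2 : |β - βW| ≤ k.bB * r := by linarith
    exact mul_le_mul p1 p2 (abs_nonneg _) (by norm_num)
  have ff : toF Φ (sv Φ) = β := by rw [hβ, Bp_eval0]; rfl
  have s0 : sv Φ < 0 := by linarith
  have hfin : -sv Φ ≤ Φ.eval (β^2-1) := by
    have := abs_le.1 u1
    have := abs_le.1 u2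
    linarith
  have key : FB.Rn (toF Φ) 1 ≤ -1 := by
    unfold FB.Rn
    rw [mul_one, toF_one, ff]
    rw [div_le_iff_of_neg s0]
    show -1 * sv Φ ≤ Φ.eval (β^2-1)
    linarith
  refine ⟨?_, ?_, ?_, key⟩
  · show -1 < toF Φ 1
    rw [toF_one]; linarith [neg_abs_le (sv Φ)]
  · show toF Φ 1 < 0
    rw [toF_one]; exact s0
  · show 0 < toF Φ (toF Φ 1)
    rw [toF_one, ff]; exact β0

end FC

namespace FC
open Polynomial

structure Dat where
  (cen dir : ℕ → ℝ[X]) (lam av : ℕ → ℝ) (m qp qm : ℕ) (θ θp w c0 : ℝ) (Fs us : ℝ[X])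

noncomputable def fc (c : ℝ) : ℝ[X] := 1 + C c * (1 + X)
noncomputable def fk (k : ℕ) (c : ℝ) : ℝ[X] := Rp^[k] (fc c)

theorem fk_succ (k : ℕ) (c : ℝ) : fk (k+1) c = Rp (fk k c) := Function.iterate_succ_apply' _ _ _

theorem toF_fc (c : ℝ) : toF (fc c) = FB.f0 c := by
  funext x; unfold toF fc FB.f0; simp

theorem Con_fc (c : ℝ) : Con (fc c) := by simp [Con, fc]

structure Dat.Ok (D : Dat) : Prop where
  stg : ∀ k, Stg (D.cen k) (D.dir k) (D.cen (k+1)) (D.dir (k+1)) (8 * D.θ) (D.lam k) (D.av k)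
    (1/40) (1/500) (3/5) (D.θ / 10^4)
  a0 : ∀ k, 0 ≤ D.av k
  l1 : ∀ k, 22/5 ≤ D.lam k - D.av k
  l2 : ∀ k, D.lam k + D.av k ≤ 24/5
  nd : ∀ k, N (D.dir k) ≤ 5
  c0 : D.cen 0 = fc D.c0
  d0 : D.dir 0 = 1 + X
  lo : -2 < D.c0 - D.θ
  hi : D.c0 + D.θ < 0
  tail : ∀ k, D.m ≤ k → D.cen k = D.Fs ∧ D.dir k = D.us
  θp0 : 0 < D.θp
  θp1 : D.θp ≤ D.θ
  θp2 : D.θ ≤ 2 * D.θp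
  w0 : 0 < D.w
  w1 : D.w ≤ D.θp / 10
  endP : EndP D.qp (D.Fs + C D.θp * D.us) D.us 0 D.w D.w (6/1000 * D.θ)
  endM : EndM D.qm (D.Fs - C D.θ * D.us) D.us 0 (6/1000 * D.θ)

theorem Hor_iter {n i : ℕ} : ∀ {Φ : ℝ[X]}, (∀ j < n, Reg (Rp^[j] Φ)) →
    FB.Hor i (toF (Rp^[n] Φ)) → FB.Hor (n + i) (toF Φ) := by
  induction n with
  | zero => intro Φ _ h; simpa using h
  | succ n ih =>
    intro Φ h hh
    have r := h 0 (by omega)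
    rw [show n + 1 + i = (n + i) + 1 by ring]
    refine ⟨?_, ?_, ?_, ?_⟩
    · rw [toF_one]; exact r.1
    · rw [toF_one]; exact r.2.1
    · rw [toF_one]; exact r.2.2
    · rw [← toF_Rp]; exact ih (fun j hj => h (j+1) (by omega)) hh

theorem LZ_iter {n i : ℕ} : ∀ {Φ : ℝ[X]}, (∀ j < n, Reg (Rp^[j] Φ)) →
    (FB.LZ (n + i) (toF Φ) ↔ FB.LZ i (toF (Rp^[n] Φ))) := by
  induction n with
  | zero => intro Φ _; simp
  | succ n ih =>
    intro Φ h
    have r := h 0 (by omega)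
    rw [show n + 1 + i = (n + i) + 1 by ring, FB.LZ_succ, toF_one, ← toF_Rp,
      ih (Φ := Rp Φ) (fun j hj => h (j+1) (by omega))]
    exact ⟨fun h => h.2.2.2, fun h => ⟨r.1, r.2.1, r.2.2, h⟩⟩

theorem Zer_iter {n : ℕ} : ∀ {Φ : ℝ[X]}, FB.Zer n (toF Φ) → sv (Rp^[n] Φ) = 0 := by
  induction n with
  | zero => intro Φ h; rw [← toF_one]; exact h
  | succ n ih =>
    intro Φ h
    have := h.2.2.2
    rw [← toF_Rp] at this
    exact ih this

namespace Dat
variable (D : Dat)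

noncomputable def xk (k : ℕ) (c : ℝ) : ℝ := xc (D.cen k) (fk k c)
noncomputable def yk (k : ℕ) (c : ℝ) : ℝ := yc (D.cen k) (D.dir k) (fk k c)

structure In (k : ℕ) (c : ℝ) : Prop where
  con : Con (fk k c)
  lo : -D.θ ≤ D.xk k c
  hi : D.xk k c ≤ D.θp
  y : D.yk k c ≤ 6/1000 * D.θ

noncomputable def dl (k : ℕ) (c c' : ℝ) : ℝ := ell (fk k c' - fk k c)

end Dat

namespace Dat.Ok
variable {D : Dat}

theorem θ0 (h : D.Ok) : 0 < D.θ := h.θp0.trans_le h.θp1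

theorem absx (h : D.Ok) {k : ℕ} {c : ℝ} (i : D.In k c) : |D.xk k c| ≤ D.θ :=
  abs_le.2 ⟨i.lo, i.hi.trans h.θp1⟩

theorem near (h : D.Ok) {k : ℕ} {c : ℝ} (i : D.In k c) : N (fk k c - D.cen k) ≤ 8 * D.θ := by
  have := N_dev (h.nd k) (h.absx i) i.y
  linarith [h.θ0]

theorem reg (h : D.Ok) {k : ℕ} {c : ℝ} (i : D.In k c) : Reg (fk k c) :=
  (h.stg k).reg _ i.con (h.near i)

theorem step (h : D.Ok) {k : ℕ} {c : ℝ} (i : D.In k c) :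
    Con (fk (k+1) c) ∧ |D.xk (k+1) c - D.lam k * D.xk k c| ≤ D.av k * |D.xk k c| + D.θ/1000 ∧
    D.yk (k+1) c ≤ 6/1000 * D.θ := by
  obtain ⟨s1, s2, s3⟩ := (h.stg k).step (h.nd (k+1)) (by linarith [h.θ0]) i.con (h.near i)
  rw [← fk_succ] at s1 s2 s3
  have := h.absx i
  have := i.y
  have := h.θ0
  unfold xk yk at *
  exact ⟨s1, by linarith, by linarith⟩

theorem dl_x (k : ℕ) (c c' : ℝ) : D.xk k c' - D.xk k c = dl k c c' := by
  unfold xk xc dl; rw [← ell_sub]; congr 1; ring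

theorem dl0 (h : D.Ok) (c c' : ℝ) : dl 0 c c' = c' - c ∧ fk 0 c' - fk 0 c = C (c' - c) * (1 + X) := by
  have e : fk 0 c' - fk 0 c = C (c' - c) * (1 + X) := by
    unfold fk fc; simp only [Function.iterate_zero, id]; rw [C_sub]; ring
  refine ⟨?_, e⟩
  unfold dl; rw [e, ell_C_mul, ← h.d0, (h.stg 0).lv, mul_one]

theorem pstep (h : D.Ok) {k : ℕ} {c c' : ℝ} (i : D.In k c) (i' : D.In k c') (hd : 0 < dl k c c')
    (hy : N (fk k c' - fk k c - C (dl k c c') * D.dir k) ≤ 1/10 * dl k c c') :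
    43/10 * dl k c c' ≤ dl (k+1) c c' ∧ dl (k+1) c c' ≤ 49/10 * dl k c c' ∧
    N (fk (k+1) c' - fk (k+1) c - C (dl (k+1) c c') * D.dir (k+1)) ≤ 1/10 * dl (k+1) c c' := by
  have p := (h.stg k).px _ _ i.con (h.near i) i'.con (h.near i')
  have q := (h.stg k).py _ _ i.con (h.near i) i'.con (h.near i')
  rw [← fk_succ, ← fk_succ] at p q
  have e : ∀ k, ell (fk k c' - fk k c) = dl k c c' := fun k => rfl
  rw [e, e, abs_of_pos hd] at p
  rw [e, e, abs_of_pos hd] at q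
  have p' := abs_le.1 p
  have := mul_le_mul_of_nonneg_right (h.l1 k) hd.le
  have := mul_le_mul_of_nonneg_right (h.l2 k) hd.le
  refine ⟨?_, ?_, ?_⟩ <;> linarith [p'.1, p'.2]

theorem pair (h : D.Ok) {k : ℕ} {c c' : ℝ} (hc : c < c') (i : ∀ j < k, D.In j c)
    (i' : ∀ j < k, D.In j c') : (0 < dl k c c' ∧
    N (fk k c' - fk k c - C (dl k c c') * D.dir k) ≤ 1/10 * dl k c c') ∧
    (43/10)^k * (c' - c) ≤ dl k c c' ∧ dl k c c' ≤ (49/10)^k * (c' - c) := by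
  induction k with
  | zero =>
    obtain ⟨e1, e2⟩ := h.dl0 c c'
    rw [e2, e1, h.d0, sub_self, N_zero]
    refine ⟨⟨by linarith, by linarith⟩, by simp, by simp⟩
  | succ k ih =>
    obtain ⟨⟨a, b⟩, e, f⟩ := ih (fun j hj => i j (by omega)) (fun j hj => i' j (by omega))
    obtain ⟨p, q, r⟩ := h.pstep (i k (by omega)) (i' k (by omega)) a b
    refine ⟨⟨by linarith, r⟩, ?_, ?_⟩ <;> rw [pow_succ] <;> linarith

theorem cont (h : D.Ok) {k : ℕ} {a b : ℝ} (i : ∀ c ∈ Set.Icc a b, ∀ j < k, D.In j c) :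
    ContinuousOn (D.xk k) (Set.Icc a b) ∧ StrictMonoOn (D.xk k) (Set.Icc a b) := by
  have key : ∀ c ∈ Set.Icc a b, ∀ c' ∈ Set.Icc a b, c < c' →
      0 < D.xk k c' - D.xk k c ∧ D.xk k c' - D.xk k c ≤ (49/10)^k * (c' - c) := by
    intro c hc c' hc' hlt
    have := h.pair hlt (i c hc) (i c' hc')
    rw [dl_x]; exact ⟨this.1.1, this.2.2⟩
  refine ⟨?_, fun c hc c' hc' hlt => by linarith [(key c hc c' hc' hlt).1]⟩
  have : LipschitzOnWith (Real.toNNReal ((49/10)^k)) (D.xk k) (Set.Icc a b) := by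
    refine LipschitzOnWith.of_dist_le_mul fun x hx y hy => ?_
    rw [Real.coe_toNNReal _ (by positivity), Real.dist_eq, Real.dist_eq]
    rcases lt_trichotomy x y with hl | hl | hl
    · have := key x hx y hy hl
      rw [abs_sub_comm, abs_of_pos this.1, abs_sub_comm, abs_of_pos (by linarith)]; exact this.2
    · simp [hl]
    · have := key y hy x hx hl
      rw [abs_of_pos this.1, abs_of_pos (by linarith)]; exact this.2
  exact this.continuousOn

theorem exJ (h : D.Ok) (k : ℕ) : ∃ a b, a < b ∧ D.c0 - D.θ ≤ a ∧ b ≤ D.c0 + D.θ ∧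
    D.xk k a = -D.θ ∧ D.xk k b = D.θp ∧ ∀ c ∈ Set.Icc a b, ∀ j ≤ k, D.In j c := by
  have t0 := h.θ0
  have p0 := h.θp0
  have p1 := h.θp1
  have p2 := h.θp2
  induction k with
  | zero =>
    have x0 : ∀ c, D.xk 0 c = c - D.c0 := by
      intro c
      have := (h.dl0 D.c0 c).1
      unfold dl at this
      rw [← this]; unfold xk xc; rw [h.c0]; rfl
    refine ⟨D.c0 - D.θ, D.c0 + D.θp, by linarith, le_rfl, by linarith, by rw [x0]; ring,
      by rw [x0]; ring, ?_⟩
    intro c hc j hj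
    obtain rfl : j = 0 := by omega
    refine ⟨Con_fc c, ?_, ?_, ?_⟩
    · rw [x0]; linarith [hc.1]
    · rw [x0]; linarith [hc.2]
    · have e : D.yk 0 c = 0 := by
        have e2 := (h.dl0 D.c0 c).2
        unfold yk yc
        have := x0 c
        unfold xk at this
        rw [this, h.d0, h.c0, show fc D.c0 = fk 0 D.c0 from rfl, e2, sub_self, N_zero]
      rw [e]; positivity
  | succ k ih =>
    obtain ⟨a, b, hab, ha, hb, xa, xb, hin⟩ := ih
    obtain ⟨cc, mm⟩ := h.cont (k := k+1) (fun c hc j hj => hin c hc j (by omega))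
    have va : D.xk (k+1) a ≤ -D.θ := by
      have s := (h.step (hin a ⟨le_rfl, hab.le⟩ k le_rfl)).2.1
      rw [xa, abs_neg, abs_of_pos t0] at s
      have := mul_le_mul_of_nonneg_right (h.l1 k) t0.le
      linarith [(abs_le.1 s).2]
    have vb : D.θp ≤ D.xk (k+1) b := by
      have s := (h.step (hin b ⟨hab.le, le_rfl⟩ k le_rfl)).2.1
      rw [xb, abs_of_pos p0] at s
      have := mul_le_mul_of_nonneg_right (h.l1 k) p0.le
      linarith [(abs_le.1 s).1]
    have iv := intermediate_value_Icc hab.le cc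
    obtain ⟨a', ha', ea⟩ := iv ⟨va, by linarith⟩
    obtain ⟨b', hb', eb⟩ := iv ⟨by linarith, vb⟩
    have lt : a' < b' := by
      rw [← mm.lt_iff_lt ha' hb', ea, eb]; linarith
    refine ⟨a', b', lt, ha.trans ha'.1, hb'.2.trans hb, ea, eb, fun c hc j hj => ?_⟩
    have hc' : c ∈ Set.Icc a b := ⟨ha'.1.trans hc.1, hc.2.trans hb'.2⟩
    rcases Nat.lt_or_ge j (k+1) with hj' | hj'
    · exact hin c hc' j (by omega)
    · obtain rfl : j = k+1 := by omega
      have s := h.step (hin c hc' k le_rfl)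
      refine ⟨s.1, ?_, ?_, s.2.2⟩
      · rw [← ea]; exact mm.monotoneOn ha' hc' hc.1
      · rw [← eb]; exact mm.monotoneOn hc' hb' hc.2

theorem xcp (h : D.Ok) {k : ℕ} (hk : D.m ≤ k) (t c : ℝ) :
    xc (D.Fs + C t * D.us) (fk k c) = D.xk k c - t ∧
    yc (D.Fs + C t * D.us) D.us (fk k c) = D.yk k c := by
  obtain ⟨e1, e2⟩ := h.tail k hk
  have lv := (h.stg k).lv
  rw [e2] at lv
  have a : xc (D.Fs + C t * D.us) (fk k c) = D.xk k c - t := by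
    unfold xk xc; rw [e1, ← sub_sub, ell_sub, ell_C_mul, lv, mul_one]
  refine ⟨a, ?_⟩
  unfold yk yc; rw [a, e1, e2]
  unfold xk; rw [e1, C_sub]; congr 1; ring

theorem regs {k q : ℕ} {c : ℝ} (h1 : ∀ j < k, Reg (fk j c)) (h2 : ∀ j < q, Reg (Rp^[j] (fk k c))) :
    ∀ j < k + q, Reg (fk j c) := by
  intro j hj
  rcases Nat.lt_or_ge j k with h | h
  · exact h1 j h
  · have := h2 (j - k) (by omega)
    unfold fk at *
    rwa [← Function.iterate_add_apply, Nat.sub_add_cancel h] at this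

theorem main (h : D.Ok) {k : ℕ} (hk : D.m ≤ k) : ∃ a b, b - a ≤ 2 * D.θ / (43/10)^k ∧
    a ≤ feigenbaumValue ∧ FB.z (k + D.qp) ≤ b ∧
    (∀ c ∈ Set.Icc a b, ∀ j ≤ k, D.In j c) ∧ D.θp - D.w ≤ D.xk k (FB.z (k + D.qp)) := by
  have t0 := h.θ0
  have p0 := h.θp0
  have p1 := h.θp1
  have w0 := h.w0
  have w1 := h.w1
  obtain ⟨a, b, hab, ha, hb, xa, xb, hin⟩ := h.exJ k
  have ma : a ∈ Set.Icc a b := ⟨le_rfl, hab.le⟩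
  have mb : b ∈ Set.Icc a b := ⟨hab.le, le_rfl⟩
  have lo : ∀ c ∈ Set.Icc a b, -2 < c ∧ c < 0 := fun c hc =>
    ⟨by linarith [hc.1, h.lo], by linarith [hc.2, h.hi]⟩
  have rk : ∀ c ∈ Set.Icc a b, ∀ j < k, Reg (fk j c) := fun c hc j hj => h.reg (hin c hc j hj.le)
  have c1 : a ≤ feigenbaumValue := by
    have e := h.xcp hk (-D.θ) a
    rw [C_neg, neg_mul, ← sub_eq_add_neg, xa] at e
    have r := h.endM.reg (fk k a) (hin a ma k le_rfl).con (by rw [e.1]; simp)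
      (by rw [e.2]; exact (hin a ma k le_rfl).y)
    have H := Hor_iter (n := k + D.qm) (i := 1) (Φ := fc a) (regs (rk a ma) r.1) (by
      rw [add_comm k, Function.iterate_add_apply]; exact r.2)
    rw [toF_fc] at H
    exact FB.Hor_le (lo a ma).1.le (lo a ma).2 H
  have itv : ∀ c, Rp^[D.qp] (fk k c) = Rp^[k + D.qp] (fc c) := fun c => by
    rw [add_comm k, Function.iterate_add_apply]; rfl
  have c2 : FB.z (k + D.qp) ≤ b := by
    have e := h.xcp hk D.θp b
    rw [xb, sub_self] at e
    have r := h.endP.reg (fk k b) (hin b mb k le_rfl).con (by rw [e.1]; simpa using w0.le)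
      (by rw [e.2]; exact (hin b mb k le_rfl).y)
    have r2 := h.endP.pos (fk k b) (hin b mb k le_rfl).con (by rw [e.1]; simp)
      (by rw [e.2]; exact (hin b mb k le_rfl).y)
    have H := (LZ_iter (n := k + D.qp) (i := 0) (Φ := fc b) (regs (rk b mb) r.1)).2 (by
      rw [FB.LZ_zero, toF_one, ← itv]; exact r2)
    rw [toF_fc, add_zero] at H
    exact FB.z_le_of_Lev (lo b mb).1 (lo b mb).2 H
  obtain ⟨cc, mm⟩ := h.cont (k := k) (fun c hc j hj => hin c hc j hj.le)
  obtain ⟨ca, hca, eca⟩ := intermediate_value_Icc hab.le cc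
    (show D.θp - D.w ∈ Set.Icc (D.xk k a) (D.xk k b) from ⟨by linarith, by linarith⟩)
  have c3 : ca < FB.z (k + D.qp) := by
    by_contra hcon
    obtain ⟨i, hi, H⟩ := FB.LZ_of_z (lo ca hca).2 (not_lt.1 hcon)
    have e := h.xcp hk D.θp ca
    rw [eca, show D.θp - D.w - D.θp = -D.w by ring] at e
    have ew : |xc (D.Fs + C D.θp * D.us) (fk k ca)| ≤ D.w := by
      rw [e.1, abs_neg, abs_of_pos w0]
    have iy := (hin ca hca k le_rfl).y
    rw [← e.2] at iy
    have r := h.endP.reg (fk k ca) (hin ca hca k le_rfl).con ew iy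
    have r2 := h.endP.neg (fk k ca) (hin ca hca k le_rfl).con ew e.1.le iy
    have rr := regs (rk ca hca) r.1
    have hs : sv (Rp^[i] (fc ca)) < 0 := by
      rcases hi.eq_or_lt with rfl | hi
      · rw [← itv]; exact r2
      · exact (rr i hi).2.1
    have := (LZ_iter (n := i) (i := 0) (Φ := fc ca) (fun j hj => rr j (by omega))).1 (by
      rw [toF_fc]; exact H)
    rw [FB.LZ_zero, toF_one] at this
    linarith
  refine ⟨a, b, ?_, c1, c2, hin, ?_⟩
  · rw [le_div_iff₀ (by positivity)]
    have := (h.pair hab (fun j hj => hin a ma j hj.le) (fun j hj => hin b mb j hj.le)).2.1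
    rw [← dl_x (D := D), xa, xb] at this
    linarith
  · rw [← eca]
    exact mm.monotoneOn hca ⟨hca.1.trans c3.le, c2⟩ c3.le

theorem inz (h : D.Ok) {n k : ℕ} (hn : D.m + D.qp ≤ n) (hk : k + D.qp ≤ n) : D.In k (FB.z n) := by
  obtain ⟨a, b, _, h1, h2, h3, _⟩ := h.main (k := n - D.qp) (by omega)
  rw [Nat.sub_add_cancel (by omega)] at h2
  exact h3 _ ⟨h1.trans (FB.cF_le n), h2⟩ k (by omega)

theorem ztop (h : D.Ok) {k : ℕ} (hk : D.m ≤ k) : D.θp - D.w ≤ D.xk k (FB.z (k + D.qp)) := by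
  obtain ⟨a, b, _, h1, h2, h3, h4⟩ := h.main hk
  exact h4

theorem zlim (h : D.Ok) : Tendsto FB.z atTop (𝓝 feigenbaumValue) := by
  have key : ∀ k, D.m ≤ k → |FB.z (k + D.qp) - feigenbaumValue| ≤ 2 * D.θ * (10/43)^k := by
    intro k hk
    obtain ⟨a, b, h0, h1, h2, h3, h4⟩ := h.main hk
    rw [abs_of_nonneg (by linarith [FB.cF_le (k + D.qp)])]
    rw [show (10/43:ℝ) = (43/10)⁻¹ by norm_num, inv_pow, ← div_eq_mul_inv]
    linarith
  rw [← tendsto_add_atTop_iff_nat D.qp, tendsto_iff_dist_tendsto_zero]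
  have z : Tendsto (fun k : ℕ => 2 * D.θ * (10/43:ℝ)^k) atTop (𝓝 0) := by
    simpa using (tendsto_pow_atTop_nhds_zero_of_lt_one (by norm_num : (0:ℝ) ≤ 10/43)
      (by norm_num)).const_mul (2 * D.θ)
  refine tendsto_of_tendsto_of_tendsto_of_le_of_le' tendsto_const_nhds z
    (Eventually.of_forall fun k => dist_nonneg) ?_
  filter_upwards [eventually_ge_atTop D.m] with k hk
  rw [Real.dist_eq]; exact key k hk

end Dat.Ok
end FC

namespace FC

theorem log_near {u : ℝ} (h : |u - 1| ≤ 1/2) : |Real.log u| ≤ 2 * |u - 1| := by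
  have h' := abs_le.1 h
  have u0 : 0 < u := by linarith
  have h1 := Real.log_le_sub_one_of_pos u0
  have h2 := Real.one_sub_inv_le_log_of_pos u0
  have h3 : 1 - u⁻¹ = (u - 1) / u := by field_simp
  have h4 : |(u-1)/u| ≤ 2 * |u-1| := by
    rw [abs_div, abs_of_pos u0, div_le_iff₀ u0]
    nlinarith [abs_nonneg (u-1)]
  rw [abs_le]
  constructor
  · have := (abs_le.1 h4).1; rw [h3] at h2; linarith
  · linarith [le_abs_self (u-1), abs_nonneg (u-1)]

theorem seqlim0 {z : ℕ → ℝ} {L C η : ℝ} (hz : StrictAnti z) (hl : Tendsto z atTop (𝓝 L))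
    (h0 : 0 < η) (h1 : η < 1) (hC : C ≤ 1/2) (hq : ∀ n, |((z (n+1) - z (n+2)) / (z (n+2) - z (n+3))) /
      ((z n - z (n+1)) / (z (n+1) - z (n+2))) - 1| ≤ C * η^n) :
    ∃ lam b : ℝ, 1 < lam ∧ 0 < b ∧ Tendsto (fun n : ℕ => lam^n * (z n - L)) atTop (𝓝 b) := by
  set s : ℕ → ℝ := fun n => z n - z (n+1) with hs
  have s0 : ∀ n, 0 < s n := fun n => sub_pos.2 (hz (Nat.lt_succ_self n))
  have C0 : 0 ≤ C := by simpa using (abs_nonneg _).trans (hq 0)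
  set l : ℕ → ℝ := fun n => Real.log (s n / s (n+1)) with hlg
  have q0 : ∀ n, 0 < s n / s (n+1) := fun n => div_pos (s0 n) (s0 (n+1))
  have d1 : ∀ n, dist (l n) (l (n+1)) ≤ 2 * C * η^n := by
    intro n
    rw [dist_comm, Real.dist_eq, hlg]
    show |Real.log _ - Real.log _| ≤ _
    rw [← Real.log_div (q0 _).ne' (q0 _).ne']
    have e : η^n ≤ 1 := pow_le_one₀ h0.le h1.le
    have := log_near ((hq n).trans (by nlinarith [pow_pos h0 n]))
    refine this.trans ?_
    linarith [hq n]
  obtain ⟨Λ, hΛ⟩ := cauchySeq_tendsto_of_complete (cauchySeq_of_le_geometric η (2*C) h1 d1)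
  have d2 : ∀ n, |l n - Λ| ≤ 2*C*η^n/(1-η) := fun n =>
    dist_le_of_le_geometric_of_tendsto η (2*C) h1 d1 hΛ n
  set v : ℕ → ℝ := fun n => Real.log (s n) + n * Λ with hv
  have d3 : ∀ n, dist (v n) (v (n+1)) ≤ (2*C/(1-η)) * η^n := by
    intro n
    have : v n - v (n+1) = l n - Λ := by
      simp only [hv, hlg]; rw [Real.log_div (s0 _).ne' (s0 _).ne']; push_cast; ring
    rw [Real.dist_eq, this]
    refine (d2 n).trans (le_of_eq ?_)
    ring
  obtain ⟨β, hβ⟩ := cauchySeq_tendsto_of_complete (cauchySeq_of_le_geometric η _ h1 d3)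
  set lam := Real.exp Λ with hlam
  have lam0 : 0 < lam := Real.exp_pos _
  have ls : ∀ n, lam^n * s n = Real.exp (v n) := by
    intro n
    rw [hv, Real.exp_add, Real.exp_log (s0 n), hlam, ← Real.exp_nat_mul]; ring
  have hb : Tendsto (fun n => lam^n * s n) atTop (𝓝 (Real.exp β)) := by
    simp only [ls]; exact (Real.continuous_exp.tendsto β).comp hβ
  have sl : Tendsto s atTop (𝓝 0) := by
    have := hl.sub ((tendsto_add_atTop_iff_nat 1).2 hl)
    rwa [sub_self] at this
  have lam1 : 1 < lam := by
    by_contra hcon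
    push Not at hcon
    have : Tendsto (fun n => lam^n * s n) atTop (𝓝 0) := by
      refine squeeze_zero (fun n => (mul_pos (pow_pos lam0 n) (s0 n)).le) (fun n => ?_) sl
      exact mul_le_of_le_one_left (s0 n).le (pow_le_one₀ lam0.le hcon)
    exact (Real.exp_pos β).ne (tendsto_nhds_unique this hb)
  have hsum : ∀ n, HasSum (fun j => s (n + j)) (z n - L) := by
    intro n
    have nn : ∀ j, 0 ≤ s (n + j) := fun j => (s0 _).le
    rw [hasSum_iff_tendsto_nat_of_nonneg nn]
    have e : ∀ k, ∑ j ∈ Finset.range k, s (n + j) = z n - z (n + k) := by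
      intro k
      induction k with
      | zero => simp
      | succ k ih => rw [Finset.sum_range_succ, ih, hs]; simp only [add_assoc]; ring
    simp only [e]
    refine tendsto_const_nhds.sub ?_
    have := (tendsto_add_atTop_iff_nat n).2 hl
    simpa [add_comm] using this
  obtain ⟨B, hB⟩ := hb.bddAbove_range
  have hB' : ∀ n, lam^n * s n ≤ B := fun n => hB ⟨n, rfl⟩
  have li0 : 0 ≤ lam⁻¹ := inv_nonneg.2 lam0.le
  have li1 : lam⁻¹ < 1 := inv_lt_one_of_one_lt₀ lam1
  have T := tendsto_tsum_of_dominated_convergence (𝓕 := atTop)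
    (f := fun (n j : ℕ) => (lam⁻¹)^j * (lam^(n+j) * s (n+j)))
    (g := fun j : ℕ => (lam⁻¹)^j * Real.exp β) (bound := fun j => (lam⁻¹)^j * B)
    ((summable_geometric_of_lt_one li0 li1).mul_right B)
    (fun j => ((tendsto_add_atTop_iff_nat j).2 hb).const_mul _)
    (Eventually.of_forall fun n j => by
      rw [Real.norm_of_nonneg (by have := s0 (n+j); positivity)]
      exact mul_le_mul_of_nonneg_left (hB' _) (by positivity))
  have e : ∀ n, ∑' j, (lam⁻¹)^j * (lam^(n+j) * s (n+j)) = lam^n * (z n - L) := by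
    intro n
    rw [← (hsum n).tsum_eq, ← tsum_mul_left]
    congr 1; funext j
    rw [pow_add, inv_pow]; field_simp
  simp only [e] at T
  refine ⟨lam, _, lam1, ?_, T⟩
  rw [tsum_mul_right, tsum_geometric_of_lt_one li0 li1]
  exact mul_pos (inv_pos.2 (by linarith)) (Real.exp_pos _)

theorem seqlim {z : ℕ → ℝ} {L C η : ℝ} (hz : StrictAnti z) (hl : Tendsto z atTop (𝓝 L))
    (h0 : 0 < η) (h1 : η < 1) (hq : ∀ᶠ n in atTop, |((z (n+1) - z (n+2)) / (z (n+2) - z (n+3))) /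
      ((z n - z (n+1)) / (z (n+1) - z (n+2))) - 1| ≤ C * η^n) :
    ∃ lam b : ℝ, 1 < lam ∧ 0 < b ∧ Tendsto (fun n : ℕ => lam^n * (z n - L)) atTop (𝓝 b) := by
  have : Tendsto (fun n : ℕ => C * η^n) atTop (𝓝 0) := by
    simpa using (tendsto_pow_atTop_nhds_zero_of_lt_one h0.le h1).const_mul C
  have ev := this.eventually_le_const (show (0:ℝ) < 1/2 by norm_num)
  obtain ⟨n1, hn1⟩ := eventually_atTop.1 (hq.and ev)
  obtain ⟨lam, b, l1, b0, T⟩ := seqlim0 (z := fun n => z (n + n1)) (L := L) (C := C * η^n1) (η := η)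
    (fun a b h => hz (by omega)) ((tendsto_add_atTop_iff_nat n1).2 hl) h0 h1 (hn1 n1 le_rfl).2 (by
      intro n
      have := (hn1 (n + n1) (by omega)).1
      simp only [show n + 1 + n1 = n + n1 + 1 by ring, show n + 2 + n1 = n + n1 + 2 by ring,
        show n + 3 + n1 = n + n1 + 3 by ring]
      refine this.trans (le_of_eq ?_)
      rw [pow_add]; ring)
  have l0 : 0 < lam := by linarith
  refine ⟨lam, lam^n1 * b, l1, by positivity, ?_⟩
  rw [← tendsto_add_atTop_iff_nat n1]
  refine (T.const_mul (lam^n1)).congr fun n => ?_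
  rw [pow_add]; ring

theorem ratio {a b c d δ : ℝ} (ha : |a - 1| ≤ δ) (hb : |b - 1| ≤ δ) (hc : |c - 1| ≤ δ)
    (hd : |d - 1| ≤ δ) (h : δ ≤ 1/4) : |a * b / (c * d) - 1| ≤ 10 * δ := by
  have d0 : 0 ≤ δ := (abs_nonneg _).trans ha
  have two : ∀ {a b : ℝ}, |a - 1| ≤ δ → |b - 1| ≤ δ → |a * b - 1| ≤ 9/4 * δ := by
    intro a b ha hb
    have : a * b - 1 = (a - 1) + (b - 1) + (a-1)*(b-1) := by ring
    rw [this]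
    refine (abs_add_le _ _).trans ?_
    have h1 := abs_add_le (a-1) (b-1)
    have h2 : |(a-1)*(b-1)| ≤ 1/4 * δ := by
      rw [abs_mul]; exact mul_le_mul (ha.trans h) hb (abs_nonneg _) (by norm_num)
    linarith
  have h1 := two ha hb
  have h2 := two hc hd
  have h3 : 7/16 ≤ c * d := by linarith [(abs_le.1 h2).1]
  have h4 : 0 < c * d := by linarith
  rw [show a * b / (c*d) - 1 = (a*b - 1 - (c*d - 1)) / (c*d) by
    rw [sub_sub_sub_cancel_right, sub_div, div_self h4.ne']]
  rw [abs_div, abs_of_pos h4, div_le_iff₀ h4]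
  have h5 := abs_sub (a*b-1) (c*d-1)
  have cd : 9/16 ≤ c*d := by
    have := (abs_le.1 hc).1; have := (abs_le.1 hd).1
    nlinarith
  nlinarith

theorem etaT (T : ℕ) : ∃ t, t ≤ T ∧ T ≤ 8 * t + 7 ∧ ((43:ℝ)/10)⁻¹^t ≤ 4 * (84/100)^T ∧
    (62/100:ℝ)^(T-t) * (49/10)^t ≤ (84/100)^T := by
  refine ⟨T/8, by omega, by omega, ?_, ?_⟩
  · have h1 : ((43:ℝ)/10)⁻¹^(T/8) ≤ ((84/100)^8)^(T/8) :=
      pow_le_pow_left₀ (by norm_num) (by norm_num) _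
    refine h1.trans ?_
    rw [← pow_mul]
    have h2 : (84/100:ℝ)^(8*(T/8)) * (84/100)^(T%8) = (84/100)^T := by
      rw [← pow_add]; congr 1; omega
    have h3 : (84/100:ℝ)^7 ≤ (84/100)^(T%8) :=
      pow_le_pow_of_le_one (by norm_num) (by norm_num) (by omega)
    have h4 : (1:ℝ)/4 ≤ (84/100)^7 := by norm_num
    have h5 : (0:ℝ) < (84/100)^(8*(T/8)) := by positivity
    rw [← h2]; nlinarith
  · have h2 : (84/100:ℝ)^T = ((84/100)^8)^(T/8) * (84/100)^(T%8) := by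
      rw [← pow_mul, ← pow_add]; congr 1; omega
    have h3 : (62/100:ℝ)^(T-T/8) = ((62/100)^7)^(T/8) * (62/100)^(T%8) := by
      rw [← pow_mul, ← pow_add]; congr 1; omega
    rw [h2, h3, mul_right_comm, ← mul_pow]
    refine mul_le_mul (pow_le_pow_left₀ (by norm_num) (by norm_num) _)
      (pow_le_pow_left₀ (by norm_num) (by norm_num) _) (by positivity) (by positivity)

end FC

namespace FC
open Polynomial

theorem le_of_small {A B K t0 : ℝ} (h0 : 0 < t0) (h : ∀ t, 0 < t → t ≤ t0 → A ≤ B + t * K) :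
    A ≤ B := by
  refine le_of_forall_pos_le_add fun ε hε => ?_
  have k1 : 0 < |K| + 1 := by positivity
  have := h (min t0 (ε / (|K|+1))) (lt_min h0 (by positivity)) (min_le_left _ _)
  refine this.trans (add_le_add_right ?_ B)
  have e : ε / (|K|+1) * (|K|+1) = ε := by field_simp
  have h1 : min t0 (ε / (|K|+1)) * K ≤ min t0 (ε / (|K|+1)) * (|K|+1) :=
    mul_le_mul_of_nonneg_left (by linarith [le_abs_self K]) (lt_min h0 (by positivity)).le
  have h2 : min t0 (ε / (|K|+1)) * (|K|+1) ≤ ε / (|K|+1) * (|K|+1) :=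
    mul_le_mul_of_nonneg_right (min_le_right _ _) k1.le
  linarith

theorem Stg.tan {F v F1 v1 : ℝ[X]} {r lam a b c κ ε n : ℝ} (h : Stg F v F1 v1 r lam a b c κ ε)
    (hv1 : N v1 ≤ n) {O : ℝ[X]} (hO : Con O) (hr : N (O - F) < r) {ξ : ℝ[X]} (hξ : Tan ξ)
    (lξ : ell ξ = 0) :
    |ell (DR O ξ)| ≤ b * N ξ ∧ N (DR O ξ - C (ell (DR O ξ)) * v1) ≤ κ * N ξ := by
  obtain ⟨K, K0, hK⟩ := h.sec
  have n0 := N_nonneg ξ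
  set t0 := (r - N (O - F)) / (N ξ + 1) with ht0
  have tp : 0 < t0 := div_pos (by linarith) (by linarith)
  have key : ∀ t, 0 < t → t ≤ t0 →
      t * |ell (DR O ξ)| ≤ t * (b * N ξ + t * (K * N ξ * N ξ)) ∧
      t * N (DR O ξ - C (ell (DR O ξ)) * v1) ≤ t * (κ * N ξ + t * ((1 + 1/2*n) * (K * N ξ * N ξ))) := by
    intro t t1 t2
    set Ψ := O + C t * ξ with hΨ
    have e : Ψ - O = C t * ξ := by rw [hΨ]; ring
    have cΨ : Con Ψ := by unfold Con Tan at *; rw [hΨ, eval_add, hO, eval_mul, hξ]; simp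
    have nΨ : N (Ψ - O) = t * N ξ := by rw [e, N_C_mul, abs_of_pos t1]
    have t3 : t * N ξ ≤ r - N (O - F) := by
      have : t * (N ξ + 1) ≤ t0 * (N ξ + 1) := mul_le_mul_of_nonneg_right t2 (by linarith)
      rw [ht0, div_mul_cancel₀ _ (by linarith)] at this
      nlinarith
    have bΨ : N (Ψ - F) ≤ r := by have := N_tri Ψ O F; linarith
    have p := h.px O Ψ hO hr.le cΨ bΨ
    have q := h.py O Ψ hO hr.le cΨ bΨ
    have s := hK O hO hr.le O Ψ hO hr.le cΨ bΨ (t * N ξ) (by rw [sub_self, N_zero]; positivity) nΨ.le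
    rw [nΨ] at s
    have le0 : ell (Ψ - O) = 0 := by rw [e, ell_C_mul, lξ, mul_zero]
    rw [le0, C_0, zero_mul, sub_zero, nΨ] at p q
    rw [e, DR_C_mul] at s
    set E := Rp Ψ - Rp O - C t * DR O ξ with hE
    have d : Rp Ψ - Rp O = C t * DR O ξ + E := by rw [hE]; ring
    rw [d] at p q
    have ld : ell (C t * DR O ξ + E) = t * ell (DR O ξ) + ell E := by rw [ell_add, ell_C_mul]
    rw [ld] at p q
    constructor
    · have l1 := ell_le E
      have l2 := abs_sub_abs_le_abs_sub (t * ell (DR O ξ)) (-ell E)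
      rw [sub_neg_eq_add, abs_neg, abs_mul, abs_of_pos t1] at l2
      simp only [mul_zero, sub_zero, abs_zero, zero_add] at p
      nlinarith [N_nonneg E]
    · have l1 := proj_le hv1 E
      have id : C t * (DR O ξ - C (ell (DR O ξ)) * v1) =
        (C t * DR O ξ + E - C (t * ell (DR O ξ) + ell E) * v1) - (E - C (ell E) * v1) := by
        rw [C_add, C_mul]; ring
      have l2 := N_sub (C t * DR O ξ + E - C (t * ell (DR O ξ) + ell E) * v1) (E - C (ell E) * v1)
      rw [← id, N_C_mul, abs_of_pos t1] at l2
      simp only [mul_zero, abs_zero, zero_add] at q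
      have nn : 0 ≤ n := (N_nonneg _).trans hv1
      have l3 := mul_le_mul_of_nonneg_left s (show 0 ≤ 1 + 1/2*n by linarith)
      nlinarith
  exact ⟨le_of_small tp fun t t1 t2 => le_of_mul_le_mul_left (key t t1 t2).1 t1,
    le_of_small tp fun t t1 t2 => le_of_mul_le_mul_left (key t t1 t2).2 t1⟩

theorem dist_step {O v1 w1 w2 w1' w2' : ℝ[X]} {E : ℝ} (hv1 : N v1 ≤ 5)
    (hyp : ∀ ξ, Tan ξ → ell ξ = 0 → |ell (DR O ξ)| ≤ 1/40 * N ξ ∧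
      N (DR O ξ - C (ell (DR O ξ)) * v1) ≤ 3/5 * N ξ)
    (T1 : Tan w1) (T2 : Tan w2) (x1 : 0 < ell w1) (x2 : 0 < ell w2)
    (g : 43/10 * ell w1 ≤ ell w1') (cone : N (w1' - C (ell w1') * v1) ≤ 1/10 * ell w1')
    (e1 : N (w1' - DR O w1) ≤ E * ell w1) (e2 : N (w2' - DR O w2) ≤ E * ell w2) (hE : 0 ≤ E) :
    |ell w2' / ell w1' - ell w2 / ell w1| ≤
      (1/40 * (N (w2 - C (ell w2 / ell w1) * w1) / ell w1) + E * (ell w2 / ell w1)) ∧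
    N (w2' - C (ell w2' / ell w1') * w1') / ell w1' ≤
      (61/100 * (N (w2 - C (ell w2 / ell w1) * w1) / ell w1) + 8 * (E * (ell w2 / ell w1))) := by
  set r := ell w2 / ell w1 with hr
  set ξ := w2 - C r * w1 with hξ
  have x1' : 0 < ell w1' := by linarith
  have r0 : 0 < r := div_pos x2 x1
  have rx : r * ell w1 = ell w2 := by rw [hr]; field_simp
  have lξ : ell ξ = 0 := by rw [hξ, ell_sub, ell_C_mul, rx, sub_self]
  have tξ : Tan ξ := by unfold Tan at *; rw [hξ, eval_sub, eval_mul, T1, T2]; simp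
  obtain ⟨a1, a2⟩ := hyp ξ tξ lξ
  set e := (w2' - DR O w2) - C r * (w1' - DR O w1) with he
  have Ne : N e ≤ 2 * E * ell w2 := by
    have := N_sub (w2' - DR O w2) (C r * (w1' - DR O w1))
    rw [N_C_mul, abs_of_pos r0] at this
    have h2 := mul_le_mul_of_nonneg_left e1 r0.le
    have h3 : r * (E * ell w1) = E * ell w2 := by rw [← rx]; ring
    linarith
  have dec : w2' - C r * w1' = DR O ξ + e := by
    have : DR O ξ = DR O w2 - C r * DR O w1 := by
      rw [hξ, sub_eq_add_neg, ← neg_mul, ← C_neg, DR_add, DR_C_mul, C_neg]; ring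
    rw [this, he]; ring
  set W := w2' - C r * w1' with hW
  have lW : ell W = ell w2' - r * ell w1' := by rw [hW, ell_sub, ell_C_mul]
  have b1 : |ell W| ≤ 1/40 * N ξ + E * ell w2 := by
    rw [dec, ell_add]
    have := abs_add_le (ell (DR O ξ)) (ell e)
    have := ell_le e
    linarith
  have b2 : N (W - C (ell W) * v1) ≤ 3/5 * N ξ + 7 * (E * ell w2) := by
    have id : W - C (ell W) * v1 = (DR O ξ - C (ell (DR O ξ)) * v1) + (e - C (ell e) * v1) := by
      rw [dec, ell_add, C_add]; ring
    rw [id]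
    have := N_add (DR O ξ - C (ell (DR O ξ)) * v1) (e - C (ell e) * v1)
    have := proj_le hv1 e
    linarith
  have dr : ell w2' / ell w1' - r = ell W / ell w1' := by rw [lW]; field_simp
  have nx := N_nonneg ξ
  have q0 : 0 ≤ E * ell w2 := by positivity
  constructor
  · rw [dr, abs_div, abs_of_pos x1', div_le_iff₀ x1']
    have c1 : (1/40 * (N ξ / ell w1) + E * r) * ell w1 = 1/40 * N ξ + E * ell w2 := by
      rw [← rx]; field_simp
    have c2 : 0 ≤ 1/40 * (N ξ / ell w1) + E * r := by positivity
    nlinarith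
  · rw [div_le_iff₀ x1']
    have c1 : (61/100 * (N ξ / ell w1) + 8 * (E * r)) * ell w1 = 61/100 * N ξ + 8 * (E * ell w2) := by
      rw [← rx]; field_simp
    have c2 : 0 ≤ 61/100 * (N ξ / ell w1) + 8 * (E * r) := by positivity
    have id : w2' - C (ell w2' / ell w1') * w1' =
        (W - C (ell W) * v1) - C (ell W / ell w1') * (w1' - C (ell w1') * v1) := by
      have h1 : ell w2' / ell w1' = ell W / ell w1' + r := by linarith
      have h2 : C (ell W / ell w1') * C (ell w1') = C (ell W) := by
        rw [← C_mul]; congr 1; field_simp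
      rw [h1, C_add, hW, ← hW]
      have : C (ell W / ell w1') * (w1' - C (ell w1') * v1) =
        C (ell W / ell w1') * w1' - C (ell W) * v1 := by rw [mul_sub, ← mul_assoc, h2]
      rw [this, hW]; ring
    have h := N_sub (W - C (ell W) * v1) (C (ell W / ell w1') * (w1' - C (ell w1') * v1))
    rw [← id, N_C_mul, abs_div, abs_of_pos x1'] at h
    have h3 : |ell W| / ell w1' * N (w1' - C (ell w1') * v1) ≤ 1/10 * |ell W| := by
      rw [div_mul_eq_mul_div, div_le_iff₀ x1']
      nlinarith [abs_nonneg (ell W)]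
    nlinarith

namespace Dat.Ok
variable {D : Dat}

theorem near' (h : D.Ok) {k : ℕ} {c : ℝ} (i : D.In k c) : N (fk k c - D.cen k) < 8 * D.θ := by
  have := N_dev (h.nd k) (h.absx i) i.y
  linarith [h.θ0]

theorem unif (h : D.Ok) : ∃ K, 0 ≤ K ∧ ∀ k, ∀ O, Con O → N (O - D.cen k) ≤ 8 * D.θ → ∀ Φ Ψ, Con Φ →
    N (Φ - D.cen k) ≤ 8 * D.θ → Con Ψ → N (Ψ - D.cen k) ≤ 8 * D.θ → ∀ ρ, N (Φ - O) ≤ ρ →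
    N (Ψ - O) ≤ ρ → N (Rp Ψ - Rp Φ - DR O (Ψ - Φ)) ≤ K * ρ * N (Ψ - Φ) := by
  choose K K0 hK using fun k => (h.stg k).sec
  refine ⟨∑ j ∈ Finset.range (D.m + 1), K j, Finset.sum_nonneg fun j _ => K0 j, ?_⟩
  intro k O o1 o2 Φ Ψ c1 c2 d1 d2 ρ r1 r2
  obtain ⟨j, hj, e⟩ : ∃ j ≤ D.m, D.cen k = D.cen j := by
    rcases le_total k D.m with hk | hk
    · exact ⟨k, hk, rfl⟩
    · exact ⟨D.m, le_rfl, by rw [(h.tail k hk).1, (h.tail D.m le_rfl).1]⟩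
  rw [e] at o2 c2 d2
  refine (hK j O o1 o2 Φ Ψ c1 c2 d1 d2 ρ r1 r2).trans ?_
  have ρ0 : 0 ≤ ρ := (N_nonneg _).trans r1
  have : K j ≤ ∑ j ∈ Finset.range (D.m + 1), K j :=
    Finset.single_le_sum (f := K) (fun i _ => K0 i) (Finset.mem_range.2 (by omega))
  exact mul_le_mul_of_nonneg_right (mul_le_mul_of_nonneg_right this ρ0) (N_nonneg _)

noncomputable def _root_.FC.Xnk (n k : ℕ) : ℝ := dl k (FB.z (n+1)) (FB.z n)

theorem pz (h : D.Ok) {n k : ℕ} (hn : D.m + D.qp ≤ n) (hk : k ≤ n - D.qp) :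
    (0 < Xnk n k ∧ N (fk k (FB.z n) - fk k (FB.z (n+1)) - C (Xnk n k) * D.dir k) ≤ 1/10 * Xnk n k) :=
  (h.pair (FB.z_lt n) (fun j hj => h.inz (by omega) (by omega))
    (fun j hj => h.inz (by omega) (by omega))).1

theorem pzs (h : D.Ok) {n k : ℕ} (hn : D.m + D.qp ≤ n) (hk : k < n - D.qp) :
    43/10 * Xnk n k ≤ Xnk n (k+1) ∧ Xnk n (k+1) ≤ 49/10 * Xnk n k := by
  have := h.pstep (k := k) (c := FB.z (n+1)) (c' := FB.z n) (h.inz (by omega) (by omega))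
    (h.inz (by omega) (by omega)) (h.pz hn hk.le).1 (h.pz hn hk.le).2
  exact ⟨this.1, this.2.1⟩

theorem Nd (h : D.Ok) {n k : ℕ} (hn : D.m + D.qp ≤ n) (hk : k ≤ n - D.qp) :
    N (fk k (FB.z n) - fk k (FB.z (n+1))) ≤ 6 * Xnk n k := by
  obtain ⟨a, b⟩ := h.pz hn hk
  have := N_add (fk k (FB.z n) - fk k (FB.z (n+1)) - C (Xnk n k) * D.dir k) (C (Xnk n k) * D.dir k)
  rw [sub_add_cancel, N_C_mul, abs_of_pos a] at this
  have := mul_le_mul_of_nonneg_left (h.nd k) a.le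
  linarith

theorem Xup (h : D.Ok) {n t : ℕ} (hn : D.m + D.qp ≤ n) (ht : t ≤ n - D.qp) :
    Xnk n (n - D.qp - t) ≤ 2 * D.θ * ((43/10)⁻¹)^t ∧
    D.θp / 4 ≤ (49/10)^t * Xnk n (n - D.qp - t) := by
  induction t with
  | zero =>
    have i1 := h.inz hn (k := n - D.qp) (by omega)
    have i2 := h.inz (n := n+1) (k := n - D.qp) (by omega) (by omega)
    have e : Xnk n (n - D.qp) = D.xk (n - D.qp) (FB.z n) - D.xk (n - D.qp) (FB.z (n+1)) :=
      (dl_x _ _ _).symm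
    have t0 := h.θ0
    have p1 := h.θp1
    have p2 := h.θp2
    have w1 := h.w1
    have zt := h.ztop (k := n - D.qp) (by omega)
    rw [Nat.sub_add_cancel (by omega)] at zt
    simp only [Nat.sub_zero, pow_zero, mul_one, one_mul]
    rw [e]
    refine ⟨by linarith [i1.hi, i2.lo], ?_⟩
    have i3 := h.inz (n := n+1) (k := n - D.qp + 1) (by omega) (by omega)
    have st := (h.step i2).2.1
    have hx : D.xk (n - D.qp) (FB.z (n+1)) ≤ D.θp/2 := by
      by_contra hc
      push Not at hc
      have x0 : 0 < D.xk (n - D.qp) (FB.z (n+1)) := by linarith [h.θp0]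
      rw [abs_of_pos x0] at st
      have := mul_le_mul_of_nonneg_right (h.l1 (n - D.qp)) x0.le
      have := (abs_le.1 st).1
      linarith [i3.hi]
    linarith
  | succ t ih =>
    obtain ⟨a, b⟩ := ih (by omega)
    have p := h.pzs (n := n) (k := n - D.qp - (t+1)) hn (by omega)
    rw [show n - D.qp - (t+1) + 1 = n - D.qp - t by omega] at p
    constructor
    · rw [pow_succ, ← mul_assoc, ← div_eq_mul_inv, le_div_iff₀ (by norm_num)]; linarith [p.1]
    · rw [pow_succ, mul_assoc]
      have : (0:ℝ) < (49/10)^t := by positivity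
      have := mul_le_mul_of_nonneg_left p.2 this.le
      linarith

theorem H1 (h : D.Ok) : ∃ E0, 0 ≤ E0 ∧ ∀ n t, D.m + D.qp ≤ n → t ≤ n - D.qp →
    E0 * ((43/10)⁻¹)^t ≤ 1 →
    |Xnk (n+1) (n - D.qp - t) * (FB.z n - FB.z (n+1)) /
      (Xnk n (n - D.qp - t) * (FB.z (n+1) - FB.z (n+2))) - 1| ≤ E0 * ((43/10)⁻¹)^t := by
  obtain ⟨K, K0, hK⟩ := h.unif
  have t0 := h.θ0
  refine ⟨6 * K * (12 * D.θ), by positivity, ?_⟩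
  intro n t hn ht hE
  set E0 := 6 * K * (12 * D.θ) with hE0
  have E00 : 0 ≤ E0 := by positivity
  set T := n - D.qp with hT
  set β := (FB.z n - FB.z (n+1)) / (FB.z (n+1) - FB.z (n+2)) with hβ
  have z1 := FB.z_lt n
  have z2 : FB.z (n+2) < FB.z (n+1) := FB.z_lt (n+1)
  have β0 : 0 < β := div_pos (by linarith) (by linarith)
  set w1 : ℕ → ℝ[X] := fun k => fk k (FB.z n) - fk k (FB.z (n+1)) with hw1
  set w2 : ℕ → ℝ[X] := fun k => C β * (fk k (FB.z (n+1)) - fk k (FB.z (n+2))) with hw2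
  have l1 : ∀ k, ell (w1 k) = Xnk n k := fun k => rfl
  have l2 : ∀ k, ell (w2 k) = β * Xnk (n+1) k := fun k => by rw [hw2, ell_C_mul]; rfl
  have claim : ∀ k, k ≤ T - t → |ell (w2 k) / ell (w1 k) - 1| ≤ E0 * ((43/10)⁻¹)^(T - k) ∧
      N (w2 k - C (ell (w2 k) / ell (w1 k)) * w1 k) / ell (w1 k) ≤
        10 * (E0 * ((43/10)⁻¹)^(T - k)) := by
    intro k
    induction k with
    | zero =>
      intro _
      have a1 : w1 0 = C (FB.z n - FB.z (n+1)) * (1 + X) := (h.dl0 _ _).2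
      have a2 : w2 0 = C (FB.z n - FB.z (n+1)) * (1 + X) := by
        rw [hw2]
        show C β * (fk 0 (FB.z (n+1)) - fk 0 (FB.z (n+2))) = _
        rw [(h.dl0 _ _).2, ← mul_assoc, ← C_mul, hβ, div_mul_cancel₀ _ (by linarith)]
      have p : 0 < ell (w1 0) := (h.pz hn (Nat.zero_le _)).1
      rw [a2, ← a1, div_self p.ne', C_1, one_mul, sub_self, sub_self, N_zero, zero_div, abs_zero]
      constructor <;> positivity
    | succ k ih =>
      intro hk
      obtain ⟨r1, Z1⟩ := ih (by omega)
      have i1 := h.inz hn (k := k) (by omega)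
      have i2 := h.inz (n := n+1) (k := k) (by omega) (by omega)
      have i3 := h.inz (n := n+2) (k := k) (by omega) (by omega)
      have x1 := h.pz (k := k) hn (by omega)
      have x2 := h.pz (n := n+1) (k := k) (by omega) (by omega)
      have s1 := h.pzs (k := k) hn (by omega)
      have c1' := (h.pz (k := k+1) hn (by omega)).2
      have n1 := h.Nd (k := k) hn (by omega)
      have n2 := h.Nd (n := n+1) (k := k) (by omega) (by omega)
      have u1 := (h.Xup hn (t := T - k) (by omega)).1
      rw [← hT, show T - (T - k) = k by omega] at u1
      have u2 := (h.Xup (n := n+1) (t := T + 1 - k) (by omega) (by omega)).1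
      rw [show n + 1 - D.qp - (T + 1 - k) = k by omega, show T + 1 - k = (T - k) + 1 by omega,
        pow_succ] at u2
      set p := ((43:ℝ)/10)⁻¹^(T-k) with hp
      have p0 : 0 < p := by positivity
      set ε := E0 * p with hε
      have ε0 : 0 ≤ ε := by positivity
      have ε1 : ε ≤ 1 := by
        refine le_trans ?_ hE
        exact mul_le_mul_of_nonneg_left (pow_le_pow_of_le_one (by norm_num) (by norm_num) (by omega)) E00
      have q1 : N (fk k (FB.z n) - fk k (FB.z (n+1))) ≤ 12 * D.θ * p := by linarith
      have q2 : N (fk k (FB.z (n+2)) - fk k (FB.z (n+1))) ≤ 12 * D.θ * p := by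
        rw [N_subc]
        have : D.θ * p * (43/10)⁻¹ ≤ D.θ * p := by
          have : 0 < D.θ * p := by positivity
          norm_num; linarith
        have e2 : 2 * D.θ * (p * (43/10)⁻¹) = 2 * (D.θ * p * (43/10)⁻¹) := by ring
        rw [e2] at u2
        show N (fk k (FB.z (n+1)) - fk k (FB.z (n+1+1))) ≤ _
        linarith
      have z0 : N (fk k (FB.z (n+1)) - fk k (FB.z (n+1))) ≤ 12 * D.θ * p := by
        rw [sub_self, N_zero]; positivity
      have k1 := hK k _ i2.con (h.near i2) _ _ i2.con (h.near i2) i1.con (h.near i1) _ z0 q1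
      have k2 := hK k _ i2.con (h.near i2) _ _ i3.con (h.near i3) i2.con (h.near i2) _ q2 z0
      rw [← fk_succ, ← fk_succ] at k1 k2
      have kp : 0 ≤ K * (12 * D.θ * p) := by positivity
      have m1 := mul_le_mul_of_nonneg_left n1 kp
      have m2 := mul_le_mul_of_nonneg_left n2 kp
      have eE : ε = 6 * (K * (12 * D.θ * p)) := by rw [hε, hE0]; ring
      have E1 : N (w1 (k+1) - DR (fk k (FB.z (n+1))) (w1 k)) ≤ ε * ell (w1 k) := by
        rw [l1, eE]; refine k1.trans ?_; linarith
      have E2 : N (w2 (k+1) - DR (fk k (FB.z (n+1))) (w2 k)) ≤ ε * ell (w2 k) := by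
        rw [l2, eE]
        have : w2 (k+1) - DR (fk k (FB.z (n+1))) (w2 k) = C β * (fk (k+1) (FB.z (n+1)) -
          fk (k+1) (FB.z (n+2)) - DR (fk k (FB.z (n+1))) (fk k (FB.z (n+1)) - fk k (FB.z (n+2)))) := by
          rw [hw2]; simp only; rw [DR_C_mul]; ring
        rw [this, N_C_mul, abs_of_pos β0]
        have m3 := mul_le_mul_of_nonneg_left (k2.trans m2) β0.le
        refine m3.trans (le_of_eq ?_)
        ring
      obtain ⟨A, B⟩ := dist_step (h.nd (k+1)) (fun ξ a b => (h.stg k).tan (h.nd (k+1)) i2.con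
        (h.near' i2) a b) (i1.con.sub i2.con) (by
          have := i2.con.sub i3.con
          unfold Tan at *; rw [hw2]; simp only; rw [eval_mul, this, mul_zero])
        (w1 := w1 k) (w2 := w2 k) (w1' := w1 (k+1)) (w2' := w2 (k+1)) x1.1
        (by rw [l2]; exact mul_pos β0 x2.1) s1.1 c1' E1 E2 ε0
      have e4 : E0 * ((43:ℝ)/10)⁻¹^(T - (k+1)) = 43/10 * ε := by
        rw [hε, hp, show T - k = (T - (k+1)) + 1 by omega, pow_succ]; ring
      rw [e4]
      have r2 := abs_le.1 r1
      have r3 : ell (w2 k) / ell (w1 k) ≤ 2 := by linarith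
      have r4 := mul_le_mul_of_nonneg_left r3 ε0
      constructor
      · have := abs_sub_le (ell (w2 (k+1)) / ell (w1 (k+1))) (ell (w2 k) / ell (w1 k)) 1
        linarith
      · linarith
  have fin := (claim (T - t) le_rfl).1
  rw [show T - (T - t) = t by omega, l1, l2, hβ] at fin
  refine le_trans (le_of_eq ?_) fin
  congr 2
  have := (h.pz (n := n) (k := T - t) hn (by omega)).1
  have : FB.z (n+1) - FB.z (n+2) ≠ 0 := by linarith
  field_simp

theorem H2 (h : D.Ok) {n : ℕ} (hn : D.m + D.qp ≤ n) : ∀ j, D.m + j ≤ n - D.qp →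
    |ell (fk (D.m + j + 1) (FB.z (n+1)) - fk (D.m + j) (FB.z n))| ≤ 560 * D.θ * (62/100)^j := by
  have t0 := h.θ0
  set e : ℕ → ℝ[X] := fun k => fk (k+1) (FB.z (n+1)) - fk k (FB.z n) with he
  set x : ℕ → ℝ := fun k => ell (e k) with hx
  set y : ℕ → ℝ := fun k => N (e k - C (x k) * D.us) with hy
  have nn : ∀ k, D.m ≤ k → k ≤ n - D.qp → Con (fk k (FB.z n)) ∧ N (fk k (FB.z n) - D.Fs) ≤ 8 * D.θ ∧
      Con (fk (k+1) (FB.z (n+1))) ∧ N (fk (k+1) (FB.z (n+1)) - D.Fs) ≤ 8 * D.θ := by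
    intro k k1 k2
    have i1 := h.inz hn (k := k) (by omega)
    have i2 := h.inz (n := n+1) (k := k+1) (by omega) (by omega)
    have n1 := h.near i1
    have n2 := h.near i2
    rw [(h.tail k k1).1] at n1
    rw [(h.tail (k+1) (by omega)).1] at n2
    exact ⟨i1.con, n1, i2.con, n2⟩
  have st : ∀ k, D.m ≤ k → k ≤ n - D.qp →
      |x (k+1) - D.lam k * x k| ≤ D.av k * |x k| + 1/40 * y k ∧
      y (k+1) ≤ 1/500 * |x k| + 3/5 * y k := by
    intro k k1 k2
    obtain ⟨a1, a2, a3, a4⟩ := nn k k1 k2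
    have S := h.stg k
    rw [(h.tail k k1).1, (h.tail k k1).2, (h.tail (k+1) (by omega)).1,
      (h.tail (k+1) (by omega)).2] at S
    have p := S.px _ _ a1 a2 a3 a4
    have q := S.py _ _ a1 a2 a3 a4
    rw [← fk_succ, ← fk_succ] at p q
    exact ⟨p, q⟩
  have nc : ∀ t, t + D.m ≤ n - D.qp → ¬ (x (n - D.qp - t) ≠ 0 ∧
      y (n - D.qp - t) ≤ 1/10 * |x (n - D.qp - t)|) := by
    intro t
    induction t with
    | zero =>
      intro ht hc
      rw [Nat.sub_zero] at hc
      set T := n - D.qp with hT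
      have hm : D.m ≤ T := by omega
      have i1 := h.inz hn (k := T) (by omega)
      have i2 := h.inz (n := n+1) (k := T+1) (by omega) (by omega)
      have zt := h.ztop hm
      rw [show T + D.qp = n by omega] at zt
      have zt2 := h.ztop (k := T+1) (by omega)
      rw [show T + 1 + D.qp = n + 1 by omega] at zt2
      have c1 := h.xcp hm D.θp (FB.z n)
      have c2 := h.xcp (k := T+1) (by omega) D.θp (FB.z (n+1))
      have w0 := h.w0
      refine h.endP.pair (fk T (FB.z n)) (fk (T+1) (FB.z (n+1))) i1.con ?_ ?_ i2.con ?_ ?_ hc.1 hc.2 ?_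
      · rw [c1.1, abs_le]; exact ⟨by linarith, by linarith [i1.hi]⟩
      · rw [c1.2]; exact i1.y
      · rw [c2.1, abs_le]; exact ⟨by linarith, by linarith [i2.hi]⟩
      · rw [c2.2]; exact i2.y
      · have v : ∀ N k, k + D.qp = N → sv (Rp^[D.qp] (fk k (FB.z N))) = 0 := by
          intro N k hk
          have := FB.z_Zer N
          rw [← toF_fc] at this
          have := Zer_iter this
          rw [← hk, add_comm k, Function.iterate_add_apply, add_comm D.qp, hk] at this
          exact this
        rw [v (n+1) (T+1) (by omega), v n T (by omega)]
    | succ t ih =>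
      intro ht hc
      refine ih (by omega) ?_
      have s := st (n - D.qp - (t+1)) (by omega) (by omega)
      rw [show n - D.qp - (t+1) + 1 = n - D.qp - t by omega] at s
      set k := n - D.qp - (t+1)
      have x0 := abs_pos.2 hc.1
      have l0 : 0 ≤ D.lam k := by linarith [h.l1 k, h.a0 k]
      have g : 43/10 * |x k| ≤ |x (n - D.qp - t)| := by
        have := abs_sub_abs_le_abs_sub (D.lam k * x k) (x (n - D.qp - t))
        rw [abs_sub_comm, abs_mul, abs_of_nonneg l0] at this
        have := mul_le_mul_of_nonneg_right (h.l1 k) x0.le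
        linarith [s.1, hc.2]
      exact ⟨abs_pos.1 (by linarith), by linarith [s.2, hc.2]⟩
  have y0 : ∀ k, 0 ≤ y k := fun k => N_nonneg _
  have nc' : ∀ k, D.m ≤ k → k ≤ n - D.qp → |x k| ≤ 10 * y k := by
    intro k k1 k2
    have := nc (n - D.qp - k) (by omega)
    rw [show n - D.qp - (n - D.qp - k) = k by omega] at this
    by_cases hx0 : x k = 0
    · rw [hx0, abs_zero]; linarith [y0 k]
    · by_contra hh
      exact this ⟨hx0, by linarith⟩
  have yb : ∀ j, D.m + j ≤ n - D.qp → y (D.m + j) ≤ 56 * D.θ * (62/100)^j := by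
    intro j
    induction j with
    | zero =>
      intro hj
      obtain ⟨_, a2, _, a4⟩ := nn D.m le_rfl hj
      have nd := h.nd D.m
      rw [(h.tail D.m le_rfl).2] at nd
      have := proj_le nd (e D.m)
      have t := N_sub (fk (D.m+1) (FB.z (n+1)) - D.Fs) (fk D.m (FB.z n) - D.Fs)
      rw [sub_sub_sub_cancel_right] at t
      simp only [add_zero, pow_zero, mul_one]
      show N (e D.m - C (ell (e D.m)) * D.us) ≤ _
      have t' : N (e D.m) ≤ 16 * D.θ := by rw [he]; simp only; linarith
      linarith
    | succ j ih =>
      intro hj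
      have i := ih (by omega)
      have s := (st (D.m + j) (by omega) (by omega)).2
      have c := nc' (D.m + j) (by omega) (by omega)
      rw [pow_succ]
      show y (D.m + j + 1) ≤ _
      linarith
  intro j hj
  have a := nc' (D.m + j) (by omega) hj
  have b := yb j hj
  show |x (D.m + j)| ≤ _
  linarith

theorem final (h : D.Ok) : ∃ lam b : ℝ, 1 < lam ∧ 0 < b ∧
    Tendsto (fun n : ℕ => lam^n * (FB.z n - feigenbaumValue)) atTop (𝓝 b) := by
  obtain ⟨E0, E00, hE⟩ := h.H1
  have t0 := h.θ0
  have p0 := h.θp0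
  set A := 1120 * D.θ * (62/100:ℝ)⁻¹^D.m * (49/10) / (D.θp/4) with hA
  have A0 : 0 < A := by positivity
  set C1 := 4 * E0 + A with hC1
  refine seqlim (C := 10 * (C1 * (84/100:ℝ)⁻¹^D.qp)) (η := 84/100) FB.z_anti h.zlim (by norm_num)
    (by norm_num) ?_
  have small : Tendsto (fun n : ℕ => C1 * (84/100:ℝ)⁻¹^D.qp * (84/100)^n) atTop (𝓝 0) := by
    simpa using (tendsto_pow_atTop_nhds_zero_of_lt_one (by norm_num : (0:ℝ) ≤ 84/100)
      (by norm_num)).const_mul (C1 * (84/100:ℝ)⁻¹^D.qp)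
  filter_upwards [small.eventually_le_const (show (0:ℝ) < 1/4 by norm_num),
    eventually_ge_atTop (2 * D.m + 16 + D.qp)] with n hs hn
  obtain ⟨t, ht, ht8, e1, e2⟩ := etaT (n - D.qp)
  set T := n - D.qp with hT
  have eT : (84/100:ℝ)⁻¹^D.qp * (84/100)^n = (84/100)^T := by
    rw [show n = D.qp + T by omega, pow_add, ← mul_assoc, ← mul_pow]; norm_num
  set δ := C1 * (84/100:ℝ)^T with hδ
  have eδ : C1 * (84/100:ℝ)⁻¹^D.qp * (84/100)^n = δ := by rw [mul_assoc, eT]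
  rw [eδ] at hs
  have pT : (0:ℝ) < (84/100)^T := by positivity
  have d1 : E0 * ((43:ℝ)/10)⁻¹^t ≤ δ := by
    have := mul_le_mul_of_nonneg_left e1 E00
    rw [hδ, hC1]; nlinarith
  have htm : t + D.m ≤ T := by
    by_contra hc
    have h1 : T - t < D.m := by omega
    have : (62/100:ℝ)^(T-t) * (49/10)^t ≤ (84/100)^T := e2
    have h2 : (62/100:ℝ)^D.m ≤ (62/100)^(T-t) :=
      pow_le_pow_of_le_one (by norm_num) (by norm_num) h1.le
    have h3 : (62/100:ℝ)^t * (49/10)^t = (3038/1000)^t := by rw [← mul_pow]; norm_num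
    have h4 : (1:ℝ) ≤ (3038/1000)^t := one_le_pow₀ (by norm_num)
    have h5 : (62/100:ℝ)^t ≤ (62/100)^(T-t) :=
      pow_le_pow_of_le_one (by norm_num) (by norm_num) (by omega)
    have h6 : (0:ℝ) < (49/10)^t := by positivity
    have h7 : (84/100:ℝ)^T < 1 := pow_lt_one₀ (by norm_num) (by norm_num) (by omega)
    have h8 := mul_le_mul_of_nonneg_right h5 h6.le
    linarith
  have sh : ∀ N, n ≤ N → N ≤ n + 1 → |Xnk (N+1) (T - t + 1) / Xnk N (T - t) - 1| ≤ δ := by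
    intro N hN hN'
    have xp := (h.pz (n := N) (k := T - t) (by omega) (by omega)).1
    have b1 := h.H2 (n := N) (by omega) (T - t - D.m) (by omega)
    have b2 := h.H2 (n := N+1) (by omega) (T - t - D.m) (by omega)
    rw [show D.m + (T - t - D.m) = T - t by omega] at b1 b2
    rw [div_sub_one xp.ne', abs_div, abs_of_pos xp, div_le_iff₀ xp]
    have id : Xnk (N+1) (T-t+1) - Xnk N (T-t) =
        ell (fk (T-t+1) (FB.z (N+1)) - fk (T-t) (FB.z N)) -
        ell (fk (T-t+1) (FB.z (N+1+1)) - fk (T-t) (FB.z (N+1))) := by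
      unfold Xnk dl; rw [← ell_sub, ← ell_sub]; congr 1; ring
    rw [id]
    have b3 := abs_sub (ell (fk (T-t+1) (FB.z (N+1)) - fk (T-t) (FB.z N)))
      (ell (fk (T-t+1) (FB.z (N+1+1)) - fk (T-t) (FB.z (N+1))))
    have lowX : D.θp/4 ≤ (49/10)^(t+1) * Xnk N (T - t) := by
      have l1 := (h.Xup (n := N) (t := t + (N - n)) (by omega) (by omega)).2
      rw [show N - D.qp - (t + (N - n)) = T - t by omega] at l1
      refine l1.trans (mul_le_mul_of_nonneg_right ?_ xp.le)
      exact pow_le_pow_right₀ (by norm_num) (by omega)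
    have pm : (62/100:ℝ)^(T - t - D.m) = (62/100)⁻¹^D.m * (62/100)^(T-t) := by
      rw [show (62/100:ℝ)^(T-t) = (62/100)^D.m * (62/100)^(T-t-D.m) by
        rw [← pow_add]; congr 1; omega, ← mul_assoc, ← mul_pow]; norm_num
    rw [pm] at b1 b2
    set G := 1120 * D.θ * (62/100:ℝ)⁻¹^D.m with hG
    have G0 : 0 < G := by positivity
    have g1 : G * (62/100)^(T-t) ≤ A * (84/100)^T * Xnk N (T-t) := by
      have p49 : (0:ℝ) < (49/10)^t := by positivity
      have s1 : A * (D.θp/4) = G * (49/10) := by rw [hA]; field_simp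
      have s2 := mul_le_mul_of_nonneg_left lowX A0.le
      rw [s1, pow_succ] at s2
      have s3 : G ≤ A * (49/10)^t * Xnk N (T-t) := by linarith
      have s4 := mul_le_mul_of_nonneg_right s3 (show (0:ℝ) ≤ (62/100)^(T-t) by positivity)
      have s5 := mul_le_mul_of_nonneg_left e2 (show 0 ≤ A * Xnk N (T-t) by positivity)
      linarith
    have g2 : A * (84/100)^T * Xnk N (T-t) ≤ δ * Xnk N (T-t) := by
      refine mul_le_mul_of_nonneg_right ?_ xp.le
      rw [hδ, hC1]; nlinarith
    have g3 : (560 * D.θ * ((62/100)⁻¹^D.m * (62/100:ℝ)^(T-t))) * 2 = G * (62/100)^(T-t) := by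
      rw [hG]; ring
    linarith
  have r1 := (hE n t (by omega) (by omega) (by linarith)).trans d1
  have r2 := (hE (n+1) t (by omega) (by omega) (by linarith)).trans d1
  rw [← hT] at r1
  rw [show n + 1 - D.qp - t = T - t + 1 by omega] at r2
  have u1 := sh n le_rfl (by omega)
  have u2 := sh (n+1) (by omega) le_rfl
  have R := ratio r2 u1 r1 u2 hs
  have xa := (h.pz (n := n) (k := T - t) (by omega) (by omega)).1
  have xb := (h.pz (n := n+1) (k := T - t) (by omega) (by omega)).1
  have xc' := (h.pz (n := n+1) (k := T - t + 1) (by omega) (by omega)).1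
  have xd := (h.pz (n := n+2) (k := T - t + 1) (by omega) (by omega)).1
  have s0 : 0 < FB.z n - FB.z (n+1) := sub_pos.2 (FB.z_lt n)
  have s1 : 0 < FB.z (n+1) - FB.z (n+2) := sub_pos.2 (FB.z_lt (n+1))
  have s2 : 0 < FB.z (n+2) - FB.z (n+3) := sub_pos.2 (FB.z_lt (n+2))
  have e : 10 * (C1 * (84/100:ℝ)⁻¹^D.qp) * (84/100)^n = 10 * δ := by rw [← eδ]; ring
  rw [e]
  refine le_trans (le_of_eq ?_) R
  congr 2
  show _ = Xnk (n+2) (T-t+1) * (FB.z (n+1) - FB.z (n+2)) / (Xnk (n+1) (T-t+1) *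
    (FB.z (n+2) - FB.z (n+3))) * (Xnk (n+1) (T-t+1) / Xnk n (T-t)) /
    (Xnk (n+1) (T-t) * (FB.z n - FB.z (n+1)) / (Xnk n (T-t) * (FB.z (n+1) - FB.z (n+2))) *
    (Xnk (n+2) (T-t+1) / Xnk (n+1) (T-t)))
  generalize Xnk n (T-t) = a at *
  generalize Xnk (n+1) (T-t) = b at *
  generalize Xnk (n+1) (T-t+1) = c at *
  generalize Xnk (n+2) (T-t+1) = d at *
  field_simp

end Dat.Ok
end FC

namespace FC
open Polynomial

def BK : ℕ := Nat.pow 2 384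
def SS : ℕ := Nat.pow 2 160
def hK : ℕ := Nat.pow 2 383
def hS : ℕ := Nat.pow 2 223
def P24 : ℕ := Nat.pow 2 24
def BN : ℕ := Nat.pow 2 9216
def rpt (c m : ℕ) : ℕ := Nat.rec 0 (fun _ ih => Nat.add c (Nat.mul BK ih)) m
def bi2 : ℕ := rpt hK 48
def biK : ℕ := rpt hK 24
def bi1 : ℕ := rpt hS 24

structure Ba where
  z : ℤ
  M : ℕ
  r : ℕ

def frc {α : Type} (n : ℕ) (k : ℕ → α) : α := Nat.rec (k 0) (fun m _ => k (Nat.succ m)) n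
def ifrc {α : Type} (z : ℤ) (k : ℤ → α) : α :=
  match z with
  | Int.ofNat n => frc n fun n => k (Int.ofNat n)
  | Int.negSucc n => frc n fun n => k (Int.negSucc n)
def bfrc {α : Type} (b : Ba) (k : Ba → α) : α :=
  match b with
  | ⟨z, M, r⟩ => ifrc z fun z => frc M fun M => frc r fun r => k ⟨z, M, r⟩

theorem frc_eq {α : Type} (n : ℕ) (k : ℕ → α) : frc n k = k n := by cases n <;> rfl
theorem ifrc_eq {α : Type} (z : ℤ) (k : ℤ → α) : ifrc z k = k z := by
  cases z <;> simp only [ifrc, frc_eq]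
theorem bfrc_eq {α : Type} (b : Ba) (k : Ba → α) : bfrc b k = k b := by
  cases b; simp only [bfrc, ifrc_eq, frc_eq]

def rnZ (m : ℕ) : ℕ → ℕ := Nat.rec (fun _ => 0)
  (fun _ ih u => Nat.add (Nat.div (Nat.mod u BK) SS) (Nat.mul BK (ih (Nat.div u BK)))) m
def adf (a b : ℕ) : ℕ := Nat.add (Nat.sub a b) (Nat.sub b a)
def nmZ (c : ℕ) (m : ℕ) : ℕ → ℕ := Nat.rec (fun _ => 0)
  (fun _ ih u => Nat.add (adf (Nat.mod u BK) c) (Nat.mul 2 (ih (Nat.div u BK)))) m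

theorem rnZ_succ (m u : ℕ) : rnZ (m+1) u = (u % BK) / SS + BK * rnZ m (u / BK) := rfl
theorem nmZ_succ (c m u : ℕ) : nmZ c (m+1) u = adf (u % BK) c + 2 * nmZ c m (u / BK) := rfl
theorem rpt_succ (c m : ℕ) : rpt c (m+1) = c + BK * rpt c m := rfl
theorem adf_cast (a b : ℕ) : ((adf a b : ℕ) : ℝ) = |(a:ℝ) - b| := by
  unfold adf
  change ((a - b + (b - a) : ℕ) : ℝ) = _
  rcases le_total a b with h | h
  · rw [Nat.sub_eq_zero_of_le h, zero_add, Nat.cast_sub h, abs_sub_comm, abs_of_nonneg]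
    exact sub_nonneg.2 (by exact_mod_cast h)
  · rw [Nat.sub_eq_zero_of_le h, add_zero, Nat.cast_sub h, abs_of_nonneg]
    exact sub_nonneg.2 (by exact_mod_cast h)

theorem BKpos : 0 < BK := by decide +kernel
theorem SSpos : 0 < SS := by decide +kernel
theorem BK2 : BK = 2 * hK := by decide +kernel
theorem hKS : hK = SS * hS := by decide +kernel
theorem BN_eq : BN = BK ^ 24 := by decide +kernel
theorem SSr : (0:ℝ) < SS := by exact_mod_cast SSpos
theorem P24r : (P24 : ℝ) = 2 ^ 24 := by norm_num [P24]
attribute [irreducible] BK SS hK hS BN P24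

def pk (a : ℕ → ℕ) (m : ℕ) : ℕ := ∑ i ∈ Finset.range m, a i * BK ^ i

theorem pk_succ (a : ℕ → ℕ) (m : ℕ) : pk a (m+1) = a 0 + BK * pk (fun i => a (i+1)) m := by
  unfold pk
  rw [Finset.sum_range_succ', add_comm, Finset.mul_sum]
  congr 1
  · simp
  · exact Finset.sum_congr rfl fun i _ => by ring

theorem rpt_eq (c m : ℕ) : rpt c m = pk (fun _ => c) m := by
  induction m with
  | zero => rfl
  | succ m ih => rw [rpt_succ, pk_succ, ih]

theorem pk_mod {a : ℕ → ℕ} (h : ∀ i, a i < BK) (m t : ℕ) :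
    (pk a (m+1) + BK ^ (m+1) * t) % BK = a 0 ∧
    (pk a (m+1) + BK ^ (m+1) * t) / BK = pk (fun i => a (i+1)) m + BK ^ m * t := by
  have e : pk a (m+1) + BK ^ (m+1) * t = a 0 + BK * (pk (fun i => a (i+1)) m + BK ^ m * t) := by
    rw [pk_succ]; ring
  rw [e]
  constructor
  · rw [Nat.add_mul_mod_self_left, Nat.mod_eq_of_lt (h 0)]
  · rw [Nat.add_mul_div_left _ _ BKpos, Nat.div_eq_of_lt (h 0), zero_add]

theorem rnZ_pk (m : ℕ) : ∀ {a : ℕ → ℕ} (_ : ∀ i, a i < BK) (t : ℕ),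
    rnZ m (pk a m + BK ^ m * t) = pk (fun i => a i / SS) m := by
  induction m with
  | zero => intro a _ t; rfl
  | succ m ih =>
    intro a h t
    rw [rnZ_succ, (pk_mod h m t).1, (pk_mod h m t).2, ih (fun i => h (i+1)), pk_succ]

theorem nmZ_pk (c m : ℕ) : ∀ {a : ℕ → ℕ} (_ : ∀ i, a i < BK) (t : ℕ),
    (nmZ c m (pk a m + BK ^ m * t) : ℝ) = ∑ i ∈ Finset.range m, |(a i : ℝ) - c| * 2 ^ i := by
  induction m with
  | zero => intro a _ t; simp [nmZ]
  | succ m ih =>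
    intro a h t
    rw [nmZ_succ, (pk_mod h m t).1, (pk_mod h m t).2, Nat.cast_add, adf_cast, Nat.cast_mul,
      ih (fun i => h (i+1)), Finset.sum_range_succ', add_comm, Finset.mul_sum]
    congr 1
    · exact Finset.sum_congr rfl fun i _ => by push_cast; ring
    · simp

noncomputable def toR (d : ℤ[X]) : ℝ[X] := d.map (Int.castRingHom ℝ)

theorem toR_coeff (d : ℤ[X]) (i : ℕ) : (toR d).coeff i = (d.coeff i : ℝ) := by
  unfold toR; rw [coeff_map]; rfl
theorem toR_deg {d : ℤ[X]} {m : ℕ} (h : d.natDegree < m) : (toR d).natDegree < m :=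
  natDegree_map_le.trans_lt h
theorem toR_add (d e : ℤ[X]) : toR (d + e) = toR d + toR e := Polynomial.map_add _
theorem toR_sub (d e : ℤ[X]) : toR (d - e) = toR d - toR e := Polynomial.map_sub _
theorem toR_mul (d e : ℤ[X]) : toR (d * e) = toR d * toR e := Polynomial.map_mul _
theorem toR_C (c : ℤ) : toR (C c) = C (c:ℝ) := by unfold toR; rw [map_C]; rfl
theorem toR_X : toR X = X := map_X _

noncomputable def qp (c : ℕ → ℤ) (m : ℕ) : ℤ[X] := ∑ i ∈ Finset.range m, C (c i) * X ^ i

theorem qp_coeff (c : ℕ → ℤ) (m i : ℕ) : (qp c m).coeff i = if i < m then c i else 0 := by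
  unfold qp
  simp only [finsetSum_coeff, coeff_C_mul, coeff_X_pow, mul_ite, mul_one, mul_zero]
  rw [Finset.sum_ite_eq]
  simp

theorem qp_deg (c : ℕ → ℤ) {m : ℕ} (h : 0 < m) : (qp c m).natDegree < m := by
  refine (natDegree_le_iff_coeff_eq_zero.2 fun i hi => ?_ : _ ≤ m - 1).trans_lt (by omega)
  rw [qp_coeff, if_neg (by omega)]

theorem coeff_le (p : ℝ[X]) (i : ℕ) : |p.coeff i| * 2 ^ i ≤ N p := by
  have h := N_eq_range p (n := max (p.natDegree+1) (i+1)) (by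
    exact (Nat.lt_succ_self _).trans_le (le_max_left _ _))
  rw [h]
  exact Finset.single_le_sum (f := fun i => |p.coeff i| * (2:ℝ) ^ i) (fun j _ => by positivity)
    (Finset.mem_range.2 ((Nat.lt_succ_self _).trans_le (le_max_right _ _)))

theorem coeff_le' (p : ℝ[X]) (i : ℕ) : |p.coeff i| ≤ N p :=
  (le_mul_of_one_le_right (abs_nonneg _) (one_le_pow₀ (by norm_num))).trans (coeff_le p i)

def dg (e : ℤ[X]) (i : ℕ) : ℕ := (e.coeff i + hK).toNat

theorem dg_spec {e : ℤ[X]} {M : ℕ} (h : N (toR e) ≤ M) (hM : M < hK) (i : ℕ) :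
    ((dg e i : ℕ) : ℤ) = e.coeff i + hK ∧ dg e i < BK := by
  have h1 : |e.coeff i| ≤ (M:ℤ) := by
    have := (coeff_le' (toR e) i).trans h
    rw [toR_coeff] at this
    exact_mod_cast this
  have h2 := abs_le.1 h1
  have h3 : (M:ℤ) < hK := by exact_mod_cast hM
  have h4 : ((dg e i : ℕ) : ℤ) = e.coeff i + hK := Int.toNat_of_nonneg (by linarith)
  refine ⟨h4, ?_⟩
  have : ((dg e i : ℕ) : ℤ) < (BK : ℕ) := by rw [h4, BK2]; push_cast; linarith
  exact_mod_cast this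

theorem dg_pk {e : ℤ[X]} {M m : ℕ} (h : N (toR e) ≤ M) (hM : M < hK) (hd : e.natDegree < m) :
    (e.eval (BK:ℤ) + (rpt hK m : ℕ)).toNat = pk (dg e) m := by
  have : (e.eval (BK:ℤ) + (rpt hK m : ℕ)) = ((pk (dg e) m : ℕ) : ℤ) := by
    rw [rpt_eq, eval_eq_sum_range' hd]
    unfold pk
    push_cast
    rw [← Finset.sum_add_distrib]
    exact Finset.sum_congr rfl fun i _ => by rw [(dg_spec h hM i).1]; ring
  rw [this]; rfl

theorem pk_split (a : ℕ → ℕ) (m k : ℕ) :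
    pk a (m + k) = pk a m + BK ^ m * pk (fun i => a (m + i)) k := by
  unfold pk
  rw [Finset.sum_range_add, Finset.mul_sum]
  congr 1
  exact Finset.sum_congr rfl fun i _ => by rw [pow_add]; ring

theorem pk_lt {a : ℕ → ℕ} (h : ∀ i, a i < BK) (m : ℕ) : pk a m < BK ^ m := by
  induction m generalizing a with
  | zero => simp [pk]
  | succ m ih =>
    rw [pk_succ, pow_succ]
    have := ih (fun i => h (i+1)); have := h 0
    nlinarith

structure MemD (p : ℝ[X]) (b : Ba) (d : ℤ[X]) : Prop where
  deg : d.natDegree < 24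
  ev : d.eval (BK:ℤ) = b.z
  nm : N (toR d) ≤ b.M
  er : N (C (SS:ℝ) * p - toR d) ≤ b.r
def Mem (p : ℝ[X]) (b : Ba) : Prop := ∃ d, MemD p b d

theorem Mem.bd {p : ℝ[X]} {b : Ba} (h : Mem p b) : SS * N p ≤ b.M + b.r := by
  obtain ⟨d, h⟩ := h
  have := N_add (C (SS:ℝ) * p - toR d) (toR d)
  rw [sub_add_cancel, N_C_mul, abs_of_pos SSr] at this
  linarith [h.nm, h.er]

def addb (a b : Ba) : Ba := ⟨a.z + b.z, a.M + b.M, a.r + b.r⟩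
def subb (a b : Ba) : Ba := ⟨a.z - b.z, a.M + b.M, a.r + b.r⟩
def addc (a : Ba) (c : ℤ) : Ba := ⟨a.z + c, a.M + c.natAbs, a.r⟩
def smul (c : ℤ) (a : Ba) : Ba := ⟨c * a.z, c.natAbs * a.M, c.natAbs * a.r⟩
def cst (c : ℤ) : Ba := ⟨c, c.natAbs, 0⟩

theorem Mem.add {p q : ℝ[X]} {a b : Ba} (h : Mem p a) (h' : Mem q b) : Mem (p + q) (addb a b) := by
  obtain ⟨d, h⟩ := h; obtain ⟨e, h'⟩ := h'
  refine ⟨d + e, (natDegree_add_le _ _).trans_lt (max_lt h.deg h'.deg), ?_, ?_, ?_⟩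
  · rw [eval_add, h.ev, h'.ev]; rfl
  · rw [toR_add]; refine (N_add _ _).trans ?_; simp only [addb]; push_cast; linarith [h.nm, h'.nm]
  · rw [toR_add, show C (SS:ℝ) * (p + q) - (toR d + toR e) =
      (C (SS:ℝ) * p - toR d) + (C (SS:ℝ) * q - toR e) by ring]
    refine (N_add _ _).trans ?_; simp only [addb]; push_cast; linarith [h.er, h'.er]

theorem natAbs_r (c : ℤ) : ((c.natAbs : ℕ) : ℝ) = |(c:ℝ)| := by
  rw [Nat.cast_natAbs]; simp

theorem Mem.smul {p : ℝ[X]} {a : Ba} (c : ℤ) (h : Mem p a) : Mem (C (c:ℝ) * p) (smul c a) := by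
  obtain ⟨d, h⟩ := h
  refine ⟨C c * d, (natDegree_C_mul_le _ _).trans_lt h.deg, ?_, ?_, ?_⟩
  · rw [eval_mul, eval_C, h.ev]; rfl
  · rw [toR_mul, toR_C, N_C_mul]; simp only [FC.smul]; push_cast [natAbs_r]
    exact mul_le_mul_of_nonneg_left h.nm (abs_nonneg _)
  · rw [toR_mul, toR_C, show C (SS:ℝ) * (C (c:ℝ) * p) - C (c:ℝ) * toR d =
      C (c:ℝ) * (C (SS:ℝ) * p - toR d) by ring, N_C_mul]; simp only [FC.smul]; push_cast [natAbs_r]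
    exact mul_le_mul_of_nonneg_left h.er (abs_nonneg _)

theorem Mem.sub {p q : ℝ[X]} {a b : Ba} (h : Mem p a) (h' : Mem q b) : Mem (p - q) (subb a b) := by
  have := h.add (h'.smul (-1))
  rw [show p - q = p + C ((-1 : ℤ):ℝ) * q by push_cast; rw [C_neg, C_1]; ring]
  convert this using 1
  simp [addb, subb, FC.smul, sub_eq_add_neg]

theorem mem_cst (c : ℤ) : Mem (C ((c:ℝ) / SS)) (cst c) := by
  refine ⟨C c, by rw [natDegree_C]; norm_num, eval_C, ?_, ?_⟩
  · rw [toR_C, N_C]; simp [cst]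
  · rw [toR_C, ← C_mul, mul_div_cancel₀ _ SSr.ne', sub_self, N_zero]; simp [cst]

theorem Mem.addc {p : ℝ[X]} {a : Ba} (h : Mem p a) (c : ℤ) :
    Mem (p + C ((c:ℝ) / SS)) (addc a c) := h.add (mem_cst c)

def mulB {α : Type} (a b : Ba) (k : Ba → Option α) : Option α :=
  match Nat.blt (Nat.mul a.M b.M) hK with
  | false => none
  | true =>
    frc (Int.toNat (a.z * b.z + bi2)) fun u =>
    frc (rnZ 24 u) fun v =>
    bfrc ⟨Int.sub (Int.ofNat v) (Int.ofNat bi1), nmZ hS 24 v,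
      Nat.add (Nat.add (Nat.div (Nat.add (Nat.add (Nat.mul a.M b.r) (Nat.mul b.M a.r))
        (Nat.mul a.r b.r)) SS) (Nat.div (Nat.mul (nmZ hK 24 (Nat.div u BN)) P24) SS))
        (Nat.add P24 2)⟩ k

theorem div_lt_r (x : ℕ) : (x:ℝ) / SS ≤ ((x / SS : ℕ) : ℝ) + 1 := by
  rw [div_le_iff₀ SSr]
  have := Nat.div_add_mod x SS
  have h2 := Nat.mod_lt x SSpos
  have : x ≤ (x / SS + 1) * SS := by nlinarith
  exact_mod_cast this

theorem N_qp (c : ℕ → ℤ) {m : ℕ} (h : 0 < m) :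
    N (toR (qp c m)) = ∑ i ∈ Finset.range m, |(c i : ℝ)| * 2 ^ i := by
  rw [N_eq_range _ (toR_deg (qp_deg c h))]
  refine Finset.sum_congr rfl fun i hi => ?_
  rw [toR_coeff, qp_coeff, if_pos (Finset.mem_range.1 hi)]

set_option maxHeartbeats 400000 in
theorem mulB_sound {α : Type} {p q : ℝ[X]} {a b : Ba} (h : Mem p a) (h' : Mem q b)
    {k : Ba → Option α} {x : α} (hk : mulB a b k = some x) :
    ∃ c, Mem (p * q) c ∧ k c = some x := by
  obtain ⟨d, h⟩ := h; obtain ⟨e, h'⟩ := h'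
  unfold mulB at hk
  split at hk
  · simp at hk
  rename_i hlt
  rw [frc_eq, frc_eq, bfrc_eq] at hk
  refine ⟨_, ?_, hk⟩
  have hlt : a.M * b.M < hK := by simpa [Nat.blt_eq] using hlt
  have hN : N (toR (d * e)) ≤ ((a.M * b.M : ℕ) : ℝ) := by
    rw [toR_mul]; push_cast
    exact (N_mul _ _).trans (mul_le_mul h.nm h'.nm (Ww_nonneg pw2 _) (Nat.cast_nonneg _))
  have hdeg : (d * e).natDegree < 24 + 24 := by
    have := h.deg; have := h'.deg; have := natDegree_mul_le (p := d) (q := e); omega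
  have hu : (a.z * b.z + (bi2 : ℕ)).toNat = pk (dg (d * e)) (24 + 24) := by
    rw [← h.ev, ← h'.ev, ← eval_mul]; exact dg_pk hN hlt hdeg
  have hd1 := fun i => (dg_spec hN hlt i).1
  have hd2 := fun i => (dg_spec hN hlt i).2
  rw [hu]
  set D := d * e with hD
  have hs := pk_split (dg D) 24 24
  have hv : rnZ 24 (pk (dg D) (24+24)) = pk (fun i => dg D i / SS) 24 := by
    rw [hs]; exact rnZ_pk 24 hd2 _
  have hd3 : ∀ i, dg D i / SS < BK := fun i => (Nat.div_le_self _ _).trans_lt (hd2 i)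
  have hT : (nmZ hK 24 (pk (dg D) (24+24) / BN) : ℝ) =
      ∑ i ∈ Finset.range 24, |((dg D (24+i) : ℕ):ℝ) - hK| * 2 ^ i := by
    have : pk (dg D) (24+24) / BN = pk (fun i => dg D (24+i)) 24 + BK ^ 24 * 0 := by
      rw [hs, BN_eq, Nat.add_mul_div_left _ _ (pow_pos BKpos _),
        Nat.div_eq_of_lt (pk_lt hd2 24), zero_add, mul_zero, add_zero]
    rw [this]; exact nmZ_pk hK 24 (fun i => hd2 (24+i)) 0
  rw [hv]
  set c' : ℕ → ℤ := fun i => ((dg D i / SS : ℕ) : ℤ) - hS with hc'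
  refine ⟨qp c' 24, qp_deg _ (by norm_num), ?_, ?_, ?_⟩
  · change _ = ((pk _ 24 : ℕ) : ℤ) - ((bi1 : ℕ) : ℤ)
    unfold bi1
    rw [rpt_eq]
    unfold qp pk
    rw [eval_finsetSum]
    push_cast
    rw [← Finset.sum_sub_distrib]
    exact Finset.sum_congr rfl fun i _ => by simp [hc']; ring
  · have := nmZ_pk hS 24 hd3 0
    rw [mul_zero, add_zero] at this
    rw [N_qp _ (by norm_num)]
    refine le_of_eq ?_
    rw [this]
    exact Finset.sum_congr rfl fun i _ => by simp only [hc', Int.cast_sub, Int.cast_natCast]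
  · have e1 : C (SS:ℝ) * (p * q) - toR (qp c' 24) = C (1/(SS:ℝ)) *
      ((C (SS:ℝ) * p - toR d) * (C (SS:ℝ) * q - toR e) + (C (SS:ℝ) * p - toR d) * toR e
        + toR d * (C (SS:ℝ) * q - toR e)
        + (toR D - C (SS:ℝ) * toR (qp c' 24))) := by
      have : C (1/(SS:ℝ)) * C (SS:ℝ) = 1 := by
        rw [← C_mul, one_div_mul_cancel SSr.ne', C_1]
      rw [hD, toR_mul]
      linear_combination (-(C (SS:ℝ) * p * q) + toR (qp c' 24)) * this
    rw [e1, N_C_mul, abs_of_pos (one_div_pos.2 SSr), one_div_mul_eq_div]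
    have e2 : N (toR D - C (SS:ℝ) * toR (qp c' 24)) ≤ SS * P24 +
        (nmZ hK 24 (pk (dg D) (24+24) / BN) : ℝ) * P24 := by
      have hcc : toR D - C (SS:ℝ) * toR (qp c' 24) =
          toR (D - C (SS:ℤ) * qp c' 24) := by
        rw [toR_sub, toR_mul (C (SS:ℤ)), toR_C]; simp only [Int.cast_natCast]
      have hdd : (D - C (SS:ℤ) * qp c' 24).natDegree < 24 + 24 :=
        (natDegree_sub_le _ _).trans_lt (max_lt hdeg ((natDegree_C_mul_le _ _).trans_lt
          ((qp_deg c' (by norm_num)).trans_le (by norm_num))))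
      rw [hcc, N_eq_range _ (toR_deg hdd), Finset.sum_range_add, hT]
      refine add_le_add ?_ ?_
      · have : ∀ i ∈ Finset.range 24, |(toR (D - C (SS:ℤ) * qp c' 24)).coeff i| * 2 ^ i ≤
            (SS:ℝ) * 2 ^ i := fun i hi => by
          refine mul_le_mul_of_nonneg_right ?_ (by positivity)
          rw [toR_coeff, coeff_sub, coeff_C_mul, qp_coeff, if_pos (Finset.mem_range.1 hi)]
          have a1 := Nat.div_add_mod (dg D i) SS
          have a2 := Nat.mod_lt (dg D i) SSpos
          have a3 : D.coeff i - SS * c' i = ((dg D i % SS : ℕ) : ℤ) := by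
            have a4 : ((dg D i : ℕ):ℤ) = SS * ((dg D i / SS : ℕ) : ℤ) + ((dg D i % SS : ℕ) : ℤ) := by
              exact_mod_cast a1.symm
            have a5 := hd1 i
            have a6 : (hK:ℤ) = SS * hS := by exact_mod_cast hKS
            simp only [hc']
            linear_combination a4 - a5 - a6
          rw [a3]
          simp only [Int.cast_natCast, Nat.abs_cast]
          exact_mod_cast a2.le
        refine (Finset.sum_le_sum this).trans ?_
        rw [← Finset.mul_sum]
        refine mul_le_mul_of_nonneg_left ?_ SSr.le
        have : (P24 : ℝ) = 2 ^ 24 := P24r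
        rw [this]; norm_num [Finset.sum_range_succ]
      · refine le_of_eq ?_
        rw [Finset.sum_mul]
        refine Finset.sum_congr rfl fun i _ => ?_
        rw [toR_coeff, coeff_sub, coeff_C_mul, qp_coeff, if_neg (by omega), mul_zero, sub_zero]
        have a5 : ((dg D (24+i) : ℕ) : ℝ) = (D.coeff (24+i) : ℝ) + hK := by exact_mod_cast hd1 (24+i)
        have : (P24 : ℝ) = 2 ^ 24 := P24r
        rw [a5, add_sub_cancel_right, this, pow_add]; ring
    have e3 : N ((C (SS:ℝ) * p - toR d) * (C (SS:ℝ) * q - toR e) + (C (SS:ℝ) * p - toR d) * toR e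
        + toR d * (C (SS:ℝ) * q - toR e)) ≤ a.M * b.r + b.M * a.r + a.r * b.r := by
      have b1 := (N_mul (C (SS:ℝ) * p - toR d) (C (SS:ℝ) * q - toR e)).trans
        (mul_le_mul h.er h'.er (Ww_nonneg pw2 _) (Nat.cast_nonneg _))
      have b2 := (N_mul (C (SS:ℝ) * p - toR d) (toR e)).trans
        (mul_le_mul h.er h'.nm (Ww_nonneg pw2 _) (Nat.cast_nonneg _))
      have b3 := (N_mul (toR d) (C (SS:ℝ) * q - toR e)).trans
        (mul_le_mul h.nm h'.er (Ww_nonneg pw2 _) (Nat.cast_nonneg _))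
      refine (N_add _ _).trans ((add_le_add (N_add _ _) le_rfl).trans ?_)
      linarith
    have e4 := (N_add _ _).trans (add_le_add e3 e2)
    refine (div_le_div_of_nonneg_right e4 SSr.le).trans ?_
    change _ ≤ (((a.M * b.r + b.M * a.r + a.r * b.r) / SS +
      nmZ hK 24 (pk (dg D) (24+24) / BN) * P24 / SS + (P24 + 2) : ℕ) : ℝ)
    have f1 := div_lt_r (a.M * b.r + b.M * a.r + a.r * b.r)
    have f2 := div_lt_r (nmZ hK 24 (pk (dg D) (24+24) / BN) * P24)
    have f3 : (SS:ℝ) * P24 / SS = P24 := mul_div_cancel_left₀ _ SSr.ne'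
    rw [add_div, add_div (_ * _ : ℝ), f3]
    push_cast at f1 f2 ⊢
    linarith
theorem biK_eq : biK = rpt hK 24 := rfl
attribute [irreducible] biK bi1 bi2 rnZ nmZ rpt
end FC

namespace FC
open Polynomial

noncomputable def pl : List ℤ → ℤ[X]
  | [] => 0
  | c :: cs => C c + X * pl cs
noncomputable def Pol (l : List ℤ) : ℝ[X] := C (1 / (SS:ℝ)) * toR (pl l)
def evL (l : List ℤ) : ℤ := List.rec 0 (fun c _ ih => c + (BK:ℤ) * ih) l
def nL' (l : List ℤ) : ℕ := List.rec 0 (fun c _ ih => Int.natAbs c + 2 * ih) l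
def altL (l : List ℤ) : ℤ := List.rec 0 (fun c _ ih => c - ih) l
def elL (as : List ℤ) : List ℤ → ℤ := List.rec (fun _ => 0) (fun a _ ih l => a * l.headD 0 + ih l.tail) as
def elZ (as : List ℤ) : ℕ → ℤ := List.rec (fun _ => 0)
  (fun a _ ih u => a * Int.sub (Int.ofNat (Nat.mod u BK)) (Int.ofNat hK) + ih (Nat.div u BK)) as
def ofl (l : List ℤ) : Ba := ⟨evL l, nL' l, 0⟩

theorem pl_coeff (l : List ℤ) (i : ℕ) : (pl l).coeff i = l.getD i 0 := by
  induction l generalizing i with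
  | nil => simp [pl]
  | cons c cs ih =>
    cases i with
    | zero => simp [pl]
    | succ i => rw [pl, coeff_add, coeff_X_mul, ih, coeff_C_succ, zero_add]; rfl

theorem pl_deg {l : List ℤ} (h : l.length ≤ 24) : (pl l).natDegree < 24 := by
  refine (natDegree_le_iff_coeff_eq_zero.2 fun i hi => ?_ : _ ≤ 23).trans_lt (by omega)
  rw [pl_coeff, List.getD_eq_default _ _ (by omega)]

theorem pl_ev (l : List ℤ) : (pl l).eval (BK:ℤ) = evL l := by
  induction l with
  | nil => simp [pl, evL]
  | cons c cs ih => rw [pl, eval_add, eval_C, eval_mul, eval_X, ih]; rfl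

theorem pl_alt (l : List ℤ) : (pl l).eval (-1) = altL l := by
  induction l with
  | nil => simp [pl, altL]
  | cons c cs ih =>
    rw [pl, eval_add, eval_C, eval_mul, eval_X, ih]
    change c + -1 * altL cs = c - altL cs
    ring

theorem Ww_X_mul (w : ℕ → ℝ) (q : ℝ[X]) : Ww w (X * q) = Ww (fun i => w (i+1)) q := by
  have h1 : (X * q).natDegree < q.natDegree + 1 + 1 := by
    have := natDegree_mul_le (p := X) (q := q); have := natDegree_X_le (R := ℝ); omega
  rw [Ww_eq w _ (supp_subset_range h1), Ww_eq _ q (supp_subset_range (Nat.lt_succ_self _)),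
    Finset.sum_range_succ']
  simp [coeff_X_mul]

theorem Ww_cons {w : ℕ → ℝ} (hw : ∀ i, 0 ≤ w i) (c : ℤ) (cs : List ℤ) :
    Ww w (toR (pl (c :: cs))) ≤ |(c:ℝ)| * w 0 + Ww (fun i => w (i+1)) (toR (pl cs)) := by
  rw [pl, toR_add, toR_mul, toR_C, toR_X]
  refine (Ww_add_le hw _ _).trans ?_
  rw [Ww_X_mul, ← monomial_zero_left, Ww_monomial]

theorem N_pl (l : List ℤ) : N (toR (pl l)) ≤ (nL' l : ℕ) := by
  induction l with
  | nil => rw [pl]; simp [toR, N_zero]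
  | cons c cs ih =>
    refine (Ww_cons pw2 c cs).trans ?_
    have e : Ww (fun i => (2:ℝ) ^ (i+1)) (toR (pl cs)) = 2 * N (toR (pl cs)) := by
      simp only [pow_succ']; rw [Ww_smul_w]; rfl
    rw [e]
    change _ ≤ ((c.natAbs + 2 * nL' cs : ℕ) : ℝ)
    rw [Nat.cast_add, natAbs_r, Nat.cast_mul, pow_zero, mul_one, Nat.cast_ofNat]
    linarith

theorem SSC (p : ℝ[X]) : C (SS:ℝ) * (C (1/(SS:ℝ)) * p) = p := by
  rw [← mul_assoc, ← C_mul, mul_one_div_cancel SSr.ne', C_1, one_mul]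

theorem mem_ofl {l : List ℤ} (h : l.length ≤ 24) : Mem (Pol l) (ofl l) :=
  ⟨pl l, pl_deg h, pl_ev l, N_pl l, by unfold Pol; rw [SSC, sub_self, N_zero]; exact Nat.cast_nonneg _⟩

theorem N_Pol (l : List ℤ) : SS * N (Pol l) ≤ (nL' l : ℕ) := by
  have := N_pl l
  rwa [← SSC (toR (pl l)), N_C_mul, abs_of_pos SSr] at this

theorem Pol_cons (c : ℤ) (cs : List ℤ) : Pol (c :: cs) = C ((c:ℝ)/SS) + X * Pol cs := by
  unfold Pol
  rw [pl, toR_add, toR_mul, toR_C, toR_X, div_eq_mul_one_div (c:ℝ), C_mul (a := (c:ℝ))]; ring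

theorem Pol_nil : Pol [] = 0 := by unfold Pol; simp [pl, toR]

theorem sv_Pol (l : List ℤ) : sv (Pol l) = (l.headD 0 : ℤ) / SS := by
  cases l with
  | nil => simp [Pol_nil, sv]
  | cons c cs => rw [Pol_cons]; simp [sv]

theorem toR_eval (d : ℤ[X]) (x : ℤ) : (toR d).eval (x:ℝ) = (d.eval x : ℤ) := by
  unfold toR; exact (eval_intCast_map _ _ _)

theorem Pol_alt (l : List ℤ) : (Pol l).eval (-1) = (altL l : ℝ) / SS := by
  unfold Pol
  have := toR_eval (pl l) (-1)
  push_cast at this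
  rw [eval_mul, eval_C, this, pl_alt, one_div_mul_eq_div]

theorem con_Pol {l : List ℤ} (h : altL l = SS) : Con (Pol l) := by
  unfold Con; rw [Pol_alt, h]; simp only [Int.cast_natCast]; exact div_self SSr.ne'
theorem tan_Pol {l : List ℤ} (h : altL l = 0) : Tan (Pol l) := by
  unfold Tan; rw [Pol_alt, h]; simp

theorem getD_cons_sum (a : ℤ) (as : List ℤ) (f : ℕ → ℤ) :
    ∑ i ∈ Finset.range (a :: as).length, (a :: as).getD i 0 * f i =
      a * f 0 + ∑ i ∈ Finset.range as.length, as.getD i 0 * f (i+1) := by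
  rw [List.length_cons, Finset.sum_range_succ', add_comm]; rfl

theorem elL_eq (as : List ℤ) : ∀ l : List ℤ, elL as l =
    ∑ i ∈ Finset.range as.length, as.getD i 0 * l.getD i 0 := by
  induction as with
  | nil => intro l; rfl
  | cons a as ih =>
    intro l
    change a * l.headD 0 + elL as l.tail = _
    rw [getD_cons_sum, ih]
    cases l <;> simp

theorem elZ_pk (as : List ℤ) : ∀ {m : ℕ} (_ : as.length ≤ m) {a : ℕ → ℕ} (_ : ∀ i, a i < BK),
    elZ as (pk a m) = ∑ i ∈ Finset.range as.length, as.getD i 0 * ((a i : ℤ) - hK) := by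
  induction as with
  | nil => intro m _ a _; rfl
  | cons c as ih =>
    intro m hm a ha
    obtain ⟨m, rfl⟩ : ∃ n, m = n + 1 := ⟨m - 1, by rw [List.length_cons] at hm; omega⟩
    have h := pk_mod ha m 0
    simp only [mul_zero, add_zero] at h
    change c * (((pk a (m+1) % BK : ℕ) : ℤ) - (hK : ℕ)) + elZ as (pk a (m+1) / BK) = _
    rw [h.1, h.2, ih (by simpa using hm) (fun i => ha (i+1)), getD_cons_sum c as (fun i => (a i : ℤ) - hK)]

theorem ell_toR (d : ℤ[X]) : ell (toR d) * 2 ^ 20 =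
    ((∑ i ∈ Finset.range lwI.length, lwI.getD i 0 * d.coeff i : ℤ) : ℝ) := by
  have : ∑ i ∈ Finset.range lwI.length, lwI.getD i 0 * d.coeff i =
      ∑ i ∈ Finset.range nL, lwI.getD i 0 * d.coeff i :=
    Finset.sum_subset (Finset.range_subset_range.2 lwI_len) fun i _ hi => by
      rw [List.getD_eq_default _ _ (by simpa using hi), zero_mul]
  rw [this]
  unfold ell lw
  push_cast
  rw [Finset.sum_mul]
  exact Finset.sum_congr rfl fun i _ => by rw [toR_coeff]; ring

theorem ell_Pol {l : List ℤ} (h : elL lwI l = 2 ^ 20 * SS) : ell (Pol l) = 1 := by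
  have h1 := ell_toR (pl l)
  simp only [pl_coeff] at h1
  rw [← elL_eq, h] at h1
  push_cast at h1
  have : ell (toR (pl l)) = SS := by linarith
  unfold Pol
  rw [ell_C_mul, this]; exact one_div_mul_cancel SSr.ne'

def gd {α : Type} (b : Bool) (k : Option α) : Option α := match b with
  | true => k
  | false => none
theorem gd_s {α : Type} {b : Bool} {k : Option α} {x : α} (h : gd b k = some x) :
    b = true ∧ k = some x := by
  cases b
  · simp [gd] at h
  · exact ⟨rfl, h⟩

def nrmB {α : Type} (b : Ba) (k : Ba → Option α) : Option α :=
  gd (Nat.blt b.M hK) (bfrc ⟨b.z, nmZ hK 24 (Int.toNat (b.z + biK)), b.r⟩ k)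

theorem MemD.nm_eq {p : ℝ[X]} {b : Ba} {d : ℤ[X]} (h : MemD p b d) (hM : b.M < hK) :
    (nmZ hK 24 (Int.toNat (b.z + biK)) : ℝ) = N (toR d) ∧
    ((elZ lwI (Int.toNat (b.z + biK)) : ℤ) : ℝ) = ell (toR d) * 2 ^ 20 := by
  have e : Int.toNat (b.z + biK) = pk (dg d) 24 := by rw [← h.ev, biK_eq]; exact dg_pk h.nm hM h.deg
  have h2 := fun i => (dg_spec h.nm hM i).2
  have h1 := fun i => (dg_spec h.nm hM i).1
  rw [e]
  constructor
  · have := nmZ_pk hK 24 h2 0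
    rw [mul_zero, add_zero] at this
    rw [this, N_eq_range _ (toR_deg h.deg)]
    refine Finset.sum_congr rfl fun i _ => ?_
    have a5 : ((dg d i : ℕ) : ℝ) = (d.coeff i : ℝ) + hK := by exact_mod_cast h1 i
    rw [a5, toR_coeff, add_sub_cancel_right]
  · rw [ell_toR, elZ_pk lwI (m := 24) lwI_len h2]
    refine congrArg _ (Finset.sum_congr rfl fun i _ => ?_)
    rw [h1 i, add_sub_cancel_right]

attribute [irreducible] elZ elL evL nL' altL
theorem blt_s {a b : ℕ} (h : Nat.blt a b = true) : a < b := by simpa [Nat.blt_eq] using h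

theorem nrmB_s {α : Type} {p : ℝ[X]} {b : Ba} (h : Mem p b) {k : Ba → Option α} {x : α}
    (hk : nrmB b k = some x) : ∃ c, Mem p c ∧ k c = some x := by
  obtain ⟨d, h⟩ := h
  obtain ⟨h1, h2⟩ := gd_s hk
  rw [bfrc_eq] at h2
  refine ⟨_, ⟨d, ?_⟩, h2⟩
  exact ⟨h.deg, h.ev, (h.nm_eq (blt_s h1)).1.ge, h.er⟩

def nl {α : Type} (b : Ba) (k : ℕ → ℤ → Option α) : Option α :=
  gd (Nat.blt b.M hK) (frc (Int.toNat (b.z + biK)) fun u => frc (nmZ hK 24 u) fun m =>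
    ifrc (elZ lwI u) fun e => k m e)

theorem nl_s {α : Type} {p : ℝ[X]} {b : Ba} (h : Mem p b) {k : ℕ → ℤ → Option α} {x : α}
    (hk : nl b k = some x) : ∃ (m : ℕ) (e : ℤ), SS * N p ≤ m + b.r ∧
      SS * |ell p| * 2 ^ 20 ≤ (Int.natAbs e : ℕ) + 2 ^ 19 * (b.r : ℝ) ∧ k m e = some x := by
  obtain ⟨d, h⟩ := h
  obtain ⟨h1, h2⟩ := gd_s hk
  simp only [frc_eq, ifrc_eq] at h2
  obtain ⟨e1, e2⟩ := h.nm_eq (blt_s h1)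
  refine ⟨_, _, ?_, ?_, h2⟩
  · have := N_add (C (SS:ℝ) * p - toR d) (toR d)
    rw [sub_add_cancel, N_C_mul, abs_of_pos SSr] at this
    linarith [h.er]
  · rw [natAbs_r, e2]
    have h3 := ell_le (C (SS:ℝ) * p - toR d)
    rw [ell_sub, ell_C_mul] at h3
    have h4 := h.er
    have h5 : |SS * ell p| ≤ |SS * ell p - ell (toR d)| + |ell (toR d)| := by
      have := abs_add_le (SS * ell p - ell (toR d)) (ell (toR d))
      rwa [sub_add_cancel] at this
    rw [abs_mul, abs_of_pos SSr] at h5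
    rw [abs_mul, abs_of_pos (by positivity : (0:ℝ) < 2 ^ 20)]
    linarith

def hor2 {α : Type} (A : Ba) (l : List ℤ) : (Ba → Ba → Option α) → Option α :=
  List.rec (fun k => k (cst 0) (cst 0)) (fun c _ ih k => ih fun p q =>
    mulB A q fun q' => mulB A p fun p' => bfrc (addc p' c) fun p' => bfrc (addb p q') fun q' =>
    k p' q') l
def hor1 {α : Type} (A : Ba) (l : List ℤ) : (Ba → Option α) → Option α :=
  List.rec (fun k => k (cst 0)) (fun c _ ih k => ih fun p =>
    mulB A p fun p' => bfrc (addc p' c) k) l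

theorem mem_zero : Mem 0 (cst 0) := by simpa using mem_cst 0

theorem hor2_s {α : Type} {a : ℝ[X]} {A : Ba} (h : Mem a A) (l : List ℤ) :
    ∀ {k : Ba → Ba → Option α} {x : α}, hor2 A l k = some x →
    ∃ b d, Mem ((Pol l).comp a) b ∧ Mem ((derivative (Pol l)).comp a) d ∧ k b d = some x := by
  induction l with
  | nil =>
    intro k x hk
    refine ⟨_, _, ?_, ?_, hk⟩ <;> simpa [Pol_nil] using mem_zero
  | cons c cs ih =>
    intro k x hk
    obtain ⟨p, q, hp, hq, hk⟩ := ih hk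
    obtain ⟨q', hq', hk⟩ := mulB_sound h hq hk
    obtain ⟨p', hp', hk⟩ := mulB_sound h hp hk
    simp only [bfrc_eq] at hk
    refine ⟨_, _, ?_, ?_, hk⟩
    · convert hp'.addc c using 1
      rw [Pol_cons]; simp; ring
    · convert hp.add hq' using 1
      rw [Pol_cons]; simp

theorem hor1_s {α : Type} {a : ℝ[X]} {A : Ba} (h : Mem a A) (l : List ℤ) :
    ∀ {k : Ba → Option α} {x : α}, hor1 A l k = some x →
    ∃ b, Mem ((Pol l).comp a) b ∧ k b = some x := by
  induction l with
  | nil =>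
    intro k x hk
    refine ⟨_, ?_, hk⟩; simpa [Pol_nil] using mem_zero
  | cons c cs ih =>
    intro k x hk
    obtain ⟨p, hp, hk⟩ := ih hk
    obtain ⟨p', hp', hk⟩ := mulB_sound h hp hk
    simp only [bfrc_eq] at hk
    refine ⟨_, ?_, hk⟩
    convert hp'.addc c using 1
    rw [Pol_cons]; simp; ring

def wt {α : Type} (a : ℕ) (l : List ℤ) : (ℕ → ℕ → ℕ → Option α) → Option α :=
  List.rec (fun k => k 0 0 0) (fun c _ ih k => ih fun p q t =>
    frc (Int.natAbs c + (a * p / 1024 + 1)) fun p' => frc (p + (a * q / 1024 + 1)) fun q' =>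
    frc (2 * q + (a * t / 1024 + 1)) fun t' => k p' q' t') l

theorem dv_r (x : ℕ) : (x:ℝ) / 1024 ≤ ((x / 1024 + 1 : ℕ) : ℝ) := by
  rw [div_le_iff₀ (by norm_num)]
  have : x ≤ (x / 1024 + 1) * 1024 := by omega
  exact_mod_cast this

theorem wt_s {α : Type} (a : ℕ) (l : List ℤ) : ∀ {k : ℕ → ℕ → ℕ → Option α} {x : α},
    wt a l k = some x → ∃ p q t : ℕ, W (a/1024) (toR (pl l)) ≤ p ∧ W1 (a/1024) (toR (pl l)) ≤ q ∧
      W2 (a/1024) (toR (pl l)) ≤ t ∧ k p q t = some x := by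
  have s0 : (0:ℝ) ≤ a / 1024 := by positivity
  induction l with
  | nil => intro k x hk; refine ⟨0, 0, 0, ?_, ?_, ?_, hk⟩ <;> simp [pl, toR, W, W1, W2, Ww_zero]
  | cons c cs ih =>
    intro k x hk
    obtain ⟨p, q, t, h1, h2, h3, hk⟩ := ih hk
    simp only [frc_eq] at hk
    have n1 := mul_le_mul_of_nonneg_left h1 s0
    have n2 := mul_le_mul_of_nonneg_left h2 s0
    have n3 := mul_le_mul_of_nonneg_left h3 s0
    have d1 := dv_r (a * p); have d2 := dv_r (a * q); have d3 := dv_r (a * t)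
    rw [Nat.cast_mul] at d1 d2 d3
    refine ⟨_, _, _, ?_, ?_, ?_, hk⟩
    · refine (Ww_cons (pw s0) c cs).trans ?_
      have e : Ww (fun i => ((a:ℝ)/1024) ^ (i+1)) (toR (pl cs)) =
          (a:ℝ)/1024 * W (a/1024) (toR (pl cs)) := by
        simp only [pow_succ']; rw [Ww_smul_w]; rfl
      rw [e, Nat.cast_add, natAbs_r, pow_zero, mul_one]
      linarith
    · refine (Ww_cons (pw1 s0) c cs).trans ?_
      have e : Ww (fun i => ((i+1 : ℕ):ℝ) * ((a:ℝ)/1024) ^ (i+1-1)) (toR (pl cs)) =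
          W (a/1024) (toR (pl cs)) + (a:ℝ)/1024 * W1 (a/1024) (toR (pl cs)) := by
        unfold W W1 Ww
        rw [Finset.mul_sum, ← Finset.sum_add_distrib]
        refine Finset.sum_congr rfl fun i _ => ?_
        rcases i with _ | i
        · simp
        · simp only [Nat.add_sub_cancel]; push_cast; ring
      rw [e, Nat.cast_add]
      simp only [Nat.cast_zero, zero_mul, mul_zero]
      linarith
    · refine (Ww_cons (pw22 s0) c cs).trans ?_
      have e : Ww (fun i => ((i+1 : ℕ):ℝ) * ((i+1-1 : ℕ):ℝ) * ((a:ℝ)/1024) ^ (i+1-2)) (toR (pl cs)) =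
          2 * W1 (a/1024) (toR (pl cs)) + (a:ℝ)/1024 * W2 (a/1024) (toR (pl cs)) := by
        unfold W1 W2 Ww
        rw [Finset.mul_sum, Finset.mul_sum, ← Finset.sum_add_distrib]
        refine Finset.sum_congr rfl fun i _ => ?_
        rcases i with _ | _ | i
        · simp
        · simp [mul_comm]
        · simp only [Nat.add_sub_cancel, show i + 1 + 1 + 1 - 2 = i + 1 by omega,
            show i + 1 + 1 - 2 = i by omega]; push_cast; ring
      rw [e, Nat.cast_add, Nat.cast_mul 2 q]
      simp only [Nat.cast_zero, zero_mul, mul_zero, Nat.cast_ofNat]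
      linarith

theorem W1_Pol (σ : ℝ) (l : List ℤ) : SS * W1 σ (Pol l) = W1 σ (toR (pl l)) := by
  unfold Pol W1; rw [Ww_C_mul, abs_of_pos (one_div_pos.2 SSr), ← mul_assoc, mul_one_div_cancel SSr.ne', one_mul]
theorem W2_Pol (σ : ℝ) (l : List ℤ) : SS * W2 σ (Pol l) = W2 σ (toR (pl l)) := by
  unfold Pol W2; rw [Ww_C_mul, abs_of_pos (one_div_pos.2 SSr), ← mul_assoc, mul_one_div_cancel SSr.ne', one_mul]

def lo0 (b : Ba) (m : ℕ) : Bool :=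
  Nat.blt b.M hK && Nat.ble (hK + b.r + m) (Nat.mod (Int.toNat (b.z + biK)) BK)
def up0 (b : Ba) (m : ℕ) : Bool :=
  Nat.blt b.M hK && Nat.ble (Nat.mod (Int.toNat (b.z + biK)) BK + b.r) (hK + m)

theorem dig0 {p : ℝ[X]} {b : Ba} (h : Mem p b) (hM : b.M < hK) :
    |SS * p.eval 0 - ((((Int.toNat (b.z + biK)) % BK : ℕ) : ℝ) - hK)| ≤ b.r := by
  obtain ⟨d, h⟩ := h
  have e : Int.toNat (b.z + biK) = pk (dg d) 24 := by rw [← h.ev, biK_eq]; exact dg_pk h.nm hM h.deg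
  have h2 := fun i => (dg_spec h.nm hM i).2
  have h3 := (pk_mod h2 23 0).1
  rw [mul_zero, add_zero] at h3
  have a5 : ((dg d 0 : ℕ) : ℝ) = (d.coeff 0 : ℝ) + hK := by exact_mod_cast (dg_spec h.nm hM 0).1
  rw [e, h3, a5, add_sub_cancel_right]
  have := (coeff_le' (C (SS:ℝ) * p - toR d) 0).trans h.er
  rwa [coeff_sub, coeff_C_mul, toR_coeff, coeff_zero_eq_eval_zero] at this

theorem lo0_s {p : ℝ[X]} {b : Ba} (h : Mem p b) {m : ℕ} (hk : lo0 b m = true) :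
    (m:ℝ) ≤ SS * p.eval 0 := by
  obtain ⟨h1, h2⟩ := Bool.and_eq_true_iff.1 hk
  have h3 := abs_le.1 (dig0 h (blt_s h1))
  have h4 : ((hK + b.r + m : ℕ) : ℝ) ≤ _ := Nat.cast_le.2 (Nat.le_of_ble_eq_true h2)
  rw [Nat.cast_add, Nat.cast_add] at h4
  change _ ≤ (((Int.toNat (b.z + biK)) % BK : ℕ) : ℝ) at h4
  linarith
theorem up0_s {p : ℝ[X]} {b : Ba} (h : Mem p b) {m : ℕ} (hk : up0 b m = true) :
    SS * p.eval 0 ≤ m := by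
  obtain ⟨h1, h2⟩ := Bool.and_eq_true_iff.1 hk
  have h3 := abs_le.1 (dig0 h (blt_s h1))
  have h4 : _ ≤ ((hK + m : ℕ) : ℝ) := Nat.cast_le.2 (Nat.le_of_ble_eq_true h2)
  rw [Nat.cast_add, Nat.cast_add] at h4
  change (((Int.toNat (b.z + biK)) % BK : ℕ) : ℝ) + _ ≤ _ at h4
  linarith
end FC

namespace FC
open Polynomial

def X1 : Ba := ofl [(SS:ℤ), (SS:ℤ)]
theorem mem_X1 : Mem (1 + X) X1 := by
  have h := mem_ofl (l := [(SS:ℤ), (SS:ℤ)]) (by norm_num)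
  have e : Pol [(SS:ℤ), (SS:ℤ)] = 1 + X := by
    rw [Pol_cons, Pol_cons, Pol_nil, Int.cast_natCast, div_self SSr.ne', C_1]; ring
  rw [e] at h; exact h

noncomputable def PP (F : ℝ[X]) : ℝ[X] := C ((2:ℤ):ℝ) * ((derivative F).comp (Gp F) * Bp F)
noncomputable def ZP (F : ℝ[X]) : ℝ[X] := C (1 / sv F) * (PP F * (C ((2:ℤ):ℝ) *
  ((derivative F).comp (Ap F) * (C (sv F) * (1 + X))))) - C (1 / sv F) * Rp F

theorem DR_eq (F d : ℝ[X]) : DR F d = C (1 / sv F) * (d.comp (Gp F) + PP F * d.comp (Ap F)) +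
    C (sv d) * ZP F := by
  unfold DR DH DG DB DA ZP PP Rp
  have e1 : C (- sv d / (sv F)^2) = - (C (sv d) * C (1 / sv F) * C (1 / sv F)) := by
    rw [← C_mul, ← C_mul, ← C_neg]; congr 1; rw [neg_div, div_eq_mul_inv]; ring
  have e2 : C (2 * sv F * sv d) = C ((2:ℤ):ℝ) * C (sv F) * C (sv d) := by
    rw [← C_mul, ← C_mul]; norm_num
  have e3 : (C ((2:ℤ):ℝ) : ℝ[X]) = 2 := by
    rw [Int.cast_ofNat]; exact map_ofNat C 2
  rw [e1, e2, e3]; generalize C (1 / sv F) = i; generalize C (sv F) = s; generalize C (sv d) = t; ring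

def inv0 (s : ℤ) : Ba :=
  ⟨- ((SS * SS / Int.natAbs s : ℕ) : ℤ), SS * SS / Int.natAbs s, 1⟩

theorem mem_inv0 {s : ℤ} (h : s < 0) : Mem (C (1 / ((s:ℝ)/SS))) (inv0 s) := by
  obtain ⟨n, rfl⟩ : ∃ n : ℕ, s = -(n:ℤ) := ⟨s.natAbs, by omega⟩
  have hn : 0 < n := by omega
  have hn' : (0:ℝ) < n := by exact_mod_cast hn
  refine ⟨C (- ((SS * SS / n : ℕ) : ℤ)), by rw [natDegree_C]; norm_num, ?_, ?_, ?_⟩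
  · rw [eval_C]; simp only [inv0, Int.natAbs_neg, Int.natAbs_natCast]
  · rw [toR_C, N_C]; simp only [inv0, Int.natAbs_neg, Int.natAbs_natCast]
    rw [Int.cast_neg, abs_neg, Int.cast_natCast, Nat.abs_cast]
  · rw [toR_C, ← C_mul, ← C_sub, N_C]
    have h1 := Nat.div_add_mod (SS * SS) n
    have h2 := Nat.mod_lt (SS * SS) hn
    have h3 : (n:ℝ) * ((SS * SS / n : ℕ) : ℝ) + ((SS * SS % n : ℕ) : ℝ) = SS * SS := by
      exact_mod_cast h1
    have h4 : (((SS * SS % n : ℕ) : ℝ)) ≤ n := by exact_mod_cast h2.le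
    have e : (SS:ℝ) * (1 / (((-(n:ℤ) : ℤ) : ℝ) / SS)) - ((-((SS * SS / n : ℕ) : ℤ) : ℤ) : ℝ) =
        - (((SS * SS % n : ℕ) : ℝ) / n) := by
      have : (SS:ℝ) * SS / n = ((SS * SS / n : ℕ) : ℝ) + ((SS * SS % n : ℕ) : ℝ) / n := by
        rw [← h3]; field_simp
      rw [Int.cast_neg, Int.cast_neg, Int.cast_natCast, Int.cast_natCast, one_div_div, div_neg,
        mul_neg, ← mul_div_assoc, this]
      ring
    rw [e, abs_neg, abs_of_nonneg (by positivity)]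
    simp only [inv0, Nat.cast_one]
    exact (div_le_one hn').2 h4

def core {α : Type} (f : List ℤ) (k : Ba → Ba → Ba → Ba → Ba → Ba → Ba → Ba → Option α) : Option α :=
  ifrc (f.headD 0) fun s => gd (Nat.blt 0 (Int.toNat (-s))) <|
  bfrc (inv0 s) fun iB => bfrc X1 fun X1 =>
  mulB (cst s) (cst s) fun ss => mulB ss X1 fun a => nrmB (addc a (-SS)) fun A =>
  hor2 A f fun B dA => nrmB B fun B => mulB B B fun b2 => nrmB (addc b2 (-SS)) fun G =>
  hor2 G f fun H dG => nrmB H fun H => mulB dG B fun p => bfrc (smul 2 p) fun P =>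
  mulB iB H fun RF => mulB (cst s) X1 fun sx => mulB dA sx fun t1 => mulB P (smul 2 t1) fun t2 =>
  mulB iB t2 fun t3 => mulB iB RF fun t4 => nrmB (subb t3 t4) fun Z =>
  k iB A B G H P RF Z

theorem core_s {α : Type} {f : List ℤ} {k : Ba → Ba → Ba → Ba → Ba → Ba → Ba → Ba → Option α} {x : α}
    (hk : core f k = some x) : f.headD 0 < 0 ∧ ∃ iB A B G H P RF Z, Mem (C (1 / sv (Pol f))) iB ∧
      Mem (Ap (Pol f)) A ∧ Mem (Bp (Pol f)) B ∧ Mem (Gp (Pol f)) G ∧ Mem (Hp (Pol f)) H ∧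
      Mem (PP (Pol f)) P ∧ Mem (Rp (Pol f)) RF ∧ Mem (ZP (Pol f)) Z ∧
      k iB A B G H P RF Z = some x := by
  unfold core at hk
  rw [ifrc_eq] at hk
  obtain ⟨h0, hk⟩ := gd_s hk
  have h0 : f.headD 0 < 0 := by have := blt_s h0; omega
  refine ⟨h0, ?_⟩
  simp only [bfrc_eq] at hk
  have hs : Mem (C (sv (Pol f))) (cst (f.headD 0)) := by rw [sv_Pol]; exact mem_cst _
  have hi : Mem (C (1 / sv (Pol f))) (inv0 (f.headD 0)) := by rw [sv_Pol]; exact mem_inv0 h0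
  have one : ∀ p : ℝ[X], p + C (((-SS : ℤ) : ℝ)/SS) = p - 1 := fun p => by
    rw [Int.cast_neg, Int.cast_natCast, neg_div, div_self SSr.ne', C_neg, C_1, sub_eq_add_neg]
  obtain ⟨ss, h1, hk⟩ := mulB_sound hs hs hk
  obtain ⟨a, h2, hk⟩ := mulB_sound h1 mem_X1 hk
  have h2 := h2.addc (-SS)
  rw [one] at h2
  obtain ⟨A, hA, hk⟩ := nrmB_s h2 hk
  change Mem (Ap (Pol f)) A at hA
  obtain ⟨B, dA, hB, hdA, hk⟩ := hor2_s hA f hk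
  obtain ⟨B, hB, hk⟩ := nrmB_s hB hk
  change Mem (Bp (Pol f)) B at hB
  obtain ⟨b2, h3, hk⟩ := mulB_sound hB hB hk
  have h3 := h3.addc (-SS)
  rw [one] at h3
  obtain ⟨G, hG, hk⟩ := nrmB_s h3 hk
  change Mem (Gp (Pol f)) G at hG
  obtain ⟨H, dG, hH, hdG, hk⟩ := hor2_s hG f hk
  obtain ⟨H, hH, hk⟩ := nrmB_s hH hk
  change Mem (Hp (Pol f)) H at hH
  obtain ⟨p, h4, hk⟩ := mulB_sound hdG hB hk
  have hP := h4.smul 2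
  change Mem (PP (Pol f)) _ at hP
  obtain ⟨RF, hR, hk⟩ := mulB_sound hi hH hk
  obtain ⟨sx, h5, hk⟩ := mulB_sound hs mem_X1 hk
  obtain ⟨t1, h6, hk⟩ := mulB_sound hdA h5 hk
  obtain ⟨t2, h7, hk⟩ := mulB_sound hP (h6.smul 2) hk
  obtain ⟨t3, h8, hk⟩ := mulB_sound hi h7 hk
  obtain ⟨t4, h9, hk⟩ := mulB_sound hi hR hk
  obtain ⟨Z, hZ, hk⟩ := nrmB_s (h8.sub h9) hk
  exact ⟨_, A, B, G, H, _, RF, Z, hi, hA, hB, hG, hH, hP, hR, hZ, hk⟩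

def cols {α : Type} (iB P Z A G w : Ba) (lam kap leak : ℕ) (k : Ba → Ba → Option α) (l : List ℤ) :
    ℤ → ℕ → Ba → Ba → Option α :=
  List.rec (fun _ _ Aj Gj => k Aj Gj) (fun c _ ih e pw Aj Gj =>
    mulB Aj A fun Aj => mulB Gj G fun Gj => mulB P (addc Aj (e * SS)) fun t =>
    mulB iB (addb (addc Gj (e * SS)) t) fun t2 =>
    bfrc (subb (smul ((2 ^ 60 : ℕ) : ℤ) (addb t2 (smul e Z))) (smul (lam * c) w)) fun E =>
    nl E fun m el => gd (Nat.ble (m + E.r) (kap * pw * 2 ^ 200) &&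
      Nat.ble (Int.natAbs el + 2 ^ 19 * E.r) (leak * pw * 2 ^ 220)) <|
    ifrc (-e) fun e => frc (2 * pw) fun pw => ih e pw Aj Gj) l

noncomputable def Dc (i P Z A G : ℝ[X]) (n : ℕ) : ℝ[X] :=
  i * ((G ^ n + C (-(-1)^n)) + P * (A ^ n + C (-(-1)^n))) + C (-(-1)^n) * Z

theorem SS160 : (SS:ℝ) = 2 ^ 160 := by rw [show SS = 2 ^ 160 by decide +kernel]; norm_num

theorem cols_s {α : Type} {iB P Z A G w : Ba} {i' P' Z' A' G' w' : ℝ[X]} (hi : Mem i' iB)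
    (hP : Mem P' P) (hZ : Mem Z' Z) (hA : Mem A' A) (hG : Mem G' G) (hw : Mem w' w) (lw1 : ell w' = 1)
    {lam kap leak : ℕ} {k : Ba → Ba → Option α} {x : α} (l : List ℤ) :
    ∀ {j : ℕ} {e : ℤ} {pw : ℕ} {Aj Gj : Ba}, e = -(-1)^(j+1) → pw = 2^(j+1) →
    Mem (A' ^ j) Aj → Mem (G' ^ j) Gj → cols iB P Z A G w lam kap leak k l e pw Aj Gj = some x →
    (∀ n < l.length,
      N (Dc i' P' Z' A' G' (j+1+n) - C (((lam:ℝ)/2^40) * (((l.getD n 0 : ℤ):ℝ)/2^20)) * w') ≤ (kap:ℝ)/2^20 * 2^(j+1+n) ∧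
      |ell (Dc i' P' Z' A' G' (j+1+n)) - ((lam:ℝ)/2^40) * (((l.getD n 0 : ℤ):ℝ)/2^20)| ≤ (leak:ℝ)/2^20 * 2^(j+1+n)) ∧
    ∃ Aj Gj, Mem (A' ^ (j + l.length)) Aj ∧ Mem (G' ^ (j + l.length)) Gj ∧ k Aj Gj = some x := by
  induction l with
  | nil => intro j e pw Aj Gj _ _ h1 h2 hk; exact ⟨fun n hn => absurd hn (by simp), Aj, Gj, h1, h2, hk⟩
  | cons c cs ih =>
    intro j e pw Aj Gj he hpw h1 h2 hk
    obtain ⟨Aj', h1, hk⟩ := mulB_sound h1 hA hk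
    obtain ⟨Gj', h2, hk⟩ := mulB_sound h2 hG hk
    rw [← pow_succ] at h1 h2
    obtain ⟨t, h3, hk⟩ := mulB_sound hP (h1.addc _) hk
    obtain ⟨t2, h4, hk⟩ := mulB_sound hi ((h2.addc _).add h3) hk
    rw [bfrc_eq] at hk
    have hE := ((h4.add (hZ.smul e)).smul ((2 ^ 60 : ℕ) : ℤ)).sub (hw.smul (lam * c))
    obtain ⟨m, el, h5, h6, hk⟩ := nl_s hE hk
    obtain ⟨h7, hk⟩ := gd_s hk
    obtain ⟨h7, h8⟩ := Bool.and_eq_true_iff.1 h7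
    rw [ifrc_eq, frc_eq] at hk
    have er : C (((e * SS : ℤ) : ℝ) / SS) = C (-(-1:ℝ)^(j+1)) := by
      rw [Int.cast_mul, Int.cast_natCast, mul_div_cancel_right₀ _ SSr.ne', he]; push_cast; rfl
    have er' : (e:ℝ) = -(-1:ℝ)^(j+1) := by rw [he]; push_cast; rfl
    rw [er, er', show i' * (G' ^ (j + 1) + C (-(-1:ℝ) ^ (j + 1)) + P' * (A' ^ (j + 1) + C (-(-1:ℝ) ^ (j + 1)))) +
      C (-(-1:ℝ) ^ (j + 1)) * Z' = Dc i' P' Z' A' G' (j+1) from rfl] at h5 h6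
    set D := Dc i' P' Z' A' G' (j+1) with hD
    have eC : C ((((2:ℕ) ^ 60 : ℕ) : ℤ) : ℝ) * D - C ((lam * c : ℤ) : ℝ) * w' =
        C (2^60 : ℝ) * (D - C (((lam:ℝ)/2^40) * ((c:ℝ)/2^20)) * w') := by
      have : (C ((lam * c : ℤ) : ℝ) : ℝ[X]) = C (2^60:ℝ) * C (((lam:ℝ)/2^40) * (c/2^20)) := by
        rw [← C_mul]; congr 1; push_cast; ring
      rw [this]; push_cast; ring_nf
    rw [eC, N_C_mul, abs_of_pos (by positivity)] at h5
    rw [eC, ell_C_mul, ell_sub, ell_C_mul, lw1, abs_mul, abs_of_pos (by positivity), mul_one] at h6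
    have h7 : ((_ : ℕ) : ℝ) ≤ ((_ : ℕ) : ℝ) := Nat.cast_le.2 (Nat.le_of_ble_eq_true h7)
    have h8 : ((_ : ℕ) : ℝ) ≤ ((_ : ℕ) : ℝ) := Nat.cast_le.2 (Nat.le_of_ble_eq_true h8)
    rw [hpw] at h7 h8
    push_cast at h7 h8
    rw [SS160] at h5 h6
    obtain ⟨q1, q2⟩ := ih (j := j+1) (by rw [he]; ring) (by rw [hpw]; ring) h1 h2 hk
    refine ⟨fun n hn => ?_, ?_⟩
    · rcases n with _ | n
      · rw [add_zero]
        simp only [List.getD_cons_zero]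
        rw [← hD]
        constructor
        · refine le_of_mul_le_mul_left ?_ (by positivity : (0:ℝ) < 2^160 * 2^60)
          rw [show (2:ℝ)^160*2^60*(kap/2^20*2^(j+1)) = kap * 2^(j+1) * 2^200 by ring]
          linarith
        · refine le_of_mul_le_mul_left ?_ (by positivity : (0:ℝ) < 2^160 * 2^60 * 2^20)
          rw [show (2:ℝ)^160*2^60*2^20*(leak/2^20*2^(j+1)) = leak * 2^(j+1) * 2^220 by ring]
          have : ((el.natAbs : ℕ):ℝ) = |(el:ℝ)| := natAbs_r el
          push_cast at h6 h8
          linarith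
      · have := q1 n (by simpa using hn)
        simpa only [List.getD_cons_succ, show j + 1 + (n+1) = j + 1 + 1 + n by ring] using this
    · simpa only [List.length_cons, show j + (cs.length + 1) = j + 1 + cs.length by ring] using q2
end FC

namespace FC
open Polynomial

noncomputable def kU : Cst := ⟨308/1000, 432/1000, (1220:ℕ)/1024, 130/100, (1690:ℕ)/1024, 188/100, 180/100, 54/100,
  210/100, 66/100⟩
theorem kU_ok : kU.Ok := by
  constructor <;> norm_num [kU]
theorem kU_K : kU.K ≤ 575 := by
  norm_num [kU, Cst.K, Cst.gH, Cst.gG, Cst.gB, Cst.gA, Cst.bH, Cst.bG, Cst.bB, Cst.bA]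

structure SOk (F v F1 v1 : ℝ[X]) (lam kap leak ee eps nv : ℝ) : Prop where
  bd : ∀ r, 0 ≤ r → r ≤ 1/2^15 → Bd0 kU r F
  sn : sv F < 0
  b0 : 1/2 ≤ (Bp F).eval 0
  tv : Tan v
  lv : ell v = 1
  col : Col F v1 lam kap leak
  Dv : N (DR F v - C lam * v1) ≤ ee
  hnv : N v ≤ nv
  hnv1 : N v1 ≤ nv
  res : N (Rp F - F1) ≤ eps

theorem SOk.stg {F v F1 v1 : ℝ[X]} {lam kap leak ee eps nv : ℝ}
    (h : SOk F v F1 v1 lam kap leak ee eps nv) {r a b c κ : ℝ} (hr : 0 ≤ r) (hr1 : r ≤ 1/2^15)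
    (ha : 1/2 * (ee + 575 * r * nv) ≤ a) (hb : leak + 1/2 * (575 * r) ≤ b)
    (hc : (1 + 1/2 * nv) * (ee + 575 * r * nv) ≤ c)
    (hκ : kap + leak * nv + (1 + 1/2 * nv) * (575 * r) ≤ κ) :
    Stg F v F1 v1 r lam a b c κ eps :=
  Stg.mk' kU_ok hr (h.bd r hr hr1) (by norm_num [kU]) h.sn (by
    have := h.b0
    have : kU.bB * r ≤ 3 * (1/2^15) := mul_le_mul (by norm_num [kU, Cst.bB, Cst.bA]) hr1 hr (by norm_num)
    norm_num at this
    linarith) h.tv h.lv h.col h.Dv h.hnv h.hnv1 h.res kU_K ha hb hc hκ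

def zq (z : ℤ) : Bool := Nat.beq (Int.natAbs z) 0
theorem zq_s {a b : ℤ} (h : zq (a - b) = true) : a = b := by
  have := Nat.eq_of_beq_eq_true h; omega
def uB (b : Ba) : ℕ := 10000 * (b.M + b.r)
theorem uB_s {p : ℝ[X]} {b : Ba} (h : Mem p b) {m : ℕ} (h1 : Nat.ble (uB b) (m * SS) = true) :
    N p ≤ (m:ℝ) / 10000 := by
  have h2 : ((10000 * (b.M + b.r) : ℕ) : ℝ) ≤ ((m * SS : ℕ) : ℝ) := Nat.cast_le.2 (Nat.le_of_ble_eq_true h1)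
  push_cast at h2
  rw [le_div_iff₀ (by norm_num)]
  refine le_of_mul_le_mul_left ?_ SSr
  linarith [h.bd]
theorem w_s {σ : ℝ} {q m : ℕ} (h : SS * σ ≤ q) (h1 : Nat.ble (10000 * q) (m * SS) = true) :
    σ ≤ (m:ℝ) / 10000 := by
  have h2 : ((10000 * q : ℕ) : ℝ) ≤ ((m * SS : ℕ) : ℝ) := Nat.cast_le.2 (Nat.le_of_ble_eq_true h1)
  push_cast at h2
  rw [le_div_iff₀ (by norm_num)]
  refine le_of_mul_le_mul_left ?_ SSr
  linarith

def bdC {α : Type} (f : List ℤ) (A B G H : Ba) (k : Option α) : Option α :=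
  gd (zq (altL f - SS) && Nat.ble (3081 * SS) (10000 * Int.natAbs (f.headD 0)) &&
    Nat.ble (10000 * Int.natAbs (f.headD 0)) (4319 * SS) && Nat.ble (uB A) (11910 * SS) &&
    Nat.ble (uB B) (12990 * SS) && Nat.ble (uB G) (16500 * SS) && Nat.ble (uB H) (18790 * SS) &&
    lo0 B (SS / 2)) <|
  wt 1220 f fun _ q t => gd (Nat.ble (10000 * q) (17990 * SS) && Nat.ble (10000 * t) (5390 * SS)) <|
  wt 1690 f fun _ q t => gd (Nat.ble (10000 * q) (20990 * SS) && Nat.ble (10000 * t) (6590 * SS)) k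

theorem bdC_s {α : Type} {f : List ℤ} {A B G H : Ba} {k : Option α} {x : α}
    (hA : Mem (Ap (Pol f)) A) (hB : Mem (Bp (Pol f)) B) (hG : Mem (Gp (Pol f)) G)
    (hH : Mem (Hp (Pol f)) H) (hk : bdC f A B G H k = some x) :
    (∀ r, 0 ≤ r → r ≤ 1/2^15 → Bd0 kU r (Pol f)) ∧ 1/2 ≤ (Bp (Pol f)).eval 0 ∧ k = some x := by
  obtain ⟨h0, hk⟩ := gd_s hk
  simp only [Bool.and_eq_true] at h0
  obtain ⟨⟨⟨⟨⟨⟨⟨h1, h2⟩, h3⟩, h4⟩, h5⟩, h6⟩, h7⟩, h8⟩ := h0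
  obtain ⟨_, q, t, -, g1, g2, hk⟩ := wt_s _ _ hk
  obtain ⟨g0, hk⟩ := gd_s hk
  obtain ⟨g3, g4⟩ := Bool.and_eq_true_iff.1 g0
  obtain ⟨_, q', t', -, e1, e2, hk⟩ := wt_s _ _ hk
  obtain ⟨e0, hk⟩ := gd_s hk
  obtain ⟨e3, e4⟩ := Bool.and_eq_true_iff.1 e0
  have s1 : |sv (Pol f)| = (Int.natAbs (f.headD 0) : ℕ) / SS := by
    rw [sv_Pol, abs_div, natAbs_r, abs_of_pos SSr]
  have s2 : ((3081 * SS : ℕ) : ℝ) ≤ ((10000 * Int.natAbs (f.headD 0) : ℕ) : ℝ) :=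
    Nat.cast_le.2 (Nat.le_of_ble_eq_true h2)
  have s3 : ((10000 * Int.natAbs (f.headD 0) : ℕ) : ℝ) ≤ ((4319 * SS : ℕ) : ℝ) :=
    Nat.cast_le.2 (Nat.le_of_ble_eq_true h3)
  push_cast at s2 s3
  have s4 : 3081/10000 ≤ |sv (Pol f)| := by rw [s1, le_div_iff₀ SSr]; linarith
  have s5 : |sv (Pol f)| ≤ 4319/10000 := by rw [s1, div_le_iff₀ SSr]; linarith
  have b0 := lo0_s hB h8
  have b1 : ((SS / 2 : ℕ) : ℝ) = SS / 2 := by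
    rw [show SS / 2 = 2 ^ 159 by decide +kernel, SS160]; norm_num
  refine ⟨fun r hr hr1 => ?_, ?_, hk⟩
  · have n1 := uB_s hA h4
    have n2 := uB_s hB h5
    have n3 := uB_s hG h6
    have n4 := uB_s hH h7
    have w1 := w_s ((W1_Pol _ f).le.trans g1) g3
    have w2 := w_s ((W2_Pol _ f).le.trans g2) g4
    have w3 := w_s ((W1_Pol _ f).le.trans e1) e3
    have w4 := w_s ((W2_Pol _ f).le.trans e2) e4
    clear g1 g2 e1 e2
    have hr1' : r ≤ 1/32768 := by norm_num at hr1 ⊢; exact hr1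
    refine ⟨con_Pol (zq_s h1), ?_, ?_, ?_, ?_, ?_, ?_, ?_, ?_, ?_, ?_⟩
    on_goal 7 => change W1 ((1220:ℕ)/1024) _ + _ ≤ _
    on_goal 8 => change W2 ((1220:ℕ)/1024) _ + _ ≤ _
    on_goal 9 => change W1 ((1690:ℕ)/1024) _ + _ ≤ _
    on_goal 10 => change W2 ((1690:ℕ)/1024) _ + _ ≤ _
    all_goals norm_num [kU, Cst.bH, Cst.bG, Cst.bB, Cst.bA] at *
    all_goals linarith
  · rw [b1] at b0
    refine le_of_mul_le_mul_left ?_ SSr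
    linarith

def lfrc {α : Type} (l : List ℤ) : (List ℤ → α) → α :=
  List.rec (fun k => k []) (fun c _ ih k => ifrc c fun c => ih fun l => k (c :: l)) l
theorem lfrc_eq {α : Type} (l : List ℤ) : ∀ k : List ℤ → α, lfrc l k = k l := by
  induction l with
  | nil => intro k; rfl
  | cons c cs ih => intro k; exact (ifrc_eq c fun c => lfrc cs fun l => k (c :: l)).trans (ih _)
def digs (m : ℕ) : ℕ → List ℤ := Nat.rec (fun _ => [])
  (fun _ ih u => (((Nat.mod u BK : ℕ) : ℤ) - ((hK : ℕ) : ℤ)) :: ih (Nat.div u BK)) m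
def nxt (ov : Option (List ℤ × List ℤ)) (RF Dv : Ba) (lam : ℕ) : List ℤ × List ℤ :=
  match ov with
  | some p => p
  | none =>
    ((fun t => ((SS:ℤ) + altL t) :: t) (digs 24 (Int.toNat (RF.z + biK))).tail,
     lfrc ((digs 24 (Int.toNat (Dv.z + biK))).tail.tail.map fun x =>
        (x * 2 ^ 20) / lam * 2 ^ 20) fun t =>
     (fun t => altL t :: t) (((SS:ℤ) - elL lwI (0 :: 0 :: t) / 2 ^ 20) :: t))

def chV (nv : ℕ) (v : List ℤ) : Bool := zq (elL lwI v - 2 ^ 20 * SS) && Nat.ble (10 * nL' v) (nv * SS)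
theorem chV_s {nv : ℕ} {v : List ℤ} (h : chV nv v = true) : ell (Pol v) = 1 ∧ N (Pol v) ≤ (nv:ℝ)/10 := by
  obtain ⟨h1, h2⟩ := Bool.and_eq_true_iff.1 h
  refine ⟨ell_Pol (zq_s h1), ?_⟩
  have h2 : ((10 * nL' v : ℕ) : ℝ) ≤ ((nv * SS : ℕ) : ℝ) := Nat.cast_le.2 (Nat.le_of_ble_eq_true h2)
  push_cast at h2
  rw [le_div_iff₀ (by norm_num)]
  refine le_of_mul_le_mul_left ?_ SSr
  linarith [N_Pol v]

def tl (kap leak : ℕ) (iB P Z Aj Gj : Ba) : Bool :=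
  (fun T => Nat.ble T (kap * 8 * (SS * SS * SS)) && Nat.ble T (leak * 16 * (SS * SS * SS)))
  ((iB.M + iB.r) * (SS * (Gj.M + Gj.r + SS) + (P.M + P.r) * (Aj.M + Aj.r + SS)) + (Z.M + Z.r) * (SS * SS))

theorem DR_wj (F : ℝ[X]) {n : ℕ} (h : 1 ≤ n) :
    DR F (wj n) = Dc (C (1 / sv F)) (PP F) (ZP F) (Ap F) (Gp F) n := by
  rw [DR_eq]
  have e : sv (wj n) = -(-1)^n := by
    unfold sv wj; rw [eval_sub, eval_pow, eval_X, eval_C, zero_pow (by omega), zero_sub]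
  have e2 : ∀ q : ℝ[X], (wj n).comp q = q ^ n + C (-(-1)^n) := fun q => by
    unfold wj; rw [sub_comp, X_pow_comp, C_comp, C_neg, sub_eq_add_neg]
  rw [e, e2, e2]; rfl

theorem N_pow_le (q : ℝ[X]) (h : N q ≤ 2) (n m : ℕ) : N (q ^ (m + n)) ≤ N (q ^ m) * 2 ^ n := by
  induction n with
  | zero => simp
  | succ n ih =>
    rw [← add_assoc, pow_succ]
    refine (N_mul _ _).trans ?_
    rw [pow_succ, ← mul_assoc]
    exact mul_le_mul ih h (Ww_nonneg pw2 _) (mul_nonneg (Ww_nonneg pw2 _) (by positivity))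

theorem tl_r {s i p z a g I P Z A G : ℝ} (hs : 0 < s) (hi : 0 ≤ i) (hp : 0 ≤ p) (ha : 0 ≤ a) (hg : 0 ≤ g)
    (h1 : s * i ≤ I) (h2 : s * p ≤ P) (h3 : s * a ≤ A) (h4 : s * g ≤ G) (h5 : s * z ≤ Z) :
    s * s * s * (i * (g + 1 + p * (a + 1)) + z) ≤ I * (s * (G + s) + P * (A + s)) + Z * (s * s) := by
  have p1 : s * p * (s * (a + 1)) ≤ P * (A + s) :=
    mul_le_mul h2 (by linarith) (by positivity) ((mul_nonneg hs.le hp).trans h2)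
  have p0 : s * (s * g) ≤ s * G := mul_le_mul_of_nonneg_left h4 hs.le
  have p2 : s * s * (g + 1 + p * (a + 1)) ≤ s * (G + s) + P * (A + s) := by linarith
  have p3 := mul_le_mul h1 p2 (by positivity) ((mul_nonneg hs.le hi).trans h1)
  have p4 := mul_le_mul_of_nonneg_right h5 (mul_nonneg hs.le hs.le)
  linarith

theorem tl_s {kap leak : ℕ} {iB P Z Aj Gj : Ba} {i P' Z' A G : ℝ[X]} (hi : Mem i iB) (hP : Mem P' P)
    (hZ : Mem Z' Z) (hA : Mem (A ^ 23) Aj) (hG : Mem (G ^ 23) Gj) (nA : N A ≤ 2) (nG : N G ≤ 2)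
    (h : tl kap leak iB P Z Aj Gj = true) {n : ℕ} (hn : 23 ≤ n) :
    N (Dc i P' Z' A G n) ≤ (kap:ℝ)/2^20 * 2^n ∧ 1/2 * N (Dc i P' Z' A G n) ≤ (leak:ℝ)/2^20 * 2^n := by
  obtain ⟨m, rfl⟩ := Nat.exists_eq_add_of_le hn
  obtain ⟨h1, h2⟩ := Bool.and_eq_true_iff.1 h
  have h1 : ((_ : ℕ) : ℝ) ≤ ((_ : ℕ) : ℝ) := Nat.cast_le.2 (Nat.le_of_ble_eq_true h1)
  have h2 : ((_ : ℕ) : ℝ) ≤ ((_ : ℕ) : ℝ) := Nat.cast_le.2 (Nat.le_of_ble_eq_true h2)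
  have bi := hi.bd; have bP := hP.bd; have bZ := hZ.bd; have bA := hA.bd; have bG := hG.bd
  push_cast at h1 h2
  have z : ∀ q : ℝ[X], 0 ≤ N q := fun q => Ww_nonneg pw2 q
  have s0 := SSr
  have one : (1:ℝ) ≤ 2 ^ m := one_le_pow₀ (by norm_num)
  have c1 : N (C (-(-1:ℝ)^(23+m))) = 1 := by rw [N_C, abs_neg, abs_pow, abs_neg, abs_one, one_pow]
  set T := (N i * (N (G ^ 23) + 1 + N P' * (N (A ^ 23) + 1)) + N Z') with hT
  have key : N (Dc i P' Z' A G (23 + m)) ≤ T * 2 ^ m := by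
    unfold Dc
    refine (N_add _ _).trans ?_
    have a1 := N_mul i ((G ^ (23+m) + C (-(-1:ℝ)^(23+m))) + P' * (A ^ (23+m) + C (-(-1:ℝ)^(23+m))))
    have a2 := N_add (G ^ (23+m) + C (-(-1:ℝ)^(23+m))) (P' * (A ^ (23+m) + C (-(-1:ℝ)^(23+m))))
    have a3 := N_add (G ^ (23+m)) (C (-(-1:ℝ)^(23+m)))
    have a4 := N_add (A ^ (23+m)) (C (-(-1:ℝ)^(23+m)))
    have a5 := N_mul P' (A ^ (23+m) + C (-(-1:ℝ)^(23+m)))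
    have a6 := N_mul (C (-(-1:ℝ)^(23+m))) Z'
    rw [c1] at a3 a4 a6
    have a7 := N_pow_le A nA m 23
    have a8 := N_pow_le G nG m 23
    have a9 : N (A ^ (23+m) + C (-(-1:ℝ)^(23+m))) ≤ (N (A^23) + 1) * 2^m := by linarith
    have a10 := mul_le_mul_of_nonneg_left a9 (z P')
    have a11 : N ((G ^ (23+m) + C (-(-1:ℝ)^(23+m))) + P' * (A ^ (23+m) + C (-(-1:ℝ)^(23+m)))) ≤
      (N (G ^ 23) + 1 + N P' * (N (A ^ 23) + 1)) * 2 ^ m := by linarith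
    have a12 := mul_le_mul_of_nonneg_left a11 (z i)
    have a13 := mul_le_mul_of_nonneg_left one (z Z')
    rw [hT]; linarith
  have q := tl_r s0 (z i) (z P') (z (A^23)) (z (G^23)) bi bP bA bG bZ
  rw [← hT] at q
  have s3 : (0:ℝ) < SS * SS * SS := by positivity
  have r1 : T ≤ kap * 8 := le_of_mul_le_mul_left (by linarith) s3
  have r2 : T ≤ leak * 16 := le_of_mul_le_mul_left (by linarith) s3
  have pm : (0:ℝ) ≤ 2 ^ m := by positivity
  have t1 := mul_le_mul_of_nonneg_right r1 pm
  have t2 := mul_le_mul_of_nonneg_right r2 pm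
  rw [pow_add]
  constructor <;> norm_num <;> linarith

def stg {α : Type} (kap leak eps ee nv : ℕ) (ov : Option (List ℤ × List ℤ)) (f v : List ℤ)
    (k : List ℤ → List ℤ → ℕ → Option α) : Option α :=
  lfrc f fun f => lfrc v fun v => gd (zq (altL v - 0) && chV nv v) <|
  core f fun iB A B G H P RF Z => bdC f A B G H <|
  hor1 A v fun vA => hor1 G v fun vG => mulB P vA fun t => mulB iB (addb vG t) fun u =>
  mulB (cst (v.headD 0)) Z fun y => nrmB (addb u y) fun Dv =>
  frc (Int.toNat (elZ lwI (Int.toNat (Dv.z + biK))) / 2 ^ 140) fun lam =>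
  (fun p => lfrc p.1 fun f1 => lfrc p.2 fun w1 =>
    gd (Nat.ble f1.length 24 && Nat.ble w1.length 24 && chV nv w1) <|
    nrmB (subb RF (ofl f1)) fun d => gd (Nat.ble (d.M + d.r) (eps * 2 ^ 80)) <|
    bfrc (ofl w1) fun W =>
    nrmB (subb (smul ((2 ^ 40 : ℕ) : ℤ) Dv) (smul lam W)) fun d => gd (Nat.ble (d.M + d.r) (ee * 2 ^ 120)) <|
    cols iB P Z A G W lam kap leak (fun Aj Gj => gd (tl kap leak iB P Z Aj Gj) (k f1 w1 lam))
      lwI.tail 1 2 (cst SS) (cst SS)) (nxt ov RF Dv lam)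

theorem stg_s {α : Type} {kap leak eps ee nv : ℕ} {ov : Option (List ℤ × List ℤ)} {f v : List ℤ}
    {k : List ℤ → List ℤ → ℕ → Option α} {x : α} (hk : stg kap leak eps ee nv ov f v k = some x) :
    ∃ (f1 w1 : List ℤ) (lam : ℕ), SOk (Pol f) (Pol v) (Pol f1) (Pol w1) ((lam:ℝ)/2^40) ((kap:ℝ)/2^20) ((leak:ℝ)/2^20)
      ((ee:ℝ)/2^80) ((eps:ℝ)/2^80) ((nv:ℝ)/10) ∧ (∀ p, ov = some p → f1 = p.1 ∧ w1 = p.2) ∧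
      k f1 w1 lam = some x := by
  unfold stg at hk
  rw [lfrc_eq, lfrc_eq] at hk
  obtain ⟨h1, hk⟩ := gd_s hk
  obtain ⟨h1, h2⟩ := Bool.and_eq_true_iff.1 h1
  obtain ⟨s0, iB, A, B, G, H, P, RF, Z, hi, hA, hB, hG, hH, hP, hR, hZ, hk⟩ := core_s hk
  obtain ⟨bd, b0, hk⟩ := bdC_s hA hB hG hH hk
  obtain ⟨vA, hvA, hk⟩ := hor1_s hA v hk
  obtain ⟨vG, hvG, hk⟩ := hor1_s hG v hk
  obtain ⟨t, ht, hk⟩ := mulB_sound hP hvA hk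
  obtain ⟨u, hu, hk⟩ := mulB_sound hi (hvG.add ht) hk
  obtain ⟨y, hy, hk⟩ := mulB_sound (mem_cst (v.headD 0)) hZ hk
  obtain ⟨Dv, hDv, hk⟩ := nrmB_s (hu.add hy) hk
  rw [← sv_Pol, ← DR_eq] at hDv
  rw [frc_eq] at hk
  generalize Int.toNat (elZ lwI (Int.toNat (Dv.z + biK))) / 2 ^ 140 = lam at hk
  have hov : ∀ p, ov = some p → (nxt ov RF Dv lam).1 = p.1 ∧ (nxt ov RF Dv lam).2 = p.2 := by
    rintro p rfl; exact ⟨rfl, rfl⟩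
  generalize nxt ov RF Dv lam = p at hk hov
  obtain ⟨f1, w1⟩ := p
  simp only [lfrc_eq, bfrc_eq] at hk hov
  obtain ⟨h3, hk⟩ := gd_s hk
  simp only [Bool.and_eq_true] at h3
  obtain ⟨⟨h3, h4⟩, h5⟩ := h3
  obtain ⟨d, hd, hk⟩ := nrmB_s (hR.sub (mem_ofl (Nat.le_of_ble_eq_true h3))) hk
  obtain ⟨h6, hk⟩ := gd_s hk
  have hW := mem_ofl (Nat.le_of_ble_eq_true h4)
  obtain ⟨d', hd', hk⟩ := nrmB_s ((hDv.smul ((2 ^ 40 : ℕ) : ℤ)).sub (hW.smul lam)) hk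
  obtain ⟨h7, hk⟩ := gd_s hk
  obtain ⟨v1, v2⟩ := chV_s h2
  obtain ⟨u1, u2⟩ := chV_s h5
  have one : Mem ((1:ℝ[X])) (cst SS) := by
    have := mem_cst SS
    rwa [Int.cast_natCast, div_self SSr.ne', C_1] at this
  obtain ⟨c1, Aj, Gj, hAj, hGj, hk⟩ := cols_s hi hP hZ hA hG hW u1 lwI.tail (j := 0) (by norm_num)
    (by norm_num) (by rwa [pow_zero]) (by rwa [pow_zero]) hk
  have ln : lwI.tail.length = 23 := by decide
  rw [ln, zero_add] at hAj hGj
  obtain ⟨h8, hk⟩ := gd_s hk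
  have B0 := bd 0 le_rfl (by positivity)
  have nA : N (Ap (Pol f)) ≤ 2 := by have := B0.sA; norm_num [kU] at this; linarith
  have nG : N (Gp (Pol f)) ≤ 2 := by have := B0.sG; norm_num [kU] at this; linarith
  have lwt : ∀ n, lwI.tail.getD n 0 = lwI.getD (n+1) 0 := fun n => by unfold lwI; rfl
  refine ⟨f1, w1, lam, ⟨bd, ?_, b0, tan_Pol (zq_s h1), v1, ⟨u1, by positivity, by positivity, ?_, ?_⟩,
    ?_, v2, u2, ?_⟩, hov, hk⟩
  · rw [sv_Pol]; exact div_neg_of_neg_of_pos (by exact_mod_cast s0) SSr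
  · intro j hj
    rw [DR_wj _ hj]
    by_cases h : j < 24
    · have := (c1 (j-1) (by omega)).1
      rw [lwt, show j - 1 + 1 = j by omega, show 0 + 1 + (j-1) = j by omega] at this
      exact this
    · have := (tl_s hi hP hZ hAj hGj nA nG h8 (n := j) (by omega)).1
      rwa [lw_zero (show nL ≤ j from not_lt.1 h), mul_zero, C_0, zero_mul, sub_zero]
  · intro j hj
    rw [DR_wj _ hj]
    by_cases h : j < 24
    · have := (c1 (j-1) (by omega)).2
      rw [lwt, show j - 1 + 1 = j by omega, show 0 + 1 + (j-1) = j by omega] at this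
      exact this
    · have := (tl_s hi hP hZ hAj hGj nA nG h8 (n := j) (by omega)).2
      rw [lw_zero (show nL ≤ j from not_lt.1 h), mul_zero, sub_zero]
      exact (ell_le _).trans this
  · have a := hd'.bd
    have b : ((_:ℕ):ℝ) ≤ ((_:ℕ):ℝ) := Nat.cast_le.2 (Nat.le_of_ble_eq_true h7)
    push_cast at b
    rw [show C ((((2:ℕ) ^ 40 : ℕ) : ℤ) : ℝ) * DR (Pol f) (Pol v) - C (((lam:ℤ)):ℝ) * Pol w1 =
      C (2^40:ℝ) * (DR (Pol f) (Pol v) - C ((lam:ℝ)/2^40) * Pol w1) by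
        have : (C (((lam:ℤ)):ℝ) : ℝ[X]) = C (2^40:ℝ) * C ((lam:ℝ)/2^40) := by
          rw [← C_mul]; congr 1; push_cast; ring
        rw [this]; push_cast; ring_nf, N_C_mul, abs_of_pos (by positivity), SS160] at a
    refine le_of_mul_le_mul_left ?_ (by positivity : (0:ℝ) < 2^160 * 2^40)
    rw [show (2:ℝ)^160*2^40*(ee/2^80) = ee * 2^120 by ring]
    linarith
  · have a := hd.bd
    have b : ((_:ℕ):ℝ) ≤ ((_:ℕ):ℝ) := Nat.cast_le.2 (Nat.le_of_ble_eq_true h6)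
    push_cast at b
    rw [SS160] at a
    refine le_of_mul_le_mul_left ?_ (by positivity : (0:ℝ) < 2^160)
    rw [show (2:ℝ)^160*(eps/2^80) = eps * 2^80 by ring]
    linarith
end FC

namespace FC
open Polynomial

def FU : List (ℤ × ℤ) := [(-494600720866704538965377024, 1237654427284710753615922083), (-1549224936611948613300387840, 826379840818740499293586339), (204145766563425971132694528, -476790086785094548378877952), (17114717210817740787417088, -47978329806530640002154496), (-3507019449566870221357056, 16189209470268602060898304), (219843864607283792052224, -1423670395078290204262400), (8522012261621308588032, -48101631106556976168960), (-3001880953315243589632, 26305206120037478301696), (134126731023515385856, -1530097470548679327744), (18254207206348029952, -197466989882019676160), (-2292306460290318336, 30327203054741356544), (-4494323494158336, -150215960683347968), (21891987952107520, -329278079341953024), (-1930333966565376, 33827232369606656), (-25147478114304, 222984908308480), (20061153656832, -382290308890624), (-1645157023744, 35714590834688), (-22163750912, 273803116544), (15852371968, -366389231616), (-1203765248, 31351373824), (-29360128, 565182464), (11534336, -338690048), (-1048576, 23068672), (-1048576, 1048576)]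
def st (t : ℤ) (l : List (ℤ × ℤ)) : List ℤ := l.map fun p => p.1 * 2 ^ 70 + t * p.2 * 2 ^ 20
def Fl : List ℤ := st 0 FU
def ul : List ℤ := FU.map fun p => p.2 * 2 ^ 70
theorem st_eq (t : ℤ) (l : List (ℤ × ℤ)) :
    Pol (st t l) = Pol (st 0 l) + C ((t:ℝ)/2^50) * Pol (l.map fun p => p.2 * 2 ^ 70) := by
  induction l with
  | nil => simp [st, Pol_nil]
  | cons p l ih =>
    simp only [st, List.map_cons, Pol_cons] at ih ⊢
    rw [ih]
    have : C ((((p.1 * 2 ^ 70 + t * p.2 * 2 ^ 20 : ℤ)) : ℝ) / SS) =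
        C ((((p.1 * 2 ^ 70 + 0 * p.2 * 2 ^ 20 : ℤ)) : ℝ) / SS) +
        C ((t:ℝ)/2^50) * C (((p.2 * 2 ^ 70 : ℤ) : ℝ) / SS) := by
      rw [← C_mul, ← C_add]; congr 1; push_cast; ring
    rw [this]; ring

def SC (F v F1 v1 : ℝ[X]) (lam : ℝ) : Prop :=
  SOk F v F1 v1 lam (((450888:ℕ):ℝ)/2^20) (((14000:ℕ):ℝ)/2^20) (((2^46:ℕ):ℝ)/2^80) (((2^41:ℕ):ℝ)/2^80) (((45:ℕ):ℝ)/10) ∧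
  441/100 ≤ lam ∧ lam ≤ 479/100
def sc (ov : Option (List ℤ × List ℤ)) (f v : List ℤ) (k : List ℤ → List ℤ → Option Unit) : Option Unit :=
  stg 450888 14000 (2 ^ 41) (2 ^ 46) 45 ov f v fun f1 w1 lam =>
    gd (Nat.ble (441 * 2 ^ 40) (100 * lam) && Nat.ble (100 * lam) (479 * 2 ^ 40)) (k f1 w1)
theorem sc_s {ov : Option (List ℤ × List ℤ)} {f v : List ℤ} {k : List ℤ → List ℤ → Option Unit}
    (h : sc ov f v k = some ()) : ∃ f1 w1 lam, SC (Pol f) (Pol v) (Pol f1) (Pol w1) lam ∧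
      (∀ p, ov = some p → f1 = p.1 ∧ w1 = p.2) ∧ k f1 w1 = some () := by
  obtain ⟨f1, w1, lam, h1, h2, h3⟩ := stg_s h
  obtain ⟨h4, h3⟩ := gd_s h3
  obtain ⟨h4, h5⟩ := Bool.and_eq_true_iff.1 h4
  have h4 : ((441 * 2 ^ 40 : ℕ) : ℝ) ≤ ((100 * lam : ℕ) : ℝ) := Nat.cast_le.2 (Nat.le_of_ble_eq_true h4)
  have h5 : ((100 * lam : ℕ) : ℝ) ≤ ((479 * 2 ^ 40 : ℕ) : ℝ) := Nat.cast_le.2 (Nat.le_of_ble_eq_true h5)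
  push_cast at h4 h5
  refine ⟨f1, w1, _, ⟨h1, ?_, ?_⟩, h2, h3⟩
  · rw [le_div_iff₀ (by positivity)]; linarith
  · rw [div_le_iff₀ (by positivity)]; linarith
def cenR (n : ℕ) : List ℤ → List ℤ → Option Unit :=
  Nat.rec (fun f v => sc (some (Fl, ul)) f v fun _ _ => some ()) (fun _ ih f v => sc none f v ih) n
theorem cenR_s {lam0 : ℝ} (self : SC (Pol Fl) (Pol ul) (Pol Fl) (Pol ul) lam0) (n : ℕ) :
    ∀ {f v : List ℤ}, cenR n f v = some () → ∃ (cen dir : ℕ → ℝ[X]) (lam : ℕ → ℝ), cen 0 = Pol f ∧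
      dir 0 = Pol v ∧ (∀ k, SC (cen k) (dir k) (cen (k+1)) (dir (k+1)) (lam k)) ∧
      ∀ k, n + 1 ≤ k → cen k = Pol Fl ∧ dir k = Pol ul := by
  induction n with
  | zero =>
    intro f v h
    obtain ⟨f1, w1, lam, h1, h2, -⟩ := sc_s h
    obtain ⟨rfl, rfl⟩ := h2 _ rfl
    refine ⟨fun | 0 => Pol f | _+1 => Pol Fl, fun | 0 => Pol v | _+1 => Pol ul,
      fun | 0 => lam | _+1 => lam0, rfl, rfl, ?_, ?_⟩
    · rintro (_ | k)
      · exact h1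
      · exact self
    · rintro (_ | k) hk
      · omega
      · exact ⟨rfl, rfl⟩
  | succ n ih =>
    intro f v h
    obtain ⟨f1, w1, lam, h1, -, h3⟩ := sc_s h
    obtain ⟨cen, dir, la, c0, d0, hc, ht⟩ := ih h3
    refine ⟨fun | 0 => Pol f | k+1 => cen k, fun | 0 => Pol v | k+1 => dir k,
      fun | 0 => lam | k+1 => la k, rfl, rfl, ?_, ?_⟩
    · rintro (_ | k)
      · show SC _ _ (cen 0) (dir 0) _; rw [c0, d0]; exact h1
      · exact hc k
    · rintro (_ | k) hk
      · omega
      · exact ht k (by omega)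

def ch {α : Type} (l : List (ℕ × ℕ)) : List ℤ → List ℤ → ℕ → ℕ → ℕ → ℕ →
    (List ℤ → List ℤ → ℕ → ℕ → ℕ → ℕ → Option α) → Option α :=
  List.rec (fun f v X0 X L Y k => k f v X0 X L Y) (fun p _ ih f v X0 X L Y k =>
    stg p.1 p.2 (2 ^ 35) (2 ^ 43) 50 none f v fun f1 w1 lam =>
    frc (5 * X + Y) fun r => frc (2 ^ 42 + 1438 * r) fun a => frc (p.2 * 2 ^ 60 + 288 * r) fun b =>
    frc ((p.1 + 5 * p.2) * 2 ^ 60 + 2013 * r) fun c => frc (lam * 2 ^ 40) fun m =>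
    gd (Nat.ble (700 * a + 10 * c + b + 10 * a) (10 * m) && Nat.ble r (2 ^ 65) &&
      Nat.ble (b * Y + 2 ^ 114) ((m - a) * L)) <|
    frc (((m + a) * X0 + b * Y) / 2 ^ 80 + 1 + 2 ^ 34) fun X0' =>
    frc (((m + a) * X + b * Y) / 2 ^ 80 + 1 + 2 ^ 34) fun X' =>
    frc (((m - a) * L - (b * Y + 2 ^ 114)) / 2 ^ 80) fun L' =>
    frc ((7 * a * X + c * Y) / 2 ^ 80 + 1 + 7 * 2 ^ 34) fun Y' => ih f1 w1 X0' X' L' Y' k) l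

theorem dvU {x n : ℕ} {y : ℝ} (h : y ≤ (x:ℝ)/2^160 + n/2^80) : y ≤ ((x / 2^80 + 1 + n : ℕ):ℝ)/2^80 := by
  have h1 : x < (x / 2^80 + 1) * 2^80 := by omega
  have h2 : (x:ℝ) < ((x / 2^80 + 1 : ℕ):ℝ) * 2^80 := by exact_mod_cast h1
  rw [Nat.cast_add _ n, add_div]
  refine h.trans (add_le_add_left ?_ _)
  rw [div_le_div_iff₀ (by positivity) (by positivity), show (2:ℝ)^160 = 2^80*2^80 by norm_num, ← mul_assoc]
  exact mul_le_mul_of_nonneg_right h2.le (by positivity)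

theorem dvL {x : ℕ} {y : ℝ} (h : (x:ℝ)/2^160 ≤ y) : ((x / 2^80 : ℕ):ℝ)/2^80 ≤ y := by
  have h1 : (x / 2^80) * 2^80 ≤ x := Nat.div_mul_le_self _ _
  have h2 : ((x / 2^80 : ℕ):ℝ) * 2^80 ≤ x := by exact_mod_cast h1
  refine le_trans ?_ h
  rw [div_le_div_iff₀ (by positivity) (by positivity), show (2:ℝ)^160 = 2^80*2^80 by norm_num, ← mul_assoc]
  exact mul_le_mul_of_nonneg_right h2 (by positivity)

theorem frc_s {α : Type} {n : ℕ} {k : ℕ → Option α} {x : α} (h : frc n k = some x) :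
    ∃ m, m = n ∧ k m = some x := ⟨n, rfl, by rwa [frc_eq] at h⟩

theorem ch_s {α : Type} (l : List (ℕ × ℕ)) : ∀ {f v : List ℤ} {X0 X L Y : ℕ}
    {k : List ℤ → List ℤ → ℕ → ℕ → ℕ → ℕ → Option α} {x : α}, X0 ≤ X → ch l f v X0 X L Y k = some x →
    ∃ (f' v' : List ℤ) (X0' X' L' Y' : ℕ), k f' v' X0' X' L' Y' = some x ∧
      (EndP 0 (Pol f') (Pol v') (X0'/2^80) (X'/2^80) (L'/2^80) (Y'/2^80) →
        EndP l.length (Pol f) (Pol v) (X0/2^80) (X/2^80) (L/2^80) (Y/2^80)) ∧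
      (EndM 0 (Pol f') (Pol v') (X'/2^80) (Y'/2^80) →
        EndM l.length (Pol f) (Pol v) (X/2^80) (Y/2^80)) := by
  induction l with
  | nil => intro f v X0 X L Y k x _ h; exact ⟨f, v, X0, X, L, Y, h, id, id⟩
  | cons p l ih =>
    intro f v X0 X L Y k x h0 h
    obtain ⟨f1, w1, lam, h1, -, h⟩ := stg_s h
    obtain ⟨r, hr, h⟩ := frc_s h
    obtain ⟨a, ha, h⟩ := frc_s h
    obtain ⟨b, hb, h⟩ := frc_s h
    obtain ⟨c, hc, h⟩ := frc_s h
    obtain ⟨m, hm, h⟩ := frc_s h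
    obtain ⟨g, h⟩ := gd_s h
    obtain ⟨A, hA, h⟩ := frc_s h
    obtain ⟨B, hB, h⟩ := frc_s h
    obtain ⟨D, hD, h⟩ := frc_s h
    obtain ⟨G, hG, h⟩ := frc_s h
    simp only [Bool.and_eq_true] at g
    obtain ⟨⟨g1, g2⟩, g3⟩ := g
    have g1 := Nat.le_of_ble_eq_true g1
    have g2 := Nat.le_of_ble_eq_true g2
    have g3 := Nat.le_of_ble_eq_true g3
    have hma : a ≤ m := by omega
    have hAB : A ≤ B := by
      rw [hA, hB]
      exact Nat.add_le_add_right (Nat.add_le_add_right (Nat.div_le_div_right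
        (Nat.add_le_add_right (Nat.mul_le_mul_left (m + a) h0) (b * Y))) 1) (2 ^ 34)
    obtain ⟨f', v', X0', X', L', Y', hk, eP, eM⟩ := ih hAB h
    have Hr : (r:ℝ) = 5 * X + Y := by rw [hr]; push_cast; ring
    have Ha : (a:ℝ) = 2^42 + 1438 * r := by rw [ha]; push_cast; ring
    have Hb : (b:ℝ) = p.2 * 2^60 + 288 * r := by rw [hb]; push_cast; ring
    have Hc : (c:ℝ) = (p.1 + 5 * p.2) * 2^60 + 2013 * r := by rw [hc]; push_cast; ring
    have Hm : (m:ℝ) = lam * 2^40 := by rw [hm]; push_cast; ring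
    have G1 : (710:ℝ) * a + 10 * c + b ≤ 10 * m := by
      have : 710 * a + 10 * c + b ≤ 10 * m := by omega
      exact_mod_cast this
    have G2 : (r:ℝ) ≤ 2^65 := by exact_mod_cast g2
    have r0 : (0:ℝ) ≤ r := Nat.cast_nonneg r
    have ml : (lam:ℝ)/2^40 = m/2^80 := by rw [Hm]; ring
    rw [ml] at h1
    have S : Stg (Pol f) (Pol v) (Pol f1) (Pol w1) (r/2^80) (m/2^80) (a/2^80) (b/2^80) (7*a/2^80) (c/2^80)
        (((2^35:ℕ):ℝ)/2^80) := by
      refine h1.stg (by positivity) ?_ ?_ ?_ ?_ ?_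
      · exact (div_le_div_of_nonneg_right G2 (by positivity)).trans (by norm_num)
      all_goals
        rw [le_div_iff₀ (by positivity)]
        push_cast
        try rw [Ha]
        try rw [Hb]
        try rw [Hc]
        norm_num
        linarith
    have nv : N (Pol v) ≤ 5 := h1.hnv.trans (by norm_num)
    have nv1 : N (Pol w1) ≤ 5 := h1.hnv1.trans (by norm_num)
    have a0 : (0:ℝ) ≤ a := Nat.cast_nonneg a
    have b0 : (0:ℝ) ≤ b := Nat.cast_nonneg b
    have c0 : (0:ℝ) ≤ c := Nat.cast_nonneg c
    have HL : (((m - a) * L - (b * Y + 2 ^ 114) : ℕ):ℝ) = (m - a) * L - (b * Y + 2^114) := by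
      rw [Nat.cast_sub g3, Nat.cast_mul, Nat.cast_sub hma]; push_cast; ring
    have hrr : (X:ℝ)/2^80 * 5 + Y/2^80 ≤ r/2^80 := by rw [Hr]; apply le_of_eq; ring
    have E : ∀ z : ℕ, ((m:ℝ)/2^80 + a/2^80) * (z/2^80) + b/2^80 * (Y/2^80) + 1/2 * (((2^35:ℕ):ℝ)/2^80) ≤
        ((((m + a) * z + b * Y) / 2 ^ 80 + 1 + 2 ^ 34 : ℕ):ℝ)/2^80 := fun z => dvU (by
      apply le_of_eq; push_cast; ring)
    have E4 : (7*(a:ℝ)/2^80) * (X/2^80) + c/2^80 * (Y/2^80) + (1 + 1/2 * 5) * (((2^35:ℕ):ℝ)/2^80) ≤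
        (((7 * a * X + c * Y) / 2 ^ 80 + 1 + 7 * 2 ^ 34 : ℕ):ℝ)/2^80 := dvU (by
      apply le_of_eq; push_cast; ring)
    have m0 : (0:ℝ) ≤ m := Nat.cast_nonneg m
    have q : ∀ {z : ℝ}, 0 ≤ z → 0 ≤ z / 2^80 := fun h => div_nonneg h (by norm_num)
    have c7 : (0:ℝ) ≤ 7 * a := by linarith
    have ma : (a:ℝ) < m := by nlinarith
    refine ⟨f', v', X0', X', L', Y', hk, fun e => ?_, fun e => ?_⟩
    · refine EndP.step S nv nv1 (q r0) (q (Nat.cast_nonneg _)) (q a0) (q b0) (q c7)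
        (q c0) ?_ ?_ (q (Nat.cast_nonneg _)) hrr (hA ▸ E X0) (hB ▸ E X) ?_ (hG ▸ E4) ?_ ?_ (eP e)
      · rw [← sub_div]; exact div_nonneg (by linarith) (by positivity)
      · gcongr
      · rw [hD]; refine dvL ?_
        rw [HL]; apply le_of_eq; push_cast; ring
      · refine sub_nonneg.1 ?_
        have : 0 ≤ (10 * (m:ℝ) - (710 * a + 10 * c + b)) / (100 * 2^80) := div_nonneg (by linarith) (by positivity)
        refine this.trans (le_of_eq ?_); ring
      · have : 0 < ((m:ℝ) - a - b/10) / (2^80) := div_pos (by linarith) (by positivity)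
        refine this.trans_le (le_of_eq ?_); ring
    · exact EndM.step S nv nv1 (q r0) (q b0) (q c7) (q c0) (add_nonneg (q m0) (q a0)) (q m0)
        hrr (hB ▸ E X) (hG ▸ E4) (eM e)
end FC

namespace FC
open Polynomial

def eP (f v : List ℤ) (X0 X L Y : ℕ) : Option Unit :=
  frc (Int.toNat (f.headD 0)) fun s => frc (Int.toNat (v.headD 0)) fun u =>
  gd (zq (altL f - SS) && zq (altL v - 0) && Nat.ble 1 s && Nat.ble SS (2 * u) && Nat.ble u (2 * SS) &&
    Nat.ble X (2 ^ 78) && Nat.ble Y (2 ^ 78) && Nat.ble (3 * X0 * u + Y * SS) (3 * s * 2 ^ 80) &&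
    Nat.blt (3 * s * 2 ^ 80 + Y * SS) (3 * L * u)) (some ())

theorem eP_s {f v : List ℤ} {X0 X L Y : ℕ} (h : eP f v X0 X L Y = some ()) :
    EndP 0 (Pol f) (Pol v) (X0/2^80) (X/2^80) (L/2^80) (Y/2^80) := by
  obtain ⟨s, hs, h⟩ := frc_s h
  obtain ⟨u, hu, h⟩ := frc_s h
  obtain ⟨g, -⟩ := gd_s h
  simp only [Bool.and_eq_true] at g
  obtain ⟨⟨⟨⟨⟨⟨⟨⟨g1, g2⟩, g3⟩, g4⟩, g5⟩, g6⟩, g7⟩, g8⟩, g9⟩ := g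
  have g3 := Nat.le_of_ble_eq_true g3
  have g4 := Nat.le_of_ble_eq_true g4
  have hS := SSpos
  have s1 : f.headD 0 = s := by omega
  have u1 : v.headD 0 = u := by omega
  have S : sv (Pol f) = s / SS := by rw [sv_Pol, s1, Int.cast_natCast]
  have U : sv (Pol v) = u / SS := by rw [sv_Pol, u1, Int.cast_natCast]
  have g4 : ((SS : ℕ) : ℝ) ≤ ((2 * u : ℕ) : ℝ) := Nat.cast_le.2 g4
  have g5 : ((u : ℕ) : ℝ) ≤ ((2 * SS : ℕ) : ℝ) := Nat.cast_le.2 (Nat.le_of_ble_eq_true g5)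
  have g6 : ((X : ℕ) : ℝ) ≤ ((2 ^ 78 : ℕ) : ℝ) := Nat.cast_le.2 (Nat.le_of_ble_eq_true g6)
  have g7 : ((Y : ℕ) : ℝ) ≤ ((2 ^ 78 : ℕ) : ℝ) := Nat.cast_le.2 (Nat.le_of_ble_eq_true g7)
  have g8 : ((3 * X0 * u + Y * SS : ℕ) : ℝ) ≤ ((3 * s * 2 ^ 80 : ℕ) : ℝ) := Nat.cast_le.2 (Nat.le_of_ble_eq_true g8)
  have g9 : ((3 * s * 2 ^ 80 + Y * SS : ℕ) : ℝ) < ((3 * L * u : ℕ) : ℝ) := Nat.cast_lt.2 (blt_s g9)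
  push_cast at g4 g5 g6 g7 g8 g9
  have r0 := SSr
  generalize (SS:ℝ) = K at *
  have s0 : (0:ℝ) ≤ s := Nat.cast_nonneg s
  have x1 : (X:ℝ)/2^80 ≤ 1/4 := by rw [div_le_div_iff₀ (by norm_num) (by norm_num)]; linarith
  have y1 : (Y:ℝ)/2^80 ≤ 1/4 := by rw [div_le_div_iff₀ (by norm_num) (by norm_num)]; linarith
  have u2 : sv (Pol v) ≤ 2 := by rw [U, div_le_iff₀ r0]; linarith
  have u3 : 1/2 ≤ sv (Pol v) := by rw [U, le_div_iff₀ r0]; linarith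
  have s2 : 0 ≤ sv (Pol f) := by rw [S]; exact div_nonneg s0 r0.le
  refine EndP.base (con_Pol (zq_s g1)) (tan_Pol (zq_s g2)) u3 ?_ ?_ ?_
  · have : (X:ℝ)/2^80 * sv (Pol v) ≤ 1/4 * 2 := mul_le_mul x1 u2 (by linarith) (by norm_num)
    linarith
  · rw [S, U, show (X0:ℝ)/2^80 * (u/K) + Y/2^80/3 = (3 * X0 * u + Y * K)/(3*2^80*K) by field_simp]
    rw [div_le_div_iff₀ (by positivity) r0]
    have := mul_le_mul_of_nonneg_right g8 r0.le
    linarith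
  · rw [S, U, show (s:ℝ)/K + Y/2^80/3 = (3*s*2^80 + Y * K)/(3*2^80*K) by field_simp,
      show (L:ℝ)/2^80 * (u/K) = (3*L*u)/(3*2^80*K) by field_simp]
    exact div_lt_div_of_pos_right (by linarith) (by positivity)

noncomputable def kM : Cst := ⟨308/1000, 540/1000, (1332:ℕ)/1024, 130/100, (1690:ℕ)/1024, 188/100, 208/100, 54/100,
  210/100, 66/100⟩
theorem kM_ok : kM.Ok := by
  constructor <;> norm_num [kM]

def eM (f v : List ℤ) (_ X _ Y : ℕ) : Option Unit :=
  gd (zq (altL f - SS) && chV 50 v && Nat.ble (5 * X + Y) (2 ^ 65) &&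
    Nat.ble (10000 * Int.natAbs (f.headD 0)) (5350 * SS) && Nat.ble (5300 * SS) (10000 * Int.natAbs (f.headD 0))) <|
  core f fun _ A B _ H _ _ _ => gd (Nat.ble (uB A) (12900 * SS) && lo0 B (SS / 4) && up0 B (SS / 4 * 3) &&
    lo0 H (SS / 1024 * 552)) <|
  wt 1332 f fun _ q _ => gd (Nat.ble (10000 * q) (20790 * SS)) <|
  wt 1024 f fun _ q _ => gd (Nat.ble (10000 * q) (18990 * SS)) (some ())

theorem SSd {n m k : ℕ} (hn : n ∣ 2^160) (h0 : 0 < n) (h : k = SS / n * m) : (k:ℝ) = SS * (m / n) := by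
  have e : SS = 2^160 := by decide +kernel
  rw [h, Nat.cast_mul, Nat.cast_div (e ▸ hn) (by positivity)]; ring

theorem eM_s {f v : List ℤ} {X0 X L Y : ℕ} (h : eM f v X0 X L Y = some ()) :
    EndM 0 (Pol f) (Pol v) (X/2^80) (Y/2^80) := by
  obtain ⟨g, h⟩ := gd_s h
  simp only [Bool.and_eq_true] at g
  obtain ⟨⟨⟨⟨g1, g2⟩, g3⟩, g4⟩, g5⟩ := g
  obtain ⟨s0, _, A, B, _, H, _, _, _, -, hA, hB, -, hH, -, -, -, h⟩ := core_s h
  obtain ⟨e, h⟩ := gd_s h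
  simp only [Bool.and_eq_true] at e
  obtain ⟨⟨⟨e1, e2⟩, e3⟩, e4⟩ := e
  obtain ⟨_, q, _, -, w1, -, h⟩ := wt_s _ _ h
  obtain ⟨f1, h⟩ := gd_s h
  obtain ⟨_, q', _, -, w2, -, h⟩ := wt_s _ _ h
  obtain ⟨f2, h⟩ := gd_s h
  have w1 := w_s ((W1_Pol _ f).le.trans w1) f1
  have w2 := w_s ((W1_Pol _ f).le.trans w2) f2
  have n1 := uB_s hA e1
  have e2 := lo0_s hB e2
  have e3 := up0_s hB e3
  have e4 := lo0_s hH e4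
  have g3 : ((5 * X + Y : ℕ) : ℝ) ≤ ((2 ^ 65 : ℕ) : ℝ) := Nat.cast_le.2 (Nat.le_of_ble_eq_true g3)
  have g4 : ((10000 * Int.natAbs (f.headD 0) : ℕ) : ℝ) ≤ ((5350 * SS : ℕ) : ℝ) :=
    Nat.cast_le.2 (Nat.le_of_ble_eq_true g4)
  have g5 : ((5300 * SS : ℕ) : ℝ) ≤ ((10000 * Int.natAbs (f.headD 0) : ℕ) : ℝ) :=
    Nat.cast_le.2 (Nat.le_of_ble_eq_true g5)
  rw [SSd (n := 4) (m := 1) (by norm_num) (by norm_num) (mul_one _).symm] at e2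
  rw [SSd (n := 4) (m := 3) (by norm_num) (by norm_num) rfl] at e3
  rw [SSd (n := 1024) (m := 552) (by norm_num) (by norm_num) rfl] at e4
  have e2 := le_of_mul_le_mul_left e2 SSr
  have e3 := le_of_mul_le_mul_left e3 SSr
  have e4 := le_of_mul_le_mul_left e4 SSr
  have s1 : |sv (Pol f)| ≤ 535/1000 := by
    rw [sv_Pol, abs_div, ← natAbs_r, abs_of_pos SSr, div_le_iff₀ SSr]
    push_cast at g4; linarith
  have s2 : sv (Pol f) ≤ - (1/10^4) := by
    have : 530/1000 ≤ |sv (Pol f)| := by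
      rw [sv_Pol, abs_div, ← natAbs_r, abs_of_pos SSr, le_div_iff₀ SSr]
      push_cast at g5; linarith
    rw [abs_of_nonpos] at this
    · linarith
    · rw [sv_Pol]; exact div_nonpos_of_nonpos_of_nonneg (by exact_mod_cast s0.le) SSr.le
  have hX : (X:ℝ)/2^80 * 5 + Y/2^80 ≤ 1/2^15 := by
    push_cast at g3
    rw [show (X:ℝ)/2^80 * 5 + Y/2^80 = (5*X+Y)/2^80 by ring, div_le_div_iff₀ (by norm_num) (by norm_num)]
    linarith
  have s3 := abs_le.1 s1
  norm_num at e2 e3 e4 n1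
  refine EndM.base kM_ok (c1 := 1899/1000) (con_Pol (zq_s g1)) ((chV_s g2).2.trans (by norm_num : _ ≤ (5:ℝ))) (by norm_num) hX
    ?_ (by norm_num [kM]) (by linarith) ?_ ?_ ?_ ?_ ?_ ?_
  on_goal 3 => exact (show W1 ((1332:ℕ)/1024) (Pol f) ≤ _ from w1.trans (by norm_num [kM]))
  on_goal 5 => norm_num at w2; linarith
  all_goals norm_num [kM, Cst.bB, Cst.bA]
  all_goals linarith

def wI : ℕ := 1315311271721
def tI : ℕ := 30624500
def tp : ℕ := 20275758
def yI : ℕ := 6 * 244996 * 2 ^ 27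
def ci : ℤ := -0x166b21b41c563bf2350e82eff2cbb2d361a3346b8
def lP : List (ℕ × ℕ) := [105, 105, 105, 105, 105, 105, 105, 212, 974, 4268, 14010].map fun x => (450888, x)
def lM : List (ℕ × ℕ) := ([105, 105, 105, 105, 105, 105, 105, 321].map fun x => (450888, x)) ++ [(475004, 1524), (600834, 7648)]
def okU (x : Option Unit) : Bool := match x with
  | some _ => true
  | none => false
theorem okU_s {x : Option Unit} (h : okU x = true) : x = some () := by
  cases x with
  | none => cases h
  | some _ => rfl

theorem r1 : okU (sc (some (Fl, ul)) Fl ul fun _ _ => some ()) = true := by decide +kernel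
theorem r2 : okU (cenR 14 [SS + ci, ci] [(SS:ℤ), (SS:ℤ)]) = true := by decide +kernel
theorem r3 : okU (ch lP (st tp FU) ul 0 wI wI yI eP) = true := by decide +kernel
theorem r4 : okU (ch lM (st (-tI) FU) ul 0 0 (2 ^ 80) yI eM) = true := by decide +kernel
end FC

namespace FC
open Polynomial

theorem SC.stg' {F v F1 v1 : ℝ[X]} {lam θ : ℝ} (h : SC F v F1 v1 lam) (hθ : θ = (tI:ℝ)/2^50) :
    Stg F v F1 v1 (8 * θ) lam (1/100) (1/40) (1/500) (3/5) (θ/10^4) := by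
  have h1 : SOk F v F1 v1 lam (((450888:ℕ):ℝ)/2^20) (((14000:ℕ):ℝ)/2^20) (((2^46:ℕ):ℝ)/2^80) (θ/10^4) (((45:ℕ):ℝ)/10) :=
    { h.1 with res := h.1.res.trans (by rw [hθ]; norm_num [tI]) }
  refine h1.stg ?_ ?_ ?_ ?_ ?_ ?_ <;> rw [hθ] <;> norm_num [tI]

theorem fin_ex : ∃ D : Dat, D.Ok := by
  obtain ⟨f1, w1, lam0, h1, h2, -⟩ := sc_s (okU_s r1)
  obtain ⟨rfl, rfl⟩ := h2 _ rfl
  obtain ⟨cen, dir, lam, c0, d0, hc, ht⟩ := cenR_s h1 14 (okU_s r2)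
  obtain ⟨f', v', _, _, _, _, hk, hP, -⟩ := ch_s lP (Nat.zero_le _) (okU_s r3)
  have hP := hP (eP_s hk)
  obtain ⟨f'', v'', _, _, _, _, hk, -, hM⟩ := ch_s lM (Nat.zero_le _) (okU_s r4)
  have hM := hM (eM_s hk)
  have hS := SSr.ne'
  refine ⟨⟨cen, dir, lam, fun _ => 1/100, 15, lP.length, lM.length, (tI:ℝ)/2^50, (tp:ℝ)/2^50, (wI:ℝ)/2^80, (ci:ℝ)/SS,
    Pol Fl, Pol ul⟩, ?_⟩
  have cb : (ci:ℝ)/SS ≤ -1 ∧ -3/2 ≤ (ci:ℝ)/SS := by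
    rw [SS160]; norm_num [ci]
  refine ⟨fun k => (hc k).stg' rfl, fun k => by norm_num, fun k => ?_, fun k => ?_, fun k => ?_, ?_, ?_, ?_, ?_,
    ht, ?_, ?_, ?_, ?_, ?_, ?_, ?_⟩
  · show _ ≤ lam k - 1/100; linarith [(hc k).2.1]
  · show lam k + 1/100 ≤ _; linarith [(hc k).2.2]
  · exact (hc k).1.hnv.trans (by norm_num)
  · refine c0.trans ?_
    unfold fc
    rw [Pol_cons, Pol_cons, Pol_nil, Int.cast_add, Int.cast_natCast, add_div, div_self hS, C_add, C_1]
    ring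
  · refine d0.trans ?_
    rw [Pol_cons, Pol_cons, Pol_nil, Int.cast_natCast, div_self hS, C_1]; ring
  · show -2 < (ci:ℝ)/SS - (tI:ℝ)/2^50
    have : (tI:ℝ)/2^50 ≤ 1/10 := by norm_num [tI]
    linarith [cb.2]
  · show (ci:ℝ)/SS + (tI:ℝ)/2^50 < 0
    have : (tI:ℝ)/2^50 ≤ 1/10 := by norm_num [tI]
    linarith [cb.1]
  · norm_num [tp]
  · norm_num [tp, tI]
  · norm_num [tp, tI]
  · norm_num [wI]
  · norm_num [wI, tp]
  · show EndP _ (Pol Fl + C ((tp:ℝ)/2^50) * Pol ul) (Pol ul) 0 ((wI:ℝ)/2^80) ((wI:ℝ)/2^80) (6/1000 * ((tI:ℝ)/2^50))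
    have e := st_eq tp FU
    rw [Int.cast_natCast] at e
    have y : (6/1000 * ((tI:ℝ)/2^50)) = (yI:ℝ)/2^80 := by norm_num [tI, yI]
    rw [y]
    rw [e, Nat.cast_zero, zero_div] at hP
    exact hP
  · show EndM _ (Pol Fl - C ((tI:ℝ)/2^50) * Pol ul) (Pol ul) 0 (6/1000 * ((tI:ℝ)/2^50))
    have e := st_eq (-tI) FU
    rw [Int.cast_neg, Int.cast_natCast, neg_div, C_neg, neg_mul, ← sub_eq_add_neg] at e
    have y : (6/1000 * ((tI:ℝ)/2^50)) = (yI:ℝ)/2^80 := by norm_num [tI, yI]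
    rw [y]
    rw [e, Nat.cast_zero, zero_div] at hM
    exact hM
end FC

end

/-- **Feigenbaum's parameter scaling law** for the period-doubling cascade of the quadratic
family: `c_n > c_F` for all `n`, and there exist `λ > 1` and `b > 0` with
`λⁿ (c_n − c_F) → b`, i.e. `c_n − c_F ∼ b λ⁻ⁿ`. -/
theorem feigenbaum_parameter_scaling :
    (∀ n : ℕ, feigenbaumValue < doublingSuperattracting n) ∧
    ∃ lam b : ℝ, 1 < lam ∧ 0 < b ∧
      Tendsto (fun n : ℕ => lam ^ n * (doublingSuperattracting n - feigenbaumValue))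
        atTop (nhds b) := by
  obtain ⟨D, h⟩ := FC.fin_ex
  obtain ⟨lam, b, h1, h2, h3⟩ := h.final
  exact FB.reduction h1 h2 h3
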